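/- arXiv:1412.3960 — 2 statements merged into one kernel-verified Lean document; each statement's English description precedes it below -/
import Mathlib

section
/- Let U be a box in ℤ^d (d ≥ 3) and let A be a nonempty subset of U. Then: (i) the equilibrium measure e_A and the relative equilibrium measure e_{A,U} have the same support; (ii) for all y ∈ ℤ^d, e_A(y) ≤ e_{A,U}(y) ≤ e_A(y)/p, where p = inf_{x∈∂U} P_x[H_A = ∞]; and (iii) there is a constant c > 0 depending only on d such that p > max(0, 1 − c·cap(A)/d(A, ℤ^d∖U)^{d−2}); in particular p > 0. -/
open MeasureTheory ENNReal Set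
open scoped Classical NNReal

namespace Disconnection

/-- Points of `ℤ^d`. -/
abbrev Zd (d : ℕ) := Fin d → ℤ

/-- Step distribution of the simple random walk: uniform weight `1/(2d)` on each of the
`2d` unit vectors of `ℤ^d`. -/
noncomputable def stepP (d : ℕ) (v : Zd d) : ℝ≥0∞ :=
  if (∑ i, (v i).natAbs) = 1 then ((2 * d : ℕ) : ℝ≥0∞)⁻¹ else 0

/-- The exponential distribution of rate `1` on `[0,∞)` (as a measure on `ℝ`). -/
noncomputable def expMeasure : Measure ℝ :=
  MeasureTheory.volume.withDensity fun t => ENNReal.ofReal (if 0 < t then Real.exp (-t) else 0)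

/-- Nearest neighbours in `ℤ^d` (Euclidean distance one). -/
def adjacent {d : ℕ} (x y : Zd d) : Prop := (∑ i, (x i - y i).natAbs) = 1

/-- (Outer) boundary `∂A` of a set `A ⊆ ℤ^d`. -/
def bdry {d : ℕ} (A : Set (Zd d)) : Set (Zd d) := {y | y ∉ A ∧ ∃ x ∈ A, adjacent x y}

/-- sup-norm distance between two points of `ℤ^d`. -/
def supDist {d : ℕ} (x y : Zd d) : ℕ := Finset.univ.sup fun i => (x i - y i).natAbs

/-- closed sup-norm ball `B(x,r)` in `ℤ^d`. -/
def ball {d : ℕ} (x : Zd d) (r : ℕ) : Set (Zd d) := {y | supDist x y ≤ r}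

/-- mutual sup-norm distance between two sets. -/
noncomputable def setDist {d : ℕ} (A B : Set (Zd d)) : ℕ := sInf {n | ∃ x ∈ A, ∃ y ∈ B, supDist x y = n}

/-- the box `ℤ^d ∩ [a,b)^d`. -/
def intBox {d : ℕ} (a b : ℤ) : Set (Zd d) := {y | ∀ i, a ≤ y i ∧ y i < b}

/-- A box in `ℤ^d`: a translate of `[0,L)^d ∩ ℤ^d` with `L ≥ 1`. -/
def isBox {d : ℕ} (S : Set (Zd d)) : Prop :=
  ∃ L : ℕ, 1 ≤ L ∧ ∃ a : Zd d, S = {y | ∀ i, a i ≤ y i ∧ y i < a i + L}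

/-- connectedness of a subset of `ℤ^d` by nearest-neighbour paths. -/
def connSet {d : ℕ} (S : Set (Zd d)) : Prop :=
  ∀ a ∈ S, ∀ b ∈ S, ∃ (n : ℕ) (f : ℕ → Zd d), f 0 = a ∧ f n = b ∧
    (∀ k ≤ n, f k ∈ S) ∧ ∀ k < n, adjacent (f k) (f (k + 1))

/-- Euclidean norm of a lattice point. -/
noncomputable def eucNorm {d : ℕ} (x : Zd d) : ℝ := Real.sqrt (∑ i, ((x i : ℝ)) ^ 2)

/-- A model of the continuous-time simple random walk on `ℤ^d` with unit jump rate: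
`Y` is the discrete jump chain and `ζ` are the holding times; under `P x` one has
`Y 0 = x` a.s., and the increments of `Y` together with the holding times are mutually
independent, the increments uniform on the `2d` unit vectors and the holding times
exponential of rate `1`.  This is expressed through the finite-dimensional cylinder
probabilities, which determine the joint law. -/
structure SRW (d : ℕ) (Ω : Type*) [MeasurableSpace Ω] where
  P : Zd d → Measure Ω
  isProb : ∀ x, IsProbabilityMeasure (P x)
  Y : ℕ → Ω → Zd d
  ζ : ℕ → Ω → ℝ
  measurable_Y : ∀ n, Measurable (Y n)
  measurable_ζ : ∀ n, Measurable (ζ n)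
  Y_zero : ∀ x : Zd d, P x {ω | Y 0 ω = x} = 1
  law : ∀ (x : Zd d) (n : ℕ) (s : Fin n → Zd d) (I : Fin n → Set ℝ),
    (∀ i, MeasurableSet (I i)) →
    P x {ω | (∀ i : Fin n, Y ((i : ℕ) + 1) ω - Y (i : ℕ) ω = s i) ∧
             (∀ i : Fin n, ζ (i : ℕ) ω ∈ I i)}
      = (∏ i, stepP d (s i)) * ∏ i, expMeasure (I i)

namespace SRW

variable {d : ℕ} {Ω : Type*} [MeasurableSpace Ω]

/-- time of the `n`-th jump. -/
noncomputable def S (W : SRW d Ω) (n : ℕ) (ω : Ω) : ℝ := ∑ i ∈ Finset.range n, W.ζ i ω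

/-- index of the current step of the jump chain at time `t`. -/
noncomputable def jumpIdx (W : SRW d Ω) (t : ℝ) (ω : Ω) : ℕ := sSup {k : ℕ | W.S k ω ≤ t}

/-- the continuous-time walk `X_t`. -/
noncomputable def X (W : SRW d Ω) (t : ℝ) (ω : Ω) : Zd d := W.Y (W.jumpIdx t ω) ω

/-- entrance time of `A` after time `t` (`∞` if there is none). -/
noncomputable def hitFrom (W : SRW d Ω) (A : Set (Zd d)) (t : ℝ≥0∞) (ω : Ω) : ℝ≥0∞ :=
  sInf {u : ℝ≥0∞ | ∃ s : ℝ≥0, u = (s : ℝ≥0∞) ∧ t ≤ u ∧ W.X (s : ℝ) ω ∈ A}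

/-- entrance time `H_A = inf {t ≥ 0 : X_t ∈ A}`. -/
noncomputable def hit (W : SRW d Ω) (A : Set (Zd d)) (ω : Ω) : ℝ≥0∞ := W.hitFrom A 0 ω

/-- exit time `T_U = inf {t ≥ 0 : X_t ∉ U}`. -/
noncomputable def exit (W : SRW d Ω) (U : Set (Zd d)) (ω : Ω) : ℝ≥0∞ := W.hit Uᶜ ω

/-- hitting time `H̃_A = inf {t ≥ ζ₀ : X_t ∈ A}`. -/
noncomputable def hitTilde (W : SRW d Ω) (A : Set (Zd d)) (ω : Ω) : ℝ≥0∞ :=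
  W.hitFrom A (ENNReal.ofReal (W.ζ 0 ω)) ω

/-- the walk evaluated at a random (possibly infinite) time. -/
noncomputable def Xat (W : SRW d Ω) (τ : Ω → ℝ≥0∞) (ω : Ω) : Zd d := W.X (τ ω).toReal ω

/-- equilibrium measure `e_A(x) = P_x[H̃_A = ∞] 1_A(x)`. -/
noncomputable def eqm (W : SRW d Ω) (A : Set (Zd d)) (x : Zd d) : ℝ :=
  if x ∈ A then (W.P x {ω | W.hitTilde A ω = ⊤}).toReal else 0

/-- capacity `cap(A) = Σ_x e_A(x)`. -/
noncomputable def cap (W : SRW d Ω) (A : Set (Zd d)) : ℝ := ∑ᶠ x, W.eqm A x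

/-- normalized equilibrium measure `ē_A = e_A / cap(A)`. -/
noncomputable def ebar (W : SRW d Ω) (A : Set (Zd d)) (x : Zd d) : ℝ := W.eqm A x / W.cap A

/-- equilibrium measure of `A` relative to `U`: `e_{A,U}(x) = P_x[H̃_A > T_U] 1_A(x)`. -/
noncomputable def eqmRel (W : SRW d Ω) (A U : Set (Zd d)) (x : Zd d) : ℝ :=
  if x ∈ A then (W.P x {ω | W.exit U ω < W.hitTilde A ω}).toReal else 0

/-- `P_ρ = Σ_x ρ(x) P_x`, the walk started from the initial (sub-)measure with density `ρ`. -/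
noncomputable def Pinit (W : SRW d Ω) (ρ : Zd d → ℝ) : Measure Ω :=
  Measure.sum fun x : Zd d => ENNReal.ofReal (ρ x) • W.P x

/-- Green function `g(x,y) = E_x[∫₀^∞ 1{X_s = y} ds]`. -/
noncomputable def green (W : SRW d Ω) (x y : Zd d) : ℝ :=
  ∫ ω, (∫ s in Set.Ioi (0 : ℝ), if W.X s ω = y then (1 : ℝ) else 0) ∂ W.P x

/-- killed Green function `g_U(x,y) = E_x[∫₀^{T_U} 1{X_s = y} ds]`. -/
noncomputable def greenK (W : SRW d Ω) (U : Set (Zd d)) (x y : Zd d) : ℝ :=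
  ∫ ω, (∫ s in Set.Ioi (0 : ℝ),
      if ENNReal.ofReal s < W.exit U ω ∧ W.X s ω = y then (1 : ℝ) else 0) ∂ W.P x

/-- the potential operator `Gf(x) = Σ_y g(x,y) f(y)`. -/
noncomputable def Gop (W : SRW d Ω) (f : Zd d → ℝ) (x : Zd d) : ℝ :=
  ∑ᶠ y, W.green x y * f y

/-- successive return times to `A` (between excursions out of `U`): `Rt A U 0 = R₁ = H_A`. -/
noncomputable def Rt (W : SRW d Ω) (A U : Set (Zd d)) : ℕ → Ω → ℝ≥0∞
  | 0 => W.hit A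
  | k + 1 => fun ω => W.hitFrom A (W.hitFrom Uᶜ (W.Rt A U k ω) ω) ω

/-- successive departure times from `U`: `Dt A U k = D_{k+1}`. -/
noncomputable def Dt (W : SRW d Ω) (A U : Set (Zd d)) (k : ℕ) (ω : Ω) : ℝ≥0∞ :=
  W.hitFrom Uᶜ (W.Rt A U k ω) ω

/-- number of excursions from `A` to the complement of `U`:
`N_{A,U} = sup {k ≥ 1 : D_k < ∞}` (with `sup ∅ = 0`). -/
noncomputable def Nexc (W : SRW d Ω) (A U : Set (Zd d)) (ω : Ω) : ℕ :=
  sSup {n | 0 < n ∧ W.Dt A U (n - 1) ω < ⊤}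

end SRW

end Disconnection

open Disconnection


lemma rch2 (a : ℝ) : Ring.choose (-a) 2 = a * (a+1) / 2 := by
  have h := Ring.descPochhammer_eq_factorial_smul_choose (-a) 2
  simp [descPochhammer_succ_right, Polynomial.smeval_mul, 
    Nat.factorial, Polynomial.smeval_sub, Polynomial.smeval_X] at h
  linarith

lemma bcoef (a : ℝ) (n : ℕ) : (binomialSeries ℝ a).coeff n = Ring.choose a n := by
  unfold FormalMultilinearSeries.coeff
  rw [binomialSeries_apply]
  simp [List.prod_ofFn]

lemma taylor_even (a : ℝ) : ∃ C : ℝ, 0 < C ∧ ∃ δ : ℝ, 0 < δ ∧ ∀ u : ℝ, |u| < δ →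
    (1 + u) ^ (-a) + (1 - u) ^ (-a) ≤ 2 + a * (a+1) * u^2 + C * u^4 := by
  have h := (Real.one_add_rpow_hasFPowerSeriesAt_zero (a := -a)).isBigO_sub_partialSum_pow 4
  obtain ⟨C, hC, hb⟩ := h.exists_pos
  rw [Asymptotics.isBigOWith_iff, Metric.eventually_nhds_iff] at hb
  obtain ⟨δ, hδ, hb⟩ := hb
  refine ⟨2 * C, by positivity, δ, hδ, fun u hu => ?_⟩
  have h1 := hb (y := u) (by simpa using hu)
  have h2 := hb (y := -u) (by simpa using hu)
  simp [FormalMultilinearSeries.partialSum, Finset.sum_range_succ, bcoef, rch2] at h1 h2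
  have e : |u|^4 = u^4 := by
    rw [show 4 = 2 * 2 from rfl, pow_mul, sq_abs, pow_mul]
  rw [e] at h1 h2
  have h1' := (abs_le.1 h1).2
  have h2' := (abs_le.1 h2).2
  ring_nf at h1' h2' ⊢
  linarith

noncomputable def N2 {d : ℕ} (x : Fin d → ℤ) : ℝ := ∑ i, (x i : ℝ)^2

lemma N2_nonneg {d : ℕ} (x : Fin d → ℤ) : 0 ≤ N2 x := Finset.sum_nonneg fun _ _ => sq_nonneg _

lemma N2_ge {d : ℕ} (x : Fin d → ℤ) (i : Fin d) : (x i : ℝ)^2 ≤ N2 x :=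
  Finset.single_le_sum (f := fun i => (x i : ℝ)^2) (fun _ _ => sq_nonneg _) (Finset.mem_univ i)

lemma N2_add_single {d : ℕ} (x : Fin d → ℤ) (i : Fin d) (e : ℤ) (he : e^2 = 1) :
    N2 (x + Pi.single i e) = N2 x + 2 * e * x i + 1 := by
  have h : ∀ j, (((x + Pi.single i e : Fin d → ℤ) j : ℤ) : ℝ)^2 = (x j : ℝ)^2 +
      if j = i then (2 * e * x i + 1 : ℝ) else 0 := by
    intro j
    have he' : (e : ℝ)^2 = 1 := by exact_mod_cast he
    by_cases hj : j = i
    · subst hj; simp; linear_combination he'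
    · simp [hj]
  unfold N2
  simp_rw [h, Finset.sum_add_distrib]
  simp; ring

lemma bern (a s : ℝ) (ha : 0 ≤ a) (hs : 1 < s) : s ^ (-a) * (1 + a / s) ≤ (s - 1) ^ (-a) := by
  have hs0 : 0 < s := by linarith
  have h1 : (s - 1) = s * (1 - 1/s) := by field_simp
  have h2 : 0 < 1 - 1/s := by
    rw [sub_pos, div_lt_one hs0]; exact hs
  rw [h1, Real.mul_rpow hs0.le h2.le]
  gcongr
  rw [Real.rpow_def_of_pos h2]
  have h3 := Real.log_le_sub_one_of_pos h2
  have h4 := Real.add_one_le_exp (Real.log (1 - 1/s) * -a)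
  have h5 : a / s ≤ Real.log (1 - 1/s) * -a := by
    have : a / s = (1/s) * a := by ring
    nlinarith
  linarith

lemma superharm {d : ℕ} (hd : 3 ≤ d) : ∃ K : ℝ, 1 ≤ K ∧ ∀ x : Fin d → ℤ,
    ∑ i, ((N2 (x + Pi.single i 1) + K) ^ (-(((d:ℝ) - 2)/2)) +
      (N2 (x + Pi.single i (-1)) + K) ^ (-(((d:ℝ) - 2)/2)))
      ≤ 2 * d * (N2 x + K) ^ (-(((d:ℝ) - 2)/2)) := by
  have hd' : (3:ℝ) ≤ d := by exact_mod_cast hd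
  obtain ⟨a, haeq⟩ : ∃ a : ℝ, a = ((d:ℝ) - 2)/2 := ⟨_, rfl⟩
  have ha : 0 < a := by rw [haeq]; linarith
  have hda : (d : ℝ) = 2 * (a + 1) := by rw [haeq]; ring
  obtain ⟨C, hC, δ, hδ, hT⟩ := taylor_even a
  rw [← haeq]
  refine ⟨1 + 1/δ^2 + 16 * C / (2 * d * a), ?_, fun x => ?_⟩
  · have : 0 ≤ 1/δ^2 := by positivity
    have : 0 ≤ 16 * C / (2 * d * a) := by positivity
    linarith
  set K := 1 + 1/δ^2 + 16 * C / (2 * d * a) with hK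
  have hK1 : 1/δ^2 < K := by
    have : 0 ≤ 16 * C / (2 * d * a) := by positivity
    linarith
  have hK2 : 16 * C ≤ 2 * d * a * K := by
    have : 0 ≤ 1/δ^2 := by positivity
    have h : 16 * C / (2 * d * a) ≤ K := by linarith
    rwa [div_le_iff₀' (by positivity)] at h
  have hK0 : 0 < K := lt_of_le_of_lt (by positivity) hK1
  clear_value K
  have hN := N2_nonneg x
  set s := N2 x + K + 1 with hs
  have hs1 : 1 < s := by linarith
  have hs0 : 0 < s := by linarith
  have key : ∀ i, (N2 (x + Pi.single i 1) + K) ^ (-a) + (N2 (x + Pi.single i (-1)) + K) ^ (-a)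
      ≤ s ^ (-a) * (2 + (a * (a+1) * (4 / s^2) + C * (16 / s^3)) * (x i : ℝ)^2) := by
    intro i
    have hi := N2_ge x i
    set u : ℝ := 2 * x i / s with hu
    have e1 : N2 (x + Pi.single i 1) + K = s * (1 + u) := by
      rw [N2_add_single x i 1 (by norm_num), hu]; field_simp; push_cast; rw [hs]; ring
    have e2 : N2 (x + Pi.single i (-1)) + K = s * (1 - u) := by
      rw [N2_add_single x i (-1) (by norm_num), hu]; field_simp; push_cast; rw [hs]; ring
    have p1 : 0 ≤ 1 + u := by
      have : 0 ≤ s * (1+u) := by rw [← e1]; linarith [N2_nonneg (x + Pi.single i 1)]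
      exact nonneg_of_mul_nonneg_right this hs0
    have p2 : 0 ≤ 1 - u := by
      have : 0 ≤ s * (1-u) := by rw [← e2]; linarith [N2_nonneg (x + Pi.single i (-1))]
      exact nonneg_of_mul_nonneg_right this hs0
    rw [e1, e2, Real.mul_rpow hs0.le p1, Real.mul_rpow hs0.le p2, ← mul_add]
    have hud : |u| < δ := by
      rw [hu, abs_div, abs_of_pos hs0, div_lt_iff₀ hs0, abs_mul, abs_two]
      have h1 : 1 < δ * (δ * K) := by
        rw [div_lt_iff₀ (by positivity)] at hK1; linarith
      have h2 : (x i : ℝ)^2 = |(x i : ℝ)|^2 := (sq_abs _).symm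
      have h3 : |(x i : ℝ)|^2 + K < s := by rw [← h2]; linarith
      have h4 : 2 * |(x i : ℝ)| * δ ≤ δ^2 * |(x i : ℝ)|^2 + 1 := by
        nlinarith [sq_nonneg (δ * |(x i : ℝ)| - 1)]
      have h5 : 2 * |(x i : ℝ)| * δ < (δ * s) * δ := by nlinarith [mul_pos hδ hδ]
      exact lt_of_mul_lt_mul_right h5 hδ.le
    refine mul_le_mul_of_nonneg_left ((hT u hud).trans ?_) (by positivity)
    have u2 : u^2 = (4 / s^2) * (x i : ℝ)^2 := by rw [hu]; ring
    have u4 : u^4 ≤ (16 / s^3) * (x i : ℝ)^2 := by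
      have : u^4 = (16 / s^3) * (x i : ℝ)^2 * ((x i : ℝ)^2 / s) := by rw [hu]; field_simp; ring
      rw [this]
      apply mul_le_of_le_one_right (by positivity)
      rw [div_le_one hs0]; linarith
    rw [u2]
    nlinarith
  refine (Finset.sum_le_sum fun i _ => key i).trans ?_
  rw [← Finset.mul_sum, Finset.sum_add_distrib, ← Finset.mul_sum]
  have hb := bern a s ha.le hs1
  have e3 : s - 1 = N2 x + K := by rw [hs]; ring
  rw [e3] at hb
  refine le_trans ?_ (mul_le_mul_of_nonneg_left hb (by positivity : (0:ℝ) ≤ 2 * d))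
  rw [mul_left_comm]
  refine mul_le_mul_of_nonneg_left ?_ (by positivity)
  change _ + _ * N2 x ≤ _
  simp only [Finset.sum_const, Finset.card_univ, Fintype.card_fin, nsmul_eq_mul]
  have : (a * (a+1) * (4 / s^2) + C * (16 / s^3)) * N2 x ≤ 2 * d * (a / s) := by
    have e5 : (a * (a+1) * (4 / s^2) + C * (16 / s^3)) * N2 x =
      (2 * d * a * N2 x + 16 * C * (N2 x / s)) / s^2 := by rw [hda]; field_simp; ring
    have e6 : 2 * d * (a / s) = (2 * d * a * s) / s^2 := by field_simp
    rw [e5, e6]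
    gcongr
    have : N2 x / s ≤ 1 := by rw [div_le_one hs0]; linarith
    have h7 : 16 * C * (N2 x / s) ≤ 16 * C := mul_le_of_le_one_right (by positivity) this
    have h8 : 0 < 2 * d * a := by positivity
    have : 2 * d * a * s = 2 * d * a * N2 x + 2 * d * a * K + 2 * d * a := by rw [hs]; ring
    linarith
  linarith

namespace Disconnection
variable {d : ℕ} {Ω : Type*} [MeasurableSpace Ω]

lemma expMeasure_Ioi : expMeasure (Ioi 0) = 1 := by
  unfold expMeasure
  rw [withDensity_apply _ measurableSet_Ioi]
  have : ∫⁻ t in Ioi (0:ℝ), ENNReal.ofReal (if 0 < t then Real.exp (-t) else 0)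
      = ∫⁻ t in Ioi (0:ℝ), ENNReal.ofReal (Real.exp (-t)) := by
    apply setLIntegral_congr_fun measurableSet_Ioi
    intro t ht
    have : (0:ℝ) < t := ht
    simp [this]
  rw [this, ← ofReal_integral_eq_lintegral_ofReal]
  · rw [integral_exp_neg_Ioi_zero]; simp
  · exact integrableOn_exp_neg_Ioi 0
  · exact Filter.Eventually.of_forall fun t => (Real.exp_pos _).le

lemma expMeasure_univ : expMeasure univ = 1 := by
  have h : expMeasure (Iic 0) = 0 := by
    unfold expMeasure
    rw [withDensity_apply _ measurableSet_Iic]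
    have : ∫⁻ t in Iic (0:ℝ), ENNReal.ofReal (if 0 < t then Real.exp (-t) else 0)
      = ∫⁻ t in Iic (0:ℝ), 0 := by
      apply setLIntegral_congr_fun measurableSet_Iic
      intro t ht
      have : ¬ (0:ℝ) < t := not_lt.2 ht
      simp [this]
    rw [this]; simp
  rw [← Iic_union_Ioi (a := (0:ℝ)), measure_union (by simp) measurableSet_Ioi, h, expMeasure_Ioi]; simp

lemma expMeasure_Ioo : expMeasure (Iio 1) < 1 := by
  have h1 : expMeasure (Ici 1) ≠ 0 := by
    unfold expMeasure
    rw [withDensity_apply _ measurableSet_Ici]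
    refine (lt_of_lt_of_le ?_ (setLIntegral_mono' (f := fun t => ENNReal.ofReal (Real.exp (-t))) measurableSet_Ici ?_)).ne'
    · rw [setLIntegral_pos_iff (by fun_prop)]
      have : Function.support (fun t : ℝ => ENNReal.ofReal (Real.exp (-t))) = univ := by
        ext t; simp [Real.exp_pos]
      rw [this]; simp
    · intro t ht
      have : (0:ℝ) < t := lt_of_lt_of_le one_pos ht
      simp [this]
  have h2 : expMeasure (Iio 1) + expMeasure (Ici 1) = 1 := by
    rw [← measure_union (by simp) measurableSet_Ici, Iio_union_Ici, expMeasure_univ]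
  have h3 : expMeasure (Iio 1) ≠ ⊤ := by
    intro h; rw [h] at h2; simp at h2
  rw [← h2]
  exact ENNReal.lt_add_right h3 h1

namespace SRW
variable (W : SRW d Ω)

instance (x : Zd d) : IsProbabilityMeasure (W.P x) := W.isProb x

lemma law_Y (x : Zd d) (n : ℕ) (s : Fin n → Zd d) :
    W.P x {ω | ∀ i : Fin n, W.Y ((i : ℕ) + 1) ω - W.Y (i : ℕ) ω = s i} = ∏ i, stepP d (s i) := by
  have := W.law x n s (fun _ => univ) (fun _ => MeasurableSet.univ)
  simpa [expMeasure_univ] using this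

lemma tsum_fibers {β : Type*} [Countable β] [MeasurableSpace β] [MeasurableSingletonClass β]
    (μ : Measure Ω) {f : Ω → β} (hf : Measurable f) (E : Set Ω) (hE : MeasurableSet E) :
    ∑' b, μ {ω | f ω = b ∧ ω ∈ E} = μ E := by
  rw [← measure_iUnion]
  · congr 1; ext ω; simp
  · intro a b hab
    rw [Function.onFun, Set.disjoint_left]
    rintro ω ⟨h1, _⟩ ⟨h2, _⟩
    exact hab (h1.symm.trans h2)
  · intro b
    exact (hf (measurableSet_singleton b)).inter hE

lemma law_ζ (x : Zd d) (n : ℕ) (I : Fin n → Set ℝ) (hI : ∀ i, MeasurableSet (I i)) :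
    W.P x {ω | ∀ i : Fin n, W.ζ (i : ℕ) ω ∈ I i} = ∏ i, expMeasure (I i) := by
  have hm : MeasurableSet {ω | ∀ i : Fin n, W.ζ (i : ℕ) ω ∈ I i} := by
    rw [ofPred_forall]
    exact MeasurableSet.iInter fun i => W.measurable_ζ i (hI i)
  have hf : Measurable (fun ω (i : Fin n) => W.Y ((i : ℕ) + 1) ω - W.Y (i : ℕ) ω) :=
    measurable_pi_lambda _ fun i => (W.measurable_Y _).sub (W.measurable_Y _)
  have h1 := tsum_fibers (W.P x) hf _ hm
  have h2 := tsum_fibers (W.P x) hf univ MeasurableSet.univ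
  rw [← h1]
  have h3 : ∀ s : Fin n → Zd d, W.P x {ω | (fun (i : Fin n) => W.Y ((i : ℕ) + 1) ω - W.Y (i : ℕ) ω) = s ∧
      ω ∈ {ω | ∀ i : Fin n, W.ζ (i : ℕ) ω ∈ I i}} = (∏ i, stepP d (s i)) * ∏ i, expMeasure (I i) := by
    intro s; rw [← W.law x n s I hI]; congr 1; ext ω; simp [funext_iff]
  have h4 : ∀ s : Fin n → Zd d, W.P x {ω | (fun (i : Fin n) => W.Y ((i : ℕ) + 1) ω - W.Y (i : ℕ) ω) = s ∧
      ω ∈ univ} = (∏ i, stepP d (s i)) := by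
    intro s; rw [← W.law_Y x n s]; congr 1; ext ω; simp [funext_iff]
  rw [tsum_congr h3, ENNReal.tsum_mul_right, ← tsum_congr h4, h2]; simp

lemma stepP_sum (W : SRW d Ω) : ∑' s, stepP d s = 1 := by
  have h2 := tsum_fibers (W.P 0) ((W.measurable_Y 1).sub (W.measurable_Y 0)) univ MeasurableSet.univ
  rw [measure_univ] at h2
  rw [← h2]
  refine tsum_congr fun s => ?_
  have := W.law_Y 0 1 (fun _ => s)
  simp at this
  rw [← this]; congr 1; ext ω; simp

lemma ae_ζ_pos (x : Zd d) : ∀ᵐ ω ∂ W.P x, ∀ i, 0 < W.ζ i ω := by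
  rw [ae_all_iff]; intro i
  have h := W.law_ζ x (i+1) (fun _ => Ioi 0) (fun _ => measurableSet_Ioi)
  simp only [expMeasure_Ioi, Finset.prod_const_one] at h
  rw [← mem_ae_iff_prob_eq_one] at h
  · filter_upwards [h] with ω hω
    exact hω ⟨i, by omega⟩
  · rw [ofPred_forall]
    exact MeasurableSet.iInter fun i => W.measurable_ζ i measurableSet_Ioi

lemma ae_ζ_io (x : Zd d) : ∀ᵐ ω ∂ W.P x, ∀ N, ∃ i, N ≤ i ∧ 1 ≤ W.ζ i ω := by
  rw [ae_all_iff]; intro N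
  rw [ae_iff]
  have hb : ∀ k : ℕ, W.P x {ω | ¬ ∃ i, N ≤ i ∧ 1 ≤ W.ζ i ω} ≤ (expMeasure (Iio 1))^k := by
    intro k
    have h := W.law_ζ x (N+k) (fun i => if (i : ℕ) < N then univ else Iio 1) (by
      intro i; split_ifs
      · exact MeasurableSet.univ
      · exact measurableSet_Iio)
    rw [Fin.prod_univ_add] at h
    simp [expMeasure_univ] at h
    rw [← h]
    apply measure_mono
    intro ω hω i
    simp only [not_exists, not_and, not_le, mem_ofPred_eq] at hω
    exact fun hi => hω i hi
  have ht := ENNReal.tendsto_pow_atTop_nhds_zero_of_lt_one expMeasure_Ioo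
  exact le_antisymm (ge_of_tendsto' ht hb) bot_le

def Good (ω : Ω) : Prop := (∀ i, 0 < W.ζ i ω) ∧ ∀ N, ∃ i, N ≤ i ∧ 1 ≤ W.ζ i ω

lemma ae_good (x : Zd d) : ∀ᵐ ω ∂ W.P x, W.Good ω := by
  filter_upwards [W.ae_ζ_pos x, W.ae_ζ_io x] with ω h1 h2 using ⟨h1, h2⟩

variable {W}

lemma Good.S_mono {ω : Ω} (h : W.Good ω) : StrictMono (fun n => W.S n ω) := by
  apply strictMono_nat_of_lt_succ
  intro n
  simp only [S, Finset.sum_range_succ]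
  linarith [h.1 n]

lemma S_zero {ω : Ω} : W.S 0 ω = 0 := by simp [S]
lemma S_one {ω : Ω} : W.S 1 ω = W.ζ 0 ω := by simp [S]

lemma Good.S_nonneg {ω : Ω} (h : W.Good ω) (n : ℕ) : 0 ≤ W.S n ω := by
  rw [← S_zero (W := W) (ω := ω)]; exact h.S_mono.monotone (Nat.zero_le n)

lemma Good.S_unb {ω : Ω} (h : W.Good ω) (B : ℕ) : ∃ n, (B:ℝ) ≤ W.S n ω := by
  induction B with
  | zero => exact ⟨0, by simp [S]⟩
  | succ B ih =>
    obtain ⟨n, hn⟩ := ih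
    obtain ⟨i, hi, h1⟩ := h.2 n
    refine ⟨i+1, ?_⟩
    have := h.S_mono.monotone hi
    simp only [S, Finset.sum_range_succ] at this hn ⊢
    push_cast
    linarith

lemma Good.bdd {ω : Ω} (h : W.Good ω) (t : ℝ) : BddAbove {k : ℕ | W.S k ω ≤ t} := by
  obtain ⟨B, hB⟩ := exists_nat_gt t
  obtain ⟨n, hn⟩ := h.S_unb B
  refine ⟨n, fun k hk => ?_⟩
  by_contra hc
  have := h.S_mono.monotone (not_le.1 hc).le
  have hk' : W.S k ω ≤ t := hk
  linarith

lemma Good.S_jump {ω : Ω} (h : W.Good ω) {t : ℝ} (ht : 0 ≤ t) : W.S (W.jumpIdx t ω) ω ≤ t := 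
  Nat.sSup_mem (s := {k : ℕ | W.S k ω ≤ t}) ⟨0, by simpa [S] using ht⟩ (h.bdd t)

lemma Good.le_jump {ω : Ω} (h : W.Good ω) {t : ℝ} {n : ℕ} (hn : W.S n ω ≤ t) : n ≤ W.jumpIdx t ω :=
  le_csSup (h.bdd t) hn

lemma Good.X_S {ω : Ω} (h : W.Good ω) (n : ℕ) : W.X (W.S n ω) ω = W.Y n ω := by
  have : W.jumpIdx (W.S n ω) ω = n := by
    apply le_antisymm
    · exact h.S_mono.le_iff_le.1 (h.S_jump (h.S_nonneg n))
    · exact h.le_jump le_rfl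
  rw [X, this]

lemma Good.hit_eq_top {ω : Ω} (h : W.Good ω) (A : Set (Zd d)) :
    W.hit A ω = ⊤ ↔ ∀ n, W.Y n ω ∉ A := by
  unfold hit hitFrom
  rw [sInf_eq_top]
  constructor
  · intro H n hn
    have := H (ENNReal.ofReal (W.S n ω)) ⟨(W.S n ω).toNNReal, rfl, bot_le, by
      rw [Real.coe_toNNReal _ (h.S_nonneg n), h.X_S]; exact hn⟩
    simp at this
  · rintro H u ⟨s, rfl, -, hs⟩
    exact absurd hs (H _)

lemma Good.hitTilde_eq_top {ω : Ω} (h : W.Good ω) (A : Set (Zd d)) :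
    W.hitTilde A ω = ⊤ ↔ ∀ n, W.Y (n+1) ω ∉ A := by
  unfold hitTilde hitFrom
  rw [sInf_eq_top]
  constructor
  · intro H n hn
    have := H (ENNReal.ofReal (W.S (n+1) ω)) ⟨(W.S (n+1) ω).toNNReal, rfl, by
      rw [← S_one]
      exact ENNReal.ofReal_le_ofReal (h.S_mono.monotone (by omega)), by
      rw [Real.coe_toNNReal _ (h.S_nonneg _), h.X_S]; exact hn⟩
    simp at this
  · rintro H u ⟨s, rfl, h1, hs⟩
    have h2 : W.S 1 ω ≤ s := by
      rw [S_one]; rw [ENNReal.ofReal_le_coe] at h1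
      exact h1
    have h3 := h.le_jump h2
    obtain ⟨m, hm⟩ := Nat.exists_eq_add_of_le' h3
    unfold X at hs
    rw [hm] at hs
    exact absurd hs (H _)

lemma Good.exit_lt {ω : Ω} (h : W.Good ω) (A U : Set (Zd d)) :
    W.exit U ω < W.hitTilde A ω ↔ ∃ n, W.Y n ω ∉ U ∧ ∀ m, 1 ≤ m → m ≤ n → W.Y m ω ∉ A := by
  constructor
  · intro H
    unfold exit hit hitFrom at H
    rw [sInf_lt_iff] at H
    obtain ⟨u, ⟨s, rfl, -, hs⟩, hu⟩ := H
    refine ⟨W.jumpIdx s ω, hs, fun m hm1 hm2 hmA => ?_⟩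
    refine absurd hu (not_lt.2 ?_)
    have hSm : W.S m ω ≤ s := (h.S_mono.monotone hm2).trans (h.S_jump s.2)
    refine le_trans (sInf_le (a := ENNReal.ofReal (W.S m ω)) ⟨(W.S m ω).toNNReal, rfl, ?_, ?_⟩) ?_
    · rw [← S_one]
      exact ENNReal.ofReal_le_ofReal (h.S_mono.monotone hm1)
    · rw [Real.coe_toNNReal _ (h.S_nonneg _), h.X_S]; exact hmA
    · rw [ENNReal.ofReal_le_coe]; exact hSm
  · rintro ⟨n, hn, H⟩
    have h1 : W.exit U ω ≤ ENNReal.ofReal (W.S n ω) := by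
      refine sInf_le ⟨(W.S n ω).toNNReal, rfl, bot_le, ?_⟩
      rw [Real.coe_toNNReal _ (h.S_nonneg n), h.X_S]; exact hn
    have h2 : ENNReal.ofReal (W.S (n+1) ω) ≤ W.hitTilde A ω := by
      refine le_sInf ?_
      rintro u ⟨s, rfl, h1, hs⟩
      have h2 : W.S 1 ω ≤ s := by
        rw [S_one]; rw [ENNReal.ofReal_le_coe] at h1
        exact h1
      have h3 := h.le_jump h2
      have h4 : n < W.jumpIdx s ω := by
        by_contra hc
        exact H _ h3 (not_lt.1 hc) hs
      rw [ENNReal.ofReal_le_coe]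
      exact (h.S_mono.monotone h4).trans (h.S_jump s.2)
    refine lt_of_le_of_lt h1 (lt_of_lt_of_le ?_ h2)
    rw [ENNReal.ofReal_lt_ofReal_iff_of_nonneg (h.S_nonneg n)]
    exact h.S_mono (Nat.lt_succ_self n)

end SRW
end Disconnection

namespace Disconnection
variable {d : ℕ} {Ω : Type*} [MeasurableSpace Ω]

/-- cylinder sets of path space -/
def cyl (n : ℕ) (y : ℕ → Zd d) : Set (ℕ → Zd d) := {p | ∀ i ≤ n, p i = y i}

def shiftP (p : ℕ → Zd d) : ℕ → Zd d := fun n => p (n + 1)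

lemma meas_coord (n : ℕ) (B : Set (Zd d)) : MeasurableSet {p : ℕ → Zd d | p n ∈ B} :=
  measurable_pi_apply n (MeasurableSet.of_discrete (s := B))

lemma meas_shiftP : Measurable (shiftP (d := d)) :=
  measurable_pi_lambda _ fun n => measurable_pi_apply (n+1)

lemma meas_cyl (n : ℕ) (y : ℕ → Zd d) : MeasurableSet (cyl n y) := by
  have : cyl n y = ⋂ i ∈ Finset.range (n+1), {p : ℕ → Zd d | p i ∈ ({y i} : Set (Zd d))} := by
    ext p; simp [cyl]
  rw [this]
  exact Finset.measurableSet_biInter _ fun i _ => meas_coord i _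

lemma cyl_pi : IsPiSystem {C : Set (ℕ → Zd d) | ∃ n y, C = cyl n y} := by
  rintro _ ⟨n, y, rfl⟩ _ ⟨m, z, rfl⟩ ⟨w, hw1, hw2⟩
  refine ⟨max n m, w, ?_⟩
  ext p
  constructor
  · rintro ⟨h1, h2⟩ i hi
    rcases le_max_iff.1 hi with h | h
    · rw [h1 i h, hw1 i h]
    · rw [h2 i h, hw2 i h]
  · intro h
    exact ⟨fun i hi => by rw [h i (hi.trans (le_max_left _ _)), hw1 i hi],
      fun i hi => by rw [h i (hi.trans (le_max_right _ _)), hw2 i hi]⟩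

lemma cyl_gen : (MeasurableSpace.pi : MeasurableSpace (ℕ → Zd d)) =
    MeasurableSpace.generateFrom {C : Set (ℕ → Zd d) | ∃ n y, C = cyl n y} := by
  apply le_antisymm
  · refine iSup_le fun n => ?_
    rintro _ ⟨v, -, rfl⟩
    have : (fun p : ℕ → Zd d => p n) ⁻¹' v = ⋃ y : {y : Fin (n+1) → Zd d // y (Fin.last n) ∈ v},
        cyl n (fun i => if h : i < n + 1 then y.1 ⟨i, h⟩ else 0) := by
      ext p
      simp only [mem_preimage, mem_iUnion]
      constructor
      · intro h
        refine ⟨⟨fun i => p i, by simpa using h⟩, fun i hi => ?_⟩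
        simp [Nat.lt_succ_of_le hi]
      · rintro ⟨⟨y, hy⟩, h⟩
        have := h n le_rfl
        rw [this]
        simpa [Fin.last] using hy
    rw [this]
    exact MeasurableSet.iUnion fun y => MeasurableSpace.measurableSet_generateFrom ⟨n, _, rfl⟩
  · apply MeasurableSpace.generateFrom_le
    rintro _ ⟨n, y, rfl⟩
    exact meas_cyl n y

namespace SRW
variable (W : SRW d Ω)

lemma meas_path : Measurable (fun ω n => W.Y n ω) := measurable_pi_lambda _ W.measurable_Y

noncomputable def nu (x : Zd d) : Measure (ℕ → Zd d) := (W.P x).map (fun ω n => W.Y n ω)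

instance (x : Zd d) : IsProbabilityMeasure (W.nu x) :=
  Measure.isProbabilityMeasure_map W.meas_path.aemeasurable

lemma nu_apply (x : Zd d) {B : Set (ℕ → Zd d)} (hB : MeasurableSet B) :
    W.nu x B = W.P x {ω | (fun n => W.Y n ω) ∈ B} :=
  Measure.map_apply W.meas_path hB

lemma ae_zero (x : Zd d) : ∀ᵐ p ∂ W.nu x, p 0 = x := by
  have : {p : ℕ → Zd d | p 0 ∈ ({x} : Set (Zd d))} ∈ ae (W.nu x) := by
    rw [mem_ae_iff_prob_eq_one (meas_coord 0 _), W.nu_apply x (meas_coord 0 _)]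
    exact W.Y_zero x
  exact this

lemma nu_cyl (x : Zd d) (n : ℕ) (y : ℕ → Zd d) (h0 : y 0 = x) :
    W.nu x (cyl n y) = ∏ i ∈ Finset.range n, stepP d (y (i+1) - y i) := by
  rw [W.nu_apply x (meas_cyl n y), Finset.prod_range, ← W.law_Y x n]
  apply measure_congr
  have h : ∀ᵐ ω ∂ W.P x, W.Y 0 ω = x := by
    have := W.Y_zero x
    exact (mem_ae_iff_prob_eq_one (W.measurable_Y 0 (measurableSet_singleton x))).2 this
  filter_upwards [h] with ω hω
  apply propext
  change (∀ i ≤ n, W.Y i ω = y i) ↔ ∀ i : Fin n, W.Y ((i : ℕ) + 1) ω - W.Y (i : ℕ) ω = y (i+1) - y i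
  constructor
  · intro H i
    rw [H _ (by omega), H _ (by omega)]
  · intro H i
    induction i with
    | zero => intro _; rw [hω, h0]
    | succ i ih =>
      intro hi
      have h1 := ih (by omega)
      have h2 := H ⟨i, by omega⟩
      simp only [h1] at h2
      exact sub_left_injective h2

lemma nu_cyl_ne (x : Zd d) (n : ℕ) (y : ℕ → Zd d) (h0 : y 0 ≠ x) :
    W.nu x (cyl n y) = 0 := by
  have := W.ae_zero x
  rw [ae_iff] at this
  refine measure_mono_null ?_ this
  intro p hp hx
  exact h0 (by rw [← hp 0 (Nat.zero_le _), hx])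

lemma markov_measure (x : Zd d) :
    (W.nu x).map shiftP = Measure.sum (fun s => stepP d s • W.nu (x + s)) := by
  have : IsProbabilityMeasure ((W.nu x).map shiftP) :=
    Measure.isProbabilityMeasure_map meas_shiftP.aemeasurable
  refine ext_of_generate_finite _ cyl_gen cyl_pi ?_ ?_
  · rintro _ ⟨n, y, rfl⟩
    rw [Measure.map_apply meas_shiftP (meas_cyl n y), Measure.sum_apply _ (meas_cyl n y)]
    have h1 : W.nu x (shiftP ⁻¹' cyl n y) = W.nu x (cyl (n+1) (fun i => Nat.casesOn i x y)) := by
      apply measure_congr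
      filter_upwards [W.ae_zero x] with p hp
      apply propext
      change (∀ i ≤ n, p (i+1) = y i) ↔ (∀ i ≤ n+1, p i = _)
      constructor
      · intro H i hi
        cases i with
        | zero => exact hp
        | succ i => exact H i (by omega)
      · intro H i hi
        exact H (i+1) (by omega)
    rw [h1, W.nu_cyl x (n+1) _ rfl, tsum_eq_single (y 0 - x)]
    · rw [Measure.smul_apply, smul_eq_mul, W.nu_cyl _ n y (by abel), Finset.prod_range_succ', mul_comm]
      rfl
    · intro s hs
      rw [Measure.smul_apply, smul_eq_mul, W.nu_cyl_ne, mul_zero]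
      intro h; apply hs; rw [h]; abel
  · rw [measure_univ, Measure.sum_apply _ MeasurableSet.univ]
    simp [W.stepP_sum]

lemma markov (x : Zd d) {B : Set (ℕ → Zd d)} (hB : MeasurableSet B) :
    W.nu x (shiftP ⁻¹' B) = ∑' s, stepP d s * W.nu (x + s) B := by
  rw [← Measure.map_apply meas_shiftP hB, W.markov_measure, Measure.sum_apply _ hB]
  simp

lemma markov_in (x : Zd d) {B E : Set (ℕ → Zd d)} (hB : MeasurableSet B)
    (hE : ∀ p, p 0 = x → (p ∈ E ↔ shiftP p ∈ B)) :
    W.nu x E = ∑' s, stepP d s * W.nu (x + s) B := by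
  rw [← W.markov x hB]
  apply measure_congr
  filter_upwards [W.ae_zero x] with p hp
  exact propext (hE p hp)

end SRW
end Disconnection

namespace Disconnection
variable {d : ℕ} {Ω : Type*} [MeasurableSpace Ω]

lemma unit_vec (v : Zd d) (h : ∑ i, (v i).natAbs = 1) :
    ∃ i, v = Pi.single i 1 ∨ v = Pi.single i (-1) := by
  have h0 : ∃ i, (v i).natAbs ≠ 0 := by
    by_contra hc
    push Not at hc
    simp [hc] at h
  obtain ⟨i, hi⟩ := h0
  refine ⟨i, ?_⟩
  rw [← Finset.add_sum_erase _ _ (Finset.mem_univ i)] at h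
  have h1 : ∑ j ∈ Finset.univ.erase i, (v j).natAbs = 0 := by omega
  have h2 : (v i).natAbs = 1 := by omega
  rw [Finset.sum_eq_zero_iff] at h1
  have h3 : ∀ j, j ≠ i → v j = 0 := fun j hj => by
    simpa using h1 j (by simp [hj])
  rcases Int.natAbs_eq (v i) with h4 | h4
  · left; ext j
    by_cases hj : j = i
    · subst hj; simp; omega
    · simp [hj, h3 j hj]
  · right; ext j
    by_cases hj : j = i
    · subst hj; simp; omega
    · simp [hj, h3 j hj]

lemma step_le (g : Zd d → ℝ≥0∞) : ∑' s, stepP d s * g s ≤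
    ((2 * d : ℕ) : ℝ≥0∞)⁻¹ * ∑ i : Fin d, (g (Pi.single i 1) + g (Pi.single i (-1))) := by
  have h1 : ∀ s, stepP d s * g s ≤ ∑ i : Fin d, (((2 * d : ℕ) : ℝ≥0∞)⁻¹ *
      ((if s = Pi.single i 1 then g s else 0) + (if s = Pi.single i (-1) then g s else 0))) := by
    intro s
    unfold stepP
    split_ifs with h
    · obtain ⟨i, hi⟩ := unit_vec s h
      refine le_trans ?_ (Finset.single_le_sum (f := fun i : Fin d => (((2 * d : ℕ) : ℝ≥0∞)⁻¹ *
      ((if s = Pi.single i 1 then g s else 0) + (if s = Pi.single i (-1) then g s else 0)))) (fun _ _ => bot_le) (Finset.mem_univ i))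
      refine mul_le_mul_right ?_ _
      rcases hi with hi | hi
      · rw [if_pos hi]; exact le_self_add
      · rw [if_pos hi]; exact le_add_self
    · simp
  refine (ENNReal.tsum_le_tsum h1).trans ?_
  rw [Summable.tsum_finsetSum (fun _ _ => ENNReal.summable)]
  simp_rw [ENNReal.tsum_mul_left, ENNReal.tsum_add]
  rw [← Finset.mul_sum]
  refine le_of_eq ?_
  congr 1
  refine Finset.sum_congr rfl fun i _ => ?_
  congr 1
  · rw [tsum_eq_single (Pi.single i 1)]
    · simp
    · intro s hs; simp [hs]
  · rw [tsum_eq_single (Pi.single i (-1))]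
    · simp
    · intro s hs; simp [hs]

lemma exists_super (hd : 3 ≤ d) : ∃ (g : Zd d → ℝ≥0∞) (δ : ℝ), 0 < δ ∧ (∀ x, g x ≠ ⊤) ∧
    (∀ x, ∑' s, stepP d s * g (x + s) + (if x = 0 then ENNReal.ofReal δ else 0) ≤ g x) ∧
    ∀ (x : Zd d) (i : Fin d) (D : ℕ), 1 ≤ D → D ≤ (x i).natAbs →
      g x ≤ ENNReal.ofReal (1 / (D:ℝ)^(d-2)) := by
  obtain ⟨K, hK, hS⟩ := superharm hd
  have hd' : (3:ℝ) ≤ d := by exact_mod_cast hd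
  obtain ⟨a, haeq⟩ : ∃ a : ℝ, a = ((d:ℝ) - 2)/2 := ⟨_, rfl⟩
  have ha : 0 < a := by rw [haeq]; linarith
  rw [← haeq] at hS
  have hK0 : 0 < K := by linarith
  have hpos : ∀ x : Zd d, 0 < N2 x + K := fun x => by linarith [N2_nonneg x]
  have hN0 : N2 (0 : Zd d) = 0 := by simp [N2]
  have hδ : 0 < K ^ (-a) - (1 + K) ^ (-a) := by
    rw [sub_pos]
    exact Real.rpow_lt_rpow_of_neg hK0 (by linarith) (by linarith)
  refine ⟨fun x => ENNReal.ofReal ((N2 x + K) ^ (-a)), K ^ (-a) - (1 + K) ^ (-a), hδ, fun x => ENNReal.ofReal_ne_top, ?_, ?_⟩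
  · intro x
    set δ := K ^ (-a) - (1 + K) ^ (-a) with hδe
    have hR : ∑ i, ((N2 (x + Pi.single i 1) + K) ^ (-a) + (N2 (x + Pi.single i (-1)) + K) ^ (-a))
        + 2 * d * (if x = 0 then δ else 0) ≤ 2 * d * (N2 x + K) ^ (-a) := by
      split_ifs with hx
      · subst hx
        simp_rw [N2_add_single (0 : Zd d) _ 1 (by norm_num), N2_add_single (0 : Zd d) _ (-1) (by norm_num), hN0]
        simp
        rw [hδe]; apply le_of_eq; ring
      · simpa using hS x
    refine (add_le_add_left (step_le fun s => ENNReal.ofReal ((N2 (x + s) + K) ^ (-a))) _).trans ?_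
    have h2 : (if x = 0 then ENNReal.ofReal δ else 0) = ENNReal.ofReal (if x = 0 then δ else 0) := by
      split_ifs <;> simp
    have h3 : (((2 * d : ℕ) : ℝ≥0∞)⁻¹) = ENNReal.ofReal ((2 * d : ℝ)⁻¹) := by
      rw [ENNReal.ofReal_inv_of_pos (by positivity)]
      congr 1
      rw [← ENNReal.ofReal_natCast]; push_cast; rfl
    have nn : ∀ y : Zd d, 0 ≤ (N2 y + K) ^ (-a) := fun y => (Real.rpow_pos_of_pos (hpos y) _).le
    have h4 : ∀ i, ENNReal.ofReal ((N2 (x + Pi.single i 1) + K) ^ (-a)) + ENNReal.ofReal ((N2 (x + Pi.single i (-1)) + K) ^ (-a)) = ENNReal.ofReal ((N2 (x + Pi.single i 1) + K) ^ (-a) + (N2 (x + Pi.single i (-1)) + K) ^ (-a)) :=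
      fun i => (ENNReal.ofReal_add (nn _) (nn _)).symm
    simp only [h4]
    rw [← ENNReal.ofReal_sum_of_nonneg (fun i _ => add_nonneg (nn _) (nn _)), h2, h3,
      ← ENNReal.ofReal_mul (by positivity), ← ENNReal.ofReal_add]
    · apply ENNReal.ofReal_le_ofReal
      have hdp : (0:ℝ) < 2 * d := by linarith
      rw [← mul_le_mul_iff_right₀ hdp, mul_add, mul_inv_cancel_left₀ hdp.ne']
      exact hR
    · exact mul_nonneg (by positivity) (Finset.sum_nonneg fun i _ => add_nonneg (nn _) (nn _))
    · split_ifs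
      · exact hδ.le
      · exact le_rfl
  · intro x i D hD hDx
    apply ENNReal.ofReal_le_ofReal
    have hDp : (0:ℝ) < D := by exact_mod_cast hD
    have h1 : (D:ℝ)^2 ≤ N2 x + K := by
      have h2 := N2_ge x i
      have h3 : (D:ℝ) ≤ |(x i : ℝ)| := by
        rw [← Int.cast_abs, Int.abs_eq_natAbs]; exact_mod_cast hDx
      have h4 : (D:ℝ)^2 ≤ |(x i : ℝ)|^2 := by gcongr
      rw [sq_abs] at h4
      linarith
    refine (Real.rpow_le_rpow_of_nonpos (by positivity) h1 (by linarith)).trans (le_of_eq ?_)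
    rw [← Real.rpow_natCast (D:ℝ) 2, ← Real.rpow_mul hDp.le, one_div, ← Real.rpow_natCast, ← Real.rpow_neg hDp.le]
    congr 1
    rw [haeq, Nat.cast_sub (by omega)]; push_cast; ring

namespace SRW
variable (W : SRW d Ω)

noncomputable def Gr (x y : Zd d) : ℝ≥0∞ := ∑' n, W.nu x {p | p n ∈ ({y} : Set (Zd d))}

lemma nu_zero (x y : Zd d) : W.nu x {p | p 0 ∈ ({y} : Set (Zd d))} = if x = y then 1 else 0 := by
  split_ifs with h
  · subst h
    exact (mem_ae_iff_prob_eq_one (meas_coord 0 _)).1 (W.ae_zero x)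
  · refine measure_mono_null ?_ (W.ae_zero x)
    intro p hp hx
    have h1 : p 0 = y := hp
    have h2 : p 0 = x := hx
    exact h (h2.symm.trans h1)

lemma Gr_bound {g : Zd d → ℝ≥0∞} {δ : ℝ}
    (hg : ∀ x, ∑' s, stepP d s * g (x + s) + (if x = 0 then ENNReal.ofReal δ else 0) ≤ g x)
    (x y : Zd d) : ENNReal.ofReal δ * W.Gr x y ≤ g (x - y) := by
  unfold Gr
  rw [ENNReal.tsum_eq_iSup_nat, ENNReal.mul_iSup]
  refine iSup_le fun N => ?_
  induction N generalizing x with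
  | zero => simp
  | succ N ih =>
    rw [Finset.sum_range_succ', W.nu_zero]
    refine le_trans ?_ (hg (x - y))
    rw [mul_add]
    refine add_le_add ?_ ?_
    · have h1 : ∀ n, W.nu x {p | p (n+1) ∈ ({y} : Set (Zd d))} =
          ∑' s, stepP d s * W.nu (x + s) {p | p n ∈ ({y} : Set (Zd d))} :=
        fun n => W.markov x (meas_coord n _)
      simp_rw [h1]
      rw [← Summable.tsum_finsetSum (fun _ _ => ENNReal.summable), ← ENNReal.tsum_mul_left]
      refine ENNReal.tsum_le_tsum fun s => ?_
      rw [← Finset.mul_sum, mul_left_comm]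
      refine mul_le_mul_right ?_ _
      have := ih (x + s)
      rwa [show x - y + s = x + s - y by abel]
    · by_cases h : x = y
      · simp [h]
      · simp [h]

lemma markov_n (n : ℕ) (x y : Zd d) {B : Set (ℕ → Zd d)} (hB : MeasurableSet B) :
    W.nu x {p | p n ∈ ({y} : Set (Zd d)) ∧ (fun k => p (k + n)) ∈ B} =
      W.nu x {p | p n ∈ ({y} : Set (Zd d))} * W.nu y B := by
  induction n generalizing x with
  | zero =>
    rw [W.nu_zero]
    split_ifs with h
    · subst h
      rw [one_mul]
      apply measure_congr
      filter_upwards [W.ae_zero x] with p hp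
      apply propext
      change (p 0 = x ∧ p ∈ B) ↔ p ∈ B
      simp [hp]
    · rw [zero_mul]
      have := W.nu_zero x y
      rw [if_neg h] at this
      exact measure_mono_null (fun p hp => hp.1) this
  | succ n ih =>
    have hm : MeasurableSet {p : ℕ → Zd d | p n ∈ ({y} : Set (Zd d)) ∧ (fun k => p (k + n)) ∈ B} :=
      (meas_coord n _).inter ((measurable_pi_lambda _ fun k => measurable_pi_apply (k+n)) hB)
    have h1 := W.markov x hm
    have h2 := W.markov x (meas_coord n {y})
    have e2 : W.nu x {p | p (n+1) ∈ ({y} : Set (Zd d))} = _ := h2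
    rw [e2, ← ENNReal.tsum_mul_right]
    refine Eq.trans h1 (tsum_congr fun s => ?_)
    rw [ih, mul_assoc]

def avoid (A : Set (Zd d)) : Set (ℕ → Zd d) := {p | ∀ n, p n ∉ A}
def avoid1 (A : Set (Zd d)) : Set (ℕ → Zd d) := {p | ∀ n, p (n+1) ∉ A}

lemma meas_avoid (A : Set (Zd d)) : MeasurableSet (avoid A) := by
  unfold avoid; rw [ofPred_forall]
  exact MeasurableSet.iInter fun n => meas_coord n Aᶜ

lemma meas_avoid1 (A : Set (Zd d)) : MeasurableSet (avoid1 A) := meas_shiftP (meas_avoid A)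

lemma avoid1_eq (A : Set (Zd d)) (x : Zd d) :
    W.nu x (avoid1 A) = ∑' s, stepP d s * W.nu (x + s) (avoid A) := W.markov x (meas_avoid A)

lemma avoid_eq {A : Set (Zd d)} {x : Zd d} (hx : x ∉ A) :
    W.nu x (avoid A) = ∑' s, stepP d s * W.nu (x + s) (avoid A) := by
  apply W.markov_in x (meas_avoid A)
  intro p hp
  constructor
  · exact fun h n => h (n+1)
  · intro h n
    cases n with
    | zero => rw [hp]; exact hx
    | succ n => exact h n

lemma last_exit (A : Finset (Zd d)) (x : Zd d) (hG : ∀ y ∈ A, W.Gr x y ≠ ⊤) :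
    (∀ᵐ p ∂ W.nu x, ∀ᶠ n in Filter.atTop, p n ∉ A) ∧
    W.nu x (avoid (A : Set (Zd d)))ᶜ ≤ ∑ y ∈ A, W.Gr x y * W.nu y (avoid1 (A : Set (Zd d))) := by
  have hev : ∀ᵐ p ∂ W.nu x, ∀ᶠ n in Filter.atTop, p n ∉ A := by
    have h1 : ∀ y ∈ A, ∀ᵐ p ∂ W.nu x, ∀ᶠ n in Filter.atTop, p n ≠ y := fun y hy =>
      ae_eventually_notMem (hG y hy)
    replace h1 := (Filter.eventually_all_finset A).2 h1
    filter_upwards [h1] with p hp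
    have := (Filter.eventually_all_finset A).2 hp
    filter_upwards [this] with n hn hA
    exact hn _ hA rfl
  refine ⟨hev, ?_⟩
  have hsub : ((avoid (A : Set (Zd d)))ᶜ : Set _) ≤ᵐ[W.nu x] ⋃ n, ⋃ y ∈ A,
      {p : ℕ → Zd d | p n ∈ ({y} : Set (Zd d)) ∧ (fun k => p (k + n)) ∈ avoid1 (A : Set (Zd d))} := by
    filter_upwards [hev] with p hp hpa
    obtain ⟨N, hN⟩ := Filter.eventually_atTop.1 hp
    have hne : {n | p n ∈ A}.Nonempty := by
      by_contra hc
      apply hpa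
      intro n hn
      exact hc ⟨n, hn⟩
    have hbd : BddAbove {n | p n ∈ A} := ⟨N, fun n hn => by
      by_contra hc
      exact hN n (not_le.1 hc).le hn⟩
    have hm := Nat.sSup_mem hne hbd
    set n := sSup {n | p n ∈ A}
    refine mem_iUnion.2 ⟨n, mem_iUnion₂.2 ⟨p n, hm, rfl, fun k hk => ?_⟩⟩
    have h5 : k + 1 + n ≤ n := le_csSup hbd hk
    omega
  refine (measure_mono_ae hsub).trans ((measure_iUnion_le _).trans ?_)
  have h2 : ∀ n, W.nu x (⋃ y ∈ A, {p : ℕ → Zd d | p n ∈ ({y} : Set (Zd d)) ∧ (fun k => p (k + n)) ∈ avoid1 (A : Set (Zd d))})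
      ≤ ∑ y ∈ A, W.nu x {p | p n ∈ ({y} : Set (Zd d))} * W.nu y (avoid1 (A : Set (Zd d))) := by
    intro n
    refine (measure_biUnion_finset_le _ _).trans (le_of_eq (Finset.sum_congr rfl fun y _ => ?_))
    exact W.markov_n n x y (meas_avoid1 _)
  refine (ENNReal.tsum_le_tsum h2).trans (le_of_eq ?_)
  rw [Summable.tsum_finsetSum (fun _ _ => ENNReal.summable)]
  refine Finset.sum_congr rfl fun y _ => ?_
  rw [ENNReal.tsum_mul_right]; rfl

def relE (A U : Set (Zd d)) : Set (ℕ → Zd d) := {p | ∃ n, p n ∉ U ∧ ∀ m, 1 ≤ m → m ≤ n → p m ∉ A}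
def rel0 (A U : Set (Zd d)) (N : ℕ) : Set (ℕ → Zd d) := {p | ∃ n, n ≤ N ∧ p n ∉ U ∧ ∀ m, m ≤ n → p m ∉ A}

lemma meas_rel0 (A U : Set (Zd d)) (N : ℕ) : MeasurableSet (rel0 A U N) := by
  have : rel0 A U N = ⋃ n, ⋃ (_ : n ≤ N), ({p : ℕ → Zd d | p n ∈ Uᶜ} ∩ ⋂ m, ⋂ (_ : m ≤ n), {p : ℕ → Zd d | p m ∈ Aᶜ}) := by
    ext p; simp [rel0]; exact exists_congr fun _ => by tauto
  rw [this]
  exact MeasurableSet.iUnion fun n => MeasurableSet.iUnion fun _ => (meas_coord n _).inter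
    (MeasurableSet.iInter fun m => MeasurableSet.iInter fun _ => meas_coord m _)

lemma adj_step {x s : Zd d} (h : stepP d s ≠ 0) : adjacent x (x + s) := by
  unfold stepP at h
  unfold adjacent
  split_ifs at h with h1
  · rw [← h1]
    refine Finset.sum_congr rfl fun i _ => ?_
    simp
  · simp at h

lemma rel0_bound {A U : Set (Zd d)} {p : ℝ≥0∞}
    (hp : ∀ x ∈ bdry U, p ≤ W.nu x (avoid A)) (N : ℕ) :
    ∀ x ∈ U ∪ bdry U, p * W.nu x (rel0 A U N) ≤ W.nu x (avoid A) := by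
  have hB : ∀ N, ∀ x ∈ bdry U, p * W.nu x (rel0 A U N) ≤ W.nu x (avoid A) := fun N x hx =>
    (mul_le_of_le_one_right bot_le prob_le_one).trans (hp x hx)
  have hzero : ∀ N, ∀ x ∈ A, W.nu x (rel0 A U N) = 0 := by
    intro N x hx
    refine measure_mono_null ?_ (W.ae_zero x)
    rintro q ⟨n, -, -, h⟩ hq
    have hq' : q 0 = x := hq
    exact h 0 (Nat.zero_le _) (hq' ▸ hx)
  induction N with
  | zero =>
    rintro x (hx | hx)
    · have : W.nu x (rel0 A U 0) = 0 := by
        refine measure_mono_null ?_ (W.ae_zero x)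
        rintro q ⟨n, hn, h, -⟩ hq
        have hq' : q 0 = x := hq
        obtain rfl : n = 0 := by omega
        exact h (hq' ▸ hx)
      simp [this]
    · exact hB 0 x hx
  | succ N ih =>
    rintro x (hx | hx)
    · by_cases hA : x ∈ A
      · simp [hzero _ x hA]
      · rw [W.avoid_eq hA, W.markov_in x (meas_rel0 A U N) (E := rel0 A U (N+1)), ← ENNReal.tsum_mul_left]
        · refine ENNReal.tsum_le_tsum fun s => ?_
          by_cases hs : stepP d s = 0
          · simp [hs]
          · rw [mul_left_comm]
            refine mul_le_mul_right (ih _ ?_) _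
            by_cases hU : x + s ∈ U
            · exact Or.inl hU
            · exact Or.inr ⟨hU, x, hx, adj_step hs⟩
        · intro q hq
          constructor
          · rintro ⟨n, hn, h1, h2⟩
            cases n with
            | zero => rw [hq] at h1; exact absurd hx h1
            | succ n => exact ⟨n, by omega, h1, fun m hm => h2 (m+1) (by omega)⟩
          · rintro ⟨n, hn, h1, h2⟩
            refine ⟨n+1, by omega, h1, fun m hm => ?_⟩
            cases m with
            | zero => rw [hq]; exact hA
            | succ m => exact h2 m (by omega)
    · exact hB _ x hx

lemma relE_bound {A U : Set (Zd d)} (hAU : A ⊆ U) {p : ℝ≥0∞}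
    (hp : ∀ x ∈ bdry U, p ≤ W.nu x (avoid A)) {y : Zd d} (hy : y ∈ A) :
    p * W.nu y (relE A U) ≤ W.nu y (avoid1 A) := by
  have hmono : Monotone (rel0 A U) := by
    rintro N M h q ⟨n, hn, h1⟩
    exact ⟨n, hn.trans h, h1⟩
  rw [W.avoid1_eq, W.markov_in y (B := ⋃ N, rel0 A U N) (MeasurableSet.iUnion (meas_rel0 A U)), ← ENNReal.tsum_mul_left]
  · refine ENNReal.tsum_le_tsum fun s => ?_
    by_cases hs : stepP d s = 0
    · simp [hs]
    · rw [mul_left_comm]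
      refine mul_le_mul_right ?_ _
      rw [hmono.measure_iUnion, ENNReal.mul_iSup]
      refine iSup_le fun N => W.rel0_bound hp N _ ?_
      by_cases hU : y + s ∈ U
      · exact Or.inl hU
      · exact Or.inr ⟨hU, y, hAU hy, adj_step hs⟩
  · intro q hq
    constructor
    · rintro ⟨n, h1, h2⟩
      cases n with
      | zero => rw [hq] at h1; exact absurd (hAU hy) h1
      | succ n => exact mem_iUnion.2 ⟨n, n, le_rfl, h1, fun m hm => h2 (m+1) (by omega) (by omega)⟩
    · intro h
      obtain ⟨N, n, hn, h1, h2⟩ := mem_iUnion.1 h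
      refine ⟨n+1, h1, fun m hm1 hm => ?_⟩
      cases m with
      | zero => omega
      | succ m => exact h2 m (by omega)

lemma meas_relE (A U : Set (Zd d)) : MeasurableSet (relE A U) := by
  have : relE A U = ⋃ n, ({p : ℕ → Zd d | p n ∈ Uᶜ} ∩ ⋂ m, ⋂ (_ : 1 ≤ m), ⋂ (_ : m ≤ n), {p : ℕ → Zd d | p m ∈ Aᶜ}) := by
    ext p; simp [relE]
  rw [this]
  exact MeasurableSet.iUnion fun n => (meas_coord n _).inter
    (MeasurableSet.iInter fun m => MeasurableSet.iInter fun _ => MeasurableSet.iInter fun _ => meas_coord m _)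

lemma P_hit (A : Set (Zd d)) (x : Zd d) : W.P x {ω | W.hit A ω = ⊤} = W.nu x (avoid A) := by
  rw [W.nu_apply x (meas_avoid A)]
  apply measure_congr
  filter_upwards [W.ae_good x] with ω hω
  exact propext (hω.hit_eq_top A)

lemma P_hitTilde (A : Set (Zd d)) (x : Zd d) : W.P x {ω | W.hitTilde A ω = ⊤} = W.nu x (avoid1 A) := by
  rw [W.nu_apply x (meas_avoid1 A)]
  apply measure_congr
  filter_upwards [W.ae_good x] with ω hω
  exact propext (hω.hitTilde_eq_top A)

lemma P_exit (A U : Set (Zd d)) (x : Zd d) :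
    W.P x {ω | W.exit U ω < W.hitTilde A ω} = W.nu x (relE A U) := by
  rw [W.nu_apply x (meas_relE A U)]
  apply measure_congr
  filter_upwards [W.ae_good x] with ω hω
  exact propext (hω.exit_lt A U)

end SRW
end Disconnection

namespace Disconnection
variable {d : ℕ} {Ω : Type*} [MeasurableSpace Ω]

lemma box_finite {U : Set (Zd d)} (hU : isBox U) : U.Finite := by
  obtain ⟨L, hL, a, rfl⟩ := hU
  refine (Set.finite_Icc a (fun i => a i + L)).subset ?_
  intro y hy
  exact ⟨fun i => (hy i).1, fun i => (hy i).2.le⟩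

lemma bdry_finite {U : Set (Zd d)} (hU : isBox U) : (bdry U).Finite := by
  obtain ⟨L, hL, a, rfl⟩ := hU
  refine (Set.finite_Icc (fun i => a i - 1) (fun i => a i + L)).subset ?_
  rintro y ⟨-, x, hx, hxy⟩
  have h : ∀ i, (x i - y i).natAbs ≤ 1 := fun i => by
    rw [← hxy]
    exact Finset.single_le_sum (f := fun i => (x i - y i).natAbs) (fun _ _ => Nat.zero_le _) (Finset.mem_univ i)
  refine ⟨fun i => ?_, fun i => ?_⟩
  · have := h i; have := hx i; dsimp only; omega
  · have := h i; have := hx i; dsimp only; omega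

lemma bdry_nonempty (hd : 3 ≤ d) {U : Set (Zd d)} (hU : isBox U) : (bdry U).Nonempty := by
  obtain ⟨L, hL, a, rfl⟩ := hU
  have i : Fin d := ⟨0, by omega⟩
  refine ⟨a + Pi.single i (L : ℤ), ?_, a + Pi.single i ((L : ℤ) - 1), ?_, ?_⟩
  · intro h
    have := (h i).2
    simp at this
  · intro j
    by_cases hj : j = i
    · subst hj; simp; omega
    · simp [hj]; omega
  · unfold adjacent
    rw [Finset.sum_eq_single i]
    · simp
    · intro j _ hj; simp [hj]
    · simp

lemma box_dir {U : Set (Zd d)} (hU : isBox U) {x : Zd d} (hx : x ∉ U) :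
    ∃ (i : Fin d) (e : ℤ), (e = 1 ∨ e = -1) ∧ ∀ (n : ℕ), ∀ y ∈ U,
      n < ((x + Pi.single i (n * e) - y : Zd d) i).natAbs := by
  obtain ⟨L, hL, a, rfl⟩ := hU
  have : ∃ i, ¬ (a i ≤ x i ∧ x i < a i + L) := by
    by_contra hc
    push Not at hc
    exact hx hc
  obtain ⟨i, hi⟩ := this
  by_cases h : a i ≤ x i
  · refine ⟨i, 1, Or.inl rfl, fun n y hy => ?_⟩
    have := hy i
    simp; omega
  · refine ⟨i, -1, Or.inr rfl, fun n y hy => ?_⟩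
    have := hy i
    simp; omega

lemma stepP_single (i : Fin d) {e : ℤ} (he : e = 1 ∨ e = -1) : stepP d (Pi.single i e) ≠ 0 := by
  unfold stepP
  rw [if_pos]
  · exact ENNReal.inv_ne_zero.2 (ENNReal.natCast_ne_top _)
  · rw [Finset.sum_eq_single i]
    · rcases he with rfl | rfl <;> simp
    · intro j _ hj; simp [hj]
    · simp

lemma supDist_exists (hd : 3 ≤ d) (x y : Zd d) : ∃ i, supDist x y = (x i - y i).natAbs := by
  have : (Finset.univ : Finset (Fin d)).Nonempty := ⟨⟨0, by omega⟩, Finset.mem_univ _⟩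
  obtain ⟨i, -, hi⟩ := Finset.exists_mem_eq_sup Finset.univ this (fun i => (x i - y i).natAbs)
  exact ⟨i, hi⟩

namespace SRW
variable (W : SRW d Ω)

lemma Gr_ne_top {g : Zd d → ℝ≥0∞} {δ : ℝ} (hδ : 0 < δ)
    (hg : ∀ x, ∑' s, stepP d s * g (x + s) + (if x = 0 then ENNReal.ofReal δ else 0) ≤ g x)
    (hgt : ∀ x, g x ≠ ⊤) (x y : Zd d) : W.Gr x y ≠ ⊤ := by
  intro h
  have := W.Gr_bound hg x y
  rw [h, ENNReal.mul_top (by simpa using hδ)] at this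
  exact hgt _ (top_le_iff.1 this)

lemma avoid_pos (hd : 3 ≤ d) {g : Zd d → ℝ≥0∞} {δ : ℝ} (hδ : 0 < δ)
    (hg : ∀ x, ∑' s, stepP d s * g (x + s) + (if x = 0 then ENNReal.ofReal δ else 0) ≤ g x)
    (hgt : ∀ x, g x ≠ ⊤)
    (hgD : ∀ (x : Zd d) (i : Fin d) (D : ℕ), 1 ≤ D → D ≤ (x i).natAbs →
      g x ≤ ENNReal.ofReal (1 / (D:ℝ)^(d-2)))
    {U : Set (Zd d)} (hU : isBox U) {x : Zd d} (hx : x ∉ U) : W.nu x (avoid U) ≠ 0 := by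
  intro h0
  obtain ⟨i, e, he, hn⟩ := box_dir hU hx
  have hz : ∀ n : ℕ, W.nu (x + Pi.single i (n * e)) (avoid U) = 0 := by
    intro n
    induction n with
    | zero => simpa using h0
    | succ n ih =>
      have hnot : x + Pi.single i (n * e) ∉ U := by
        intro h
        have := hn n _ h
        simp at this
      rw [W.avoid_eq hnot, ENNReal.tsum_eq_zero] at ih
      have := ih (Pi.single i e)
      rw [mul_eq_zero, or_iff_right (stepP_single i he), add_assoc, ← Pi.single_add] at this
      convert this using 4
      push_cast; ring
  set F := (box_finite hU).toFinset with hF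
  have hFU : (F : Set (Zd d)) = U := by simp [hF]
  obtain ⟨n, hn1⟩ := exists_nat_gt ((F.card : ℝ) / δ)
  have hnp : (0:ℝ) < n := lt_of_le_of_lt (by positivity) hn1
  have hn0 : 1 ≤ n := by exact_mod_cast hnp
  have hzn := hz n
  have hnn := hn n
  obtain ⟨z, hzz⟩ : ∃ z : Zd d, z = x + Pi.single i (n * e) := ⟨_, rfl⟩
  rw [← hzz] at hzn hnn
  clear hzz hz hn
  have h1 := (W.last_exit F z (fun y _ => W.Gr_ne_top hδ hg hgt _ y)).2
  rw [hFU, prob_compl_eq_one_sub (meas_avoid U), hzn, tsub_zero] at h1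
  have h2 : ENNReal.ofReal δ ≤ ∑ y ∈ F, ENNReal.ofReal (1 / (n:ℝ)) := by
    calc ENNReal.ofReal δ ≤ ENNReal.ofReal δ * ∑ y ∈ F, W.Gr z y * W.nu y (avoid1 U) :=
          le_mul_of_one_le_right bot_le h1
      _ ≤ _ := by
        rw [Finset.mul_sum]
        refine Finset.sum_le_sum fun y hy => ?_
        rw [← mul_assoc]
        refine (mul_le_of_le_one_right bot_le prob_le_one).trans ((W.Gr_bound hg _ _).trans ?_)
        refine (hgD (z - y) i n hn0 (hnn y ?_).le).trans ?_
        · rw [← hFU]; exact hy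
        · apply ENNReal.ofReal_le_ofReal
          have h3 : (n:ℝ) ≤ (n:ℝ)^(d-2) := le_self_pow₀ (by exact_mod_cast hn0) (by omega)
          gcongr
  rw [← ENNReal.ofReal_sum_of_nonneg (fun _ _ => by positivity), ENNReal.ofReal_le_ofReal_iff (by positivity)] at h2
  simp only [Finset.sum_const, nsmul_eq_mul] at h2
  rw [mul_one_div, le_div_iff₀ hnp] at h2
  rw [div_lt_iff₀ hδ] at hn1
  linarith

end SRW
end Disconnection

open Disconnection

theorem statement2 {d : ℕ} (hd : 3 ≤ d) {Ω : Type*} [MeasurableSpace Ω] (W : SRW d Ω) :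
    ∃ c : ℝ, 0 < c ∧
      ∀ U A : Set (Zd d), isBox U → A ⊆ U → A.Nonempty →
        (∀ y, W.eqm A y ≠ 0 ↔ W.eqmRel A U y ≠ 0) ∧
        (∀ y, W.eqm A y ≤ W.eqmRel A U y ∧
          W.eqmRel A U y ≤ W.eqm A y /
            sInf ((fun x => (W.P x {ω | W.hit A ω = ⊤}).toReal) '' bdry U)) ∧
        max 0 (1 - c * W.cap A / (setDist A Uᶜ : ℝ) ^ (d - 2))
          < sInf ((fun x => (W.P x {ω | W.hit A ω = ⊤}).toReal) '' bdry U) := by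
  obtain ⟨g, δ, hδ, hgt, hg, hgD⟩ := exists_super hd
  refine ⟨2 / δ, by positivity, fun U A hU hAU hAne => ?_⟩
  have hUf := box_finite hU
  have hAf := hUf.subset hAU
  simp only [SRW.P_hit]
  set T : Set ℝ := (fun x => (W.nu x (SRW.avoid A)).toReal) '' bdry U with hT
  have hTf : T.Finite := (bdry_finite hU).image _
  have hTm : sInf T ∈ T := ((bdry_nonempty hd hU).image _).csInf_mem hTf
  have hple : ∀ x ∈ bdry U, sInf T ≤ (W.nu x (SRW.avoid A)).toReal := fun x hx =>
    csInf_le hTf.bddBelow ⟨x, hx, rfl⟩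
  set p := sInf T
  obtain ⟨x0, hx0, hpx0⟩ := hTm
  have hpx : (W.nu x0 (SRW.avoid A)).toReal = p := hpx0
  have hppos : 0 < p := by
    rw [← hpx]
    refine ENNReal.toReal_pos ?_ (measure_ne_top _ _)
    intro h0
    refine W.avoid_pos hd hδ hg hgt hgD hU hx0.1 (measure_mono_null ?_ h0)
    exact fun q hq n hn => hq n (hAU hn)
  have hpE : ∀ x ∈ bdry U, ENNReal.ofReal p ≤ W.nu x (SRW.avoid A) := fun x hx =>
    ENNReal.ofReal_le_of_le_toReal (hple x hx)
  have e1 : ∀ y ∈ A, W.eqm A y = (W.nu y (SRW.avoid1 A)).toReal := fun y hy => by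
    rw [SRW.eqm, if_pos hy, W.P_hitTilde]
  have e2 : ∀ y ∈ A, W.eqmRel A U y = (W.nu y (SRW.relE A U)).toReal := fun y hy => by
    rw [SRW.eqmRel, if_pos hy, W.P_exit]
  have e1' : ∀ y, y ∉ A → W.eqm A y = 0 := fun y hy => if_neg hy
  have e2' : ∀ y, y ∉ A → W.eqmRel A U y = 0 := fun y hy => if_neg hy
  have hii : ∀ y, W.eqm A y ≤ W.eqmRel A U y ∧ W.eqmRel A U y ≤ W.eqm A y / p := by
    intro y
    by_cases hy : y ∈ A
    · rw [e1 y hy, e2 y hy]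
      constructor
      · apply ENNReal.toReal_mono (measure_ne_top _ _)
        apply measure_mono_ae
        have hl := (W.last_exit hUf.toFinset y (fun z _ => W.Gr_ne_top hδ hg hgt y z)).1
        filter_upwards [hl] with q hq hqa
        obtain ⟨n, hn⟩ := hq.exists
        refine ⟨n, by simpa using hn, fun m hm1 _ => ?_⟩
        obtain ⟨k, rfl⟩ := Nat.exists_eq_add_of_le' hm1
        exact hqa k
      · rw [le_div_iff₀ hppos, mul_comm]
        have := ENNReal.toReal_mono (measure_ne_top _ _) (W.relE_bound hAU hpE hy)
        rwa [ENNReal.toReal_mul, ENNReal.toReal_ofReal hppos.le] at this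
    · rw [e1' y hy, e2' y hy]; simp
  have hnn : ∀ y, 0 ≤ W.eqm A y := by
    intro y
    by_cases hy : y ∈ A
    · rw [e1 y hy]; exact ENNReal.toReal_nonneg
    · rw [e1' y hy]
  set F := hAf.toFinset with hF
  have hFA : (F : Set (Zd d)) = A := by simp [hF]
  have hcap : W.cap A = ∑ y ∈ F, W.eqm A y := by
    unfold SRW.cap
    apply finsum_eq_sum_of_support_subset
    intro y hy
    rw [hFA]
    by_contra hc
    exact hy (e1' y hc)
  have hcap0 : 0 ≤ W.cap A := by rw [hcap]; exact Finset.sum_nonneg fun y _ => hnn y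
  have hbound : ∀ (x : Zd d) (b : ℝ), 0 ≤ b → (∀ y ∈ A, g (x - y) ≤ ENNReal.ofReal b) →
      δ * (1 - (W.nu x (SRW.avoid A)).toReal) ≤ b * W.cap A := by
    intro x b hb hgb
    have h1 := (W.last_exit F x (fun z _ => W.Gr_ne_top hδ hg hgt x z)).2
    rw [hFA] at h1
    have h2 : ENNReal.ofReal δ * W.nu x (SRW.avoid A)ᶜ ≤ ∑ y ∈ F, ENNReal.ofReal (b * W.eqm A y) := by
      refine (mul_le_mul_right h1 _).trans ?_
      rw [Finset.mul_sum]
      refine Finset.sum_le_sum fun y hy => ?_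
      have hyA : y ∈ A := by rw [← hFA]; exact hy
      rw [← mul_assoc, ENNReal.ofReal_mul hb, e1 y hyA, ENNReal.ofReal_toReal (measure_ne_top _ _)]
      exact mul_le_mul_left ((W.Gr_bound hg x y).trans (hgb y hyA)) _
    rw [← ENNReal.ofReal_sum_of_nonneg (fun y _ => mul_nonneg hb (hnn y)), ← Finset.mul_sum, ← hcap] at h2
    have h3 := ENNReal.toReal_mono ENNReal.ofReal_ne_top h2
    rw [ENNReal.toReal_mul, ENNReal.toReal_ofReal hδ.le, ENNReal.toReal_ofReal (mul_nonneg hb hcap0)] at h3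
    have h4 := probReal_compl_eq_one_sub (μ := W.nu x) (SRW.meas_avoid A)
    unfold Measure.real at h4
    rwa [h4] at h3
  have hcappos : 0 < W.cap A := by
    obtain ⟨x, hx⟩ := hAne
    have hz : W.nu x (SRW.avoid A) = 0 := by
      refine measure_mono_null ?_ (W.ae_zero x)
      intro q hq h0
      have h0' : q 0 = x := h0
      exact hq 0 (h0' ▸ hx)
    have h1 := hbound x (∑ y ∈ F, (g (x - y)).toReal) (Finset.sum_nonneg fun _ _ => ENNReal.toReal_nonneg) (by
      intro y hy
      rw [← ENNReal.ofReal_toReal (hgt (x - y))]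
      apply ENNReal.ofReal_le_ofReal
      exact Finset.single_le_sum (f := fun y => (g (x - y)).toReal) (fun _ _ => ENNReal.toReal_nonneg) (by
        rw [← Finset.mem_coe, hFA]; exact hy))
    rw [hz] at h1
    simp at h1
    rcases hcap0.lt_or_eq with h | h
    · exact h
    · rw [← h] at h1; simp at h1; linarith
  refine ⟨fun y => ?_, hii, max_lt hppos ?_⟩
  · obtain ⟨h1, h2⟩ := hii y
    constructor
    · intro h
      have : 0 < W.eqm A y := lt_of_le_of_ne (hnn y) (Ne.symm h)
      exact (lt_of_lt_of_le this h1).ne'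
    · intro h h0
      rw [h0] at h1 h2
      simp at h2
      exact h (le_antisymm h2 h1)
  · set D := setDist A Uᶜ with hD
    have hD1 : 1 ≤ D := by
      by_contra hc
      have hne : {n | ∃ x ∈ A, ∃ y ∈ Uᶜ, supDist x y = n}.Nonempty := by
        obtain ⟨x, hx⟩ := hAne
        exact ⟨_, x, hx, x0, hx0.1, rfl⟩
      have hm := Nat.sInf_mem hne
      obtain ⟨x, hx, y, hy, hxy⟩ := hm
      have h0 : supDist x y = 0 := by
        rw [hxy]; change D = 0; omega
      apply hy
      have : x = y := by
        ext i
        have : (x i - y i).natAbs ≤ supDist x y :=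
          Finset.le_sup (f := fun i => (x i - y i).natAbs) (Finset.mem_univ i)
        omega
      rw [← this]; exact hAU hx
    have hDp : (0:ℝ) < D := by exact_mod_cast hD1
    have h1 := hbound x0 (1 / (D:ℝ)^(d-2)) (by positivity) (by
      intro y hy
      obtain ⟨i, hi⟩ := supDist_exists hd y x0
      have hle : D ≤ supDist y x0 := Nat.sInf_le ⟨y, hy, x0, hx0.1, rfl⟩
      refine hgD (x0 - y) i D hD1 ?_
      simp only [Pi.sub_apply]
      omega)
    rw [hpx] at h1
    have hE : 0 < W.cap A / (D:ℝ)^(d-2) := by positivity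
    have e3 : 1 / (D:ℝ)^(d-2) * W.cap A = W.cap A / (D:ℝ)^(d-2) := by ring
    have e4 : 2 / δ * W.cap A / (D:ℝ)^(d-2) = 2 * ((W.cap A / (D:ℝ)^(d-2)) / δ) := by ring
    rw [e3, ← le_div_iff₀' hδ] at h1
    have : 0 < (W.cap A / (D:ℝ)^(d-2)) / δ := by positivity
    rw [e4]
    linarith
end

section
/- There exist constants c₁ ≥ 2 and c₂ > 0 depending only on d ≥ 3 such that: for all integers K ≥ c₁ and L ≥ 1, every A ⊆ B(0,L), every finite U ⊇ B(0,KL), every y ∈ A and z ∈ ∂U, there is a real number ψ with |ψ| ≤ c₂/K such that P_z[H_A < H̃_{∂U}, X_{H_A} = y] = P_y[T_U < H̃_A, X_{T_U} = z] = e_A(y)·P_0[X_{T_U} = z]·(1 + ψ), and ψ can be taken equal to 0 whenever e_A(y)·P_y[X_{T_U} = z] = 0. -/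
open MeasureTheory ENNReal Set
open scoped Classical NNReal

open Disconnection

/-! ### Lattice directions, maximum principle -/
namespace DProof

abbrev Dir (d : ℕ) := Fin d × Bool

def dir {d : ℕ} (v : Dir d) : Zd d := Pi.single v.1 (if v.2 then 1 else -1)

def opp {d : ℕ} (v : Dir d) : Dir d := (v.1, !v.2)

lemma dir_opp {d : ℕ} (v : Dir d) : dir (opp v) = - dir v := by
  rcases v with ⟨i, b⟩
  cases b <;> simp [dir, opp, ← Pi.single_neg]

lemma opp_opp {d : ℕ} (v : Dir d) : opp (opp v) = v := by simp [opp]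

lemma sum_dir {d : ℕ} {M : Type*} [AddCommMonoid M] (g : Dir d → M) :
    ∑ v, g v = ∑ i, (g (i, true) + g (i, false)) := by
  rw [Fintype.sum_prod_type]
  simp

/-- harmonicity at a point -/
def Harm {d : ℕ} (u : Zd d → ℝ) (x : Zd d) : Prop := ∑ v, u (x + dir v) = 2 * d * u x

lemma card_dir {d : ℕ} : Fintype.card (Dir d) = 2 * d := by
  simp [Dir, mul_comm]

lemma Harm.lin {d : ℕ} {u w : Zd d → ℝ} {x : Zd d} (hu : Harm u x) (hw : Harm w x) (a b c : ℝ) :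
    Harm (fun y => a * u y + b * w y + c) x := by
  unfold Harm at *
  rw [Finset.sum_add_distrib, Finset.sum_add_distrib, ← Finset.mul_sum, ← Finset.mul_sum, hu, hw]
  simp
  ring

/-- Maximum principle on a finite set. -/
lemma max_principle {d : ℕ} (hd : 0 < d) (D : Set (Zd d)) (hD : D.Finite) (g : Zd d → ℝ)
    (hg : ∀ x ∈ D, Harm g x) (hb : ∀ x, x ∉ D → g x ≤ 0) : ∀ x, g x ≤ 0 := by
  by_contra hcon
  push Not at hcon
  obtain ⟨x₁, hx₁⟩ := hcon
  have hx₁D : x₁ ∈ D := by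
    by_contra h
    exact absurd (hb x₁ h) (not_le.mpr hx₁)
  obtain ⟨x₂, hx₂D, hx₂⟩ := Set.exists_max_image D g hD ⟨x₁, hx₁D⟩
  have hpos : 0 < g x₂ := lt_of_lt_of_le hx₁ (hx₂ x₁ hx₁D)
  have hall : ∀ x, g x ≤ g x₂ := by
    intro x
    by_cases h : x ∈ D
    · exact hx₂ x h
    · exact (hb x h).trans hpos.le
  set E : Set (Zd d) := {x | g x = g x₂} with hE
  have hED : E ⊆ D := by
    intro x hx
    by_contra h
    have := hb x h
    rw [hE, Set.mem_ofPred_eq] at hx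
    linarith
  obtain ⟨x₃, hx₃E, hx₃⟩ := Set.exists_max_image E (fun x => x ⟨0, hd⟩) (hD.subset hED) ⟨x₂, rfl⟩
  have hh := hg x₃ (hED hx₃E)
  unfold Harm at hh
  have hx3 : g x₃ = g x₂ := hx₃E
  have hsum : ∑ v : Dir d, (g x₂ - g (x₃ + dir v)) = 0 := by
    rw [Finset.sum_sub_distrib, hh, hx3]
    simp
    ring
  have hz := (Finset.sum_eq_zero_iff_of_nonneg (fun v _ => sub_nonneg.mpr (hall _))).mp hsum
    (⟨0, hd⟩, true) (Finset.mem_univ _)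
  have hin : x₃ + dir (⟨0, hd⟩, true) ∈ E := by
    rw [hE, Set.mem_ofPred_eq]; linarith
  have := hx₃ _ hin
  simp [dir] at this

/-! ### Discrete gradient estimate for positive harmonic functions -/

/-- Algebraic core. -/
lemma alg_core {d : ℕ} (a b : Fin d → ℝ) (ha : ∀ i, 0 < a i) (hb : ∀ i, 0 < b i)
    (hs : ∑ i, (a i + b i) = 2 * d) :
    (∑ i, ((a i - 1) ^ 2 + (b i - 1) ^ 2)) ^ 2 ≤ 136 * (d : ℝ) ^ 3 * ∑ i, (1 - a i * b i) ^ 2 := by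
  rcases Nat.eq_zero_or_pos d with rfl | hd
  · simp
  have hd1 : (1 : ℝ) ≤ d := by exact_mod_cast hd
  set m : Fin d → ℝ := fun i => (a i + b i) / 2 with hm
  set δ : Fin d → ℝ := fun i => (a i - b i) / 2 with hδ
  set M := ∑ i, (m i - 1) ^ 2 with hM
  set Δ := ∑ i, (δ i) ^ 2 with hΔ
  set Q := ∑ i, (1 - a i * b i) ^ 2 with hQ
  have hmpos : ∀ i, 0 < m i := fun i => by simp only [hm]; linarith [ha i, hb i]
  have hmsum : ∑ i, m i = d := by
    simp only [hm]
    rw [← Finset.sum_div, hs]; ring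
  have hF : ∑ i, ((a i - 1) ^ 2 + (b i - 1) ^ 2) = 2 * M + 2 * Δ := by
    rw [hM, hΔ, Finset.mul_sum, Finset.mul_sum, ← Finset.sum_add_distrib]
    refine Finset.sum_congr rfl fun i _ => ?_
    simp only [hm, hδ]; ring
  have hS1 : ∑ i, (1 - a i * b i) = Δ - M := by
    have : ∑ i, (1 - a i * b i) = ∑ i, ((δ i) ^ 2 - (m i - 1) ^ 2 + (2 - 2 * m i)) := by
      refine Finset.sum_congr rfl fun i _ => ?_
      simp only [hm, hδ]; ring
    rw [this, Finset.sum_add_distrib, Finset.sum_sub_distrib, Finset.sum_sub_distrib,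
      ← Finset.mul_sum, hmsum]
    simp
    ring
  have hCS : (∑ i, (1 - a i * b i)) ^ 2 ≤ d * Q := by
    have := sq_sum_le_card_mul_sum_sq (s := (Finset.univ : Finset (Fin d)))
      (f := fun i => (1 - a i * b i))
    simpa using this
  have hQ0 : 0 ≤ Q := Finset.sum_nonneg fun i _ => sq_nonneg _
  have hM0 : 0 ≤ M := Finset.sum_nonneg fun i _ => sq_nonneg _
  have hΔ0 : 0 ≤ Δ := Finset.sum_nonneg fun i _ => sq_nonneg _
  -- M ≤ 4 d Q
  set Pp : ℝ := ∑ i, max (1 - m i) 0 with hPp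
  have hP0 : 0 ≤ Pp := Finset.sum_nonneg fun i _ => le_max_right _ _
  have habs : ∑ i, |1 - m i| = 2 * Pp := by
    have : ∑ i, |1 - m i| = ∑ i, (2 * max (1 - m i) 0 - (1 - m i)) := by
      refine Finset.sum_congr rfl fun i _ => ?_
      rcases le_total (1 - m i) 0 with h | h
      · rw [abs_of_nonpos h, max_eq_right h]; ring
      · rw [abs_of_nonneg h, max_eq_left h]; ring
    rw [this, Finset.sum_sub_distrib, ← Finset.mul_sum, Finset.sum_sub_distrib, hmsum]
    simp [hPp]
  have hM1 : M ≤ (2 * Pp) ^ 2 := by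
    rw [← habs, hM]
    calc ∑ i, (m i - 1) ^ 2 = ∑ i, |1 - m i| ^ 2 := by
          refine Finset.sum_congr rfl fun i _ => ?_
          rw [sq_abs]; ring
      _ ≤ (∑ i, |1 - m i|) ^ 2 :=
          Finset.sum_sq_le_sq_sum_of_nonneg fun i _ => abs_nonneg _
  have hP2 : Pp ^ 2 ≤ d * Q := by
    have h1 := sq_sum_le_card_mul_sum_sq (s := (Finset.univ : Finset (Fin d)))
      (f := fun i => max (1 - m i) 0)
    have h2 : ∑ i, (max (1 - m i) 0) ^ 2 ≤ Q := by
      refine Finset.sum_le_sum fun i _ => ?_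
      rcases le_total (1 - m i) 0 with h | h
      · rw [max_eq_right h]; simp; positivity
      · rw [max_eq_left h]
        have h3 : 1 - m i ≤ 1 - a i * b i := by
          have : a i * b i ≤ m i ^ 2 := by
            simp only [hm]; nlinarith [sq_nonneg (a i - b i)]
          nlinarith [hmpos i]
        exact pow_le_pow_left₀ h h3 2
    have h4 : (d : ℝ) * ∑ i, (max (1 - m i) 0) ^ 2 ≤ d * Q :=
      mul_le_mul_of_nonneg_left h2 (by positivity)
    have h1' : Pp ^ 2 ≤ (d : ℝ) * ∑ i, (max (1 - m i) 0) ^ 2 := by simpa using h1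
    linarith
  have hMQ : M ≤ 4 * d * Q := by nlinarith
  have hMd : M ≤ d ^ 2 := by
    have h1 : M = ∑ i, (m i) ^ 2 - d := by
      have : M = ∑ i, ((m i) ^ 2 - 2 * m i + 1) := by
        rw [hM]; exact Finset.sum_congr rfl fun i _ => by ring
      rw [this, Finset.sum_add_distrib, Finset.sum_sub_distrib, ← Finset.mul_sum, hmsum]
      simp
      ring
    have h2 : ∑ i, (m i) ^ 2 ≤ (∑ i, m i) ^ 2 :=
      Finset.sum_sq_le_sq_sum_of_nonneg fun i _ => (hmpos i).le
    rw [hmsum] at h2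
    linarith
  rw [hF]
  have hD2 : (Δ - M) ^ 2 ≤ d * Q := by rw [← hS1]; exact hCS
  have hM2 : M ^ 2 ≤ d ^ 2 * (4 * d * Q) := by
    rw [sq]; exact mul_le_mul hMd hMQ hM0 (by positivity)
  have e1 : (2 * M + 2 * Δ) ^ 2 ≤ 32 * M ^ 2 + 8 * (Δ - M) ^ 2 := by
    nlinarith [sq_nonneg (4 * M - 2 * (Δ - M))]
  have e2 : d * Q ≤ d ^ 3 * Q := by
    apply mul_le_mul_of_nonneg_right _ hQ0
    nlinarith [mul_self_nonneg ((d : ℝ) - 1), mul_nonneg (by linarith : (0 : ℝ) ≤ d) (by nlinarith : (0 : ℝ) ≤ (d : ℝ) ^ 2 - 1)]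
  nlinarith

/-- ratio of neighbouring values -/
noncomputable def rat {d : ℕ} (u : Zd d → ℝ) (v : Dir d) (x : Zd d) : ℝ := u (x + dir v) / u x

/-- the squared logarithmic gradient -/
noncomputable def FF {d : ℕ} (u : Zd d → ℝ) (x : Zd d) : ℝ := ∑ v, (rat u v x - 1) ^ 2

lemma rat_pos {d : ℕ} {u : Zd d → ℝ} (hu : ∀ x, 0 < u x) (v : Dir d) (x : Zd d) :
    0 < rat u v x := div_pos (hu _) (hu _)

lemma sum_rat {d : ℕ} {u : Zd d → ℝ} (hu : ∀ x, 0 < u x) {x : Zd d} (hx : Harm u x) :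
    ∑ v, rat u v x = 2 * d := by
  unfold rat
  rw [← Finset.sum_div, hx]
  field_simp [(hu x).ne']

lemma FF_eq {d : ℕ} {u : Zd d → ℝ} (hu : ∀ x, 0 < u x) {x : Zd d} (hx : Harm u x) :
    FF u x = ∑ v, (rat u v x) ^ 2 - 2 * d := by
  have h : FF u x = ∑ v, ((rat u v x) ^ 2 - 2 * rat u v x + 1) := by
    unfold FF; exact Finset.sum_congr rfl fun v _ => by ring
  rw [h, Finset.sum_add_distrib, Finset.sum_sub_distrib, ← Finset.mul_sum, sum_rat hu hx]
  simp
  ring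

lemma FF_nonneg {d : ℕ} (u : Zd d → ℝ) (x : Zd d) : 0 ≤ FF u x :=
  Finset.sum_nonneg fun _ _ => sq_nonneg _

lemma FF_le {d : ℕ} {u : Zd d → ℝ} (hu : ∀ x, 0 < u x) {x : Zd d} (hx : Harm u x) :
    FF u x ≤ 4 * d ^ 2 := by
  rw [FF_eq hu hx]
  have h2 : ∑ v, (rat u v x) ^ 2 ≤ (∑ v, rat u v x) ^ 2 :=
    Finset.sum_sq_le_sq_sum_of_nonneg fun i _ => (rat_pos hu i x).le
  rw [sum_rat hu hx] at h2
  have : (0 : ℝ) ≤ d := by positivity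
  nlinarith

lemma rat_le {d : ℕ} {u : Zd d → ℝ} (hu : ∀ x, 0 < u x) {x : Zd d} (hx : Harm u x) (v : Dir d) :
    rat u v x ≤ 2 * d := by
  rw [← sum_rat hu hx]
  exact Finset.single_le_sum (f := fun v => rat u v x) (fun i _ => (rat_pos hu i x).le)
    (Finset.mem_univ v)

lemma rat_rat {d : ℕ} {u : Zd d → ℝ} (hu : ∀ x, 0 < u x) (x : Zd d) (v w : Dir d) :
    rat u w x * rat u v (x + dir w) = u (x + dir v + dir w) / u x := by
  unfold rat
  have h1 := (hu x).ne'
  have h2 := (hu (x + dir w)).ne'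
  rw [show x + dir v + dir w = x + dir w + dir v by abel]
  field_simp

/-- Bochner-type inequality. -/
lemma bochner {d : ℕ} (hd : 0 < d) {u : Zd d → ℝ} (hu : ∀ x, 0 < u x) {x : Zd d} (hx : Harm u x)
    (hxw : ∀ w, Harm u (x + dir w)) :
    (FF u x) ^ 2 ≤ 136 * (d : ℝ) ^ 4 * ∑ w, rat u w x * (FF u (x + dir w) - FF u x) := by
  have hd1 : (1 : ℝ) ≤ d := by exact_mod_cast hd
  have h1 : ∑ w, rat u w x * (FF u (x + dir w) - FF u x)
      = ∑ v, ∑ w, rat u w x * (rat u v (x + dir w) - rat u v x) ^ 2 := by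
    have e1 : ∀ w, rat u w x * (FF u (x + dir w) - FF u x)
        = ∑ v, rat u w x * ((rat u v (x + dir w)) ^ 2 - (rat u v x) ^ 2) := by
      intro w
      rw [FF_eq hu hx, FF_eq hu (hxw w), ← Finset.mul_sum, Finset.sum_sub_distrib]
      ring
    rw [Finset.sum_congr rfl fun w _ => e1 w, Finset.sum_comm]
    refine Finset.sum_congr rfl fun v _ => ?_
    have e2 : ∑ w, rat u w x * (rat u v (x + dir w)) = 2 * d * rat u v x := by
      rw [Finset.sum_congr rfl fun w _ => rat_rat hu x v w, ← Finset.sum_div, hxw v]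
      unfold rat; ring
    have e3 : ∑ w, rat u w x * rat u v x = 2 * d * rat u v x := by
      rw [← Finset.sum_mul, sum_rat hu hx]
    have e4 : ∀ w, rat u w x * ((rat u v (x + dir w)) ^ 2 - (rat u v x) ^ 2)
        = rat u w x * (rat u v (x + dir w) - rat u v x) ^ 2
          + 2 * rat u v x * (rat u w x * (rat u v (x + dir w)) - rat u w x * rat u v x) := by
      intro w; ring
    rw [Finset.sum_congr rfl fun w _ => e4 w, Finset.sum_add_distrib, ← Finset.mul_sum,
      Finset.sum_sub_distrib, e2, e3]
    ring
  have h2 : ∀ v, (1 - rat u v x * rat u (opp v) x) ^ 2 / (2 * d)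
      ≤ ∑ w, rat u w x * (rat u v (x + dir w) - rat u v x) ^ 2 := by
    intro v
    have e1 : rat u (opp v) x * (rat u v (x + dir (opp v)) - rat u v x) ^ 2
        ≤ ∑ w, rat u w x * (rat u v (x + dir w) - rat u v x) ^ 2 :=
      Finset.single_le_sum (f := fun w => rat u w x * (rat u v (x + dir w) - rat u v x) ^ 2)
        (fun w _ => mul_nonneg (rat_pos hu w x).le (sq_nonneg _)) (Finset.mem_univ (opp v))
    refine le_trans ?_ e1
    have hp := rat_pos hu (opp v) x
    have hle := rat_le hu hx (opp v)
    have e2 : rat u v (x + dir (opp v)) = 1 / rat u (opp v) x := by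
      unfold rat
      rw [dir_opp]
      simp
    rw [e2]
    set r := rat u (opp v) x
    have e3 : r * (1 / r - rat u v x) ^ 2 = (1 - rat u v x * r) ^ 2 / r := by
      field_simp
    rw [e3]
    exact div_le_div_of_nonneg_left (sq_nonneg _) hp hle
  have h3 : (1 / d) * ∑ i : Fin d, (1 - rat u (i, true) x * rat u (i, false) x) ^ 2
      ≤ ∑ w, rat u w x * (FF u (x + dir w) - FF u x) := by
    rw [h1]
    refine le_trans (le_of_eq ?_) (Finset.sum_le_sum fun v _ => h2 v)
    rw [sum_dir, Finset.mul_sum]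
    refine Finset.sum_congr rfl fun i _ => ?_
    simp only [opp, Bool.not_true, Bool.not_false]
    field_simp
    ring
  have h4 := alg_core (fun i => rat u (i, true) x) (fun i => rat u (i, false) x)
    (fun i => rat_pos hu _ x) (fun i => rat_pos hu _ x) (by
      rw [← sum_rat hu hx, sum_dir])
  have h5 : FF u x = ∑ i, ((rat u (i, true) x - 1) ^ 2 + (rat u (i, false) x - 1) ^ 2) := by
    unfold FF; rw [sum_dir]
  rw [← h5] at h4
  refine h4.trans ?_
  have h6 := mul_le_mul_of_nonneg_left h3 (by positivity : (0 : ℝ) ≤ 136 * (d : ℝ) ^ 4)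
  refine le_trans (le_of_eq ?_) h6
  field_simp

/-- squared Euclidean norm -/
def nsq {d : ℕ} (x : Zd d) : ℝ := ∑ i, ((x i : ℤ) : ℝ) ^ 2

def sg {d : ℕ} (x : Zd d) (v : Dir d) : ℝ := if v.2 then (x v.1 : ℝ) else - (x v.1 : ℝ)

lemma nsq_add {d : ℕ} (x : Zd d) (v : Dir d) : nsq (x + dir v) = nsq x + (1 + 2 * sg x v) := by
  unfold nsq sg dir
  rcases v with ⟨i, b⟩
  have : ∀ j, (((x + Pi.single i (if b then 1 else -1) : Zd d) j : ℤ) : ℝ) ^ 2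
      = (x j : ℝ) ^ 2 + if j = i then (1 + 2 * (if b then (x i : ℝ) else - (x i : ℝ))) else 0 := by
    intro j
    by_cases h : j = i
    · subst h
      cases b <;> simp <;> ring
    · simp [h]
  simp only
  rw [Finset.sum_congr rfl fun j _ => this j, Finset.sum_add_distrib]
  simp

lemma nsq_nonneg {d : ℕ} (x : Zd d) : 0 ≤ nsq x := Finset.sum_nonneg fun _ _ => sq_nonneg _

lemma sq_le_nsq {d : ℕ} (x : Zd d) (i : Fin d) : (x i : ℝ) ^ 2 ≤ nsq x :=
  Finset.single_le_sum (f := fun i => (x i : ℝ) ^ 2) (fun _ _ => sq_nonneg _) (Finset.mem_univ i)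

lemma sg_sq {d : ℕ} (x : Zd d) (v : Dir d) : (sg x v) ^ 2 = (x v.1 : ℝ) ^ 2 := by
  unfold sg; split_ifs <;> ring

lemma nsq_finite {d : ℕ} (ρ : ℝ) : {x : Zd d | nsq x < ρ ^ 2}.Finite := by
  refine (Set.Finite.pi (t := fun _ : Fin d => Set.Icc (-⌈|ρ|⌉) ⌈|ρ|⌉)
    fun i => Set.finite_Icc _ _).subset ?_
  intro x hx i _
  have h1 : (x i : ℝ) ^ 2 ≤ |ρ| ^ 2 := by
    rw [sq_abs]; exact ((sq_le_nsq x i).trans_lt hx).le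
  have h2 := abs_le.mp (abs_le_of_sq_le_sq h1 (abs_nonneg ρ))
  have h3 := Int.le_ceil |ρ|
  constructor
  · have : (-(⌈|ρ|⌉ : ℝ)) ≤ x i := by linarith [h2.1]
    exact_mod_cast this
  · have : (x i : ℝ) ≤ ⌈|ρ|⌉ := by linarith [h2.2]
    exact_mod_cast this

lemma inv_sq_bound (t δ : ℝ) (ht : 0 < t) (h : |δ| ≤ t / 2) :
    t ^ 2 / (t - δ) ^ 2 - 1 ≤ 2 * δ / t + 16 * δ ^ 2 / t ^ 2 := by
  obtain ⟨r, rfl⟩ : ∃ r, δ = r * t := ⟨δ / t, by field_simp⟩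
  have hr : |r| ≤ 1 / 2 := by
    rw [abs_mul, abs_of_pos ht] at h
    nlinarith
  obtain ⟨h1, h2⟩ := abs_le.mp hr
  have e1 : t ^ 2 / (t - r * t) ^ 2 = 1 / (1 - r) ^ 2 := by
    have : (1 - r) ≠ 0 := by linarith
    rw [show t - r * t = t * (1 - r) by ring]
    field_simp
  have e2 : 2 * (r * t) / t + 16 * (r * t) ^ 2 / t ^ 2 = 2 * r + 16 * r ^ 2 := by field_simp
  rw [e1, e2]
  have h3 : (0 : ℝ) < (1 - r) ^ 2 := by
    have : 0 < 1 - r := by linarith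
    positivity
  rw [sub_le_iff_le_add, div_le_iff₀ h3]
  have h4 : 0 ≤ r ^ 2 := sq_nonneg r
  have : (2 * r + 16 * r ^ 2 + 1) * (1 - r) ^ 2 - 1 = r ^ 2 * (13 - 30 * r + 16 * r ^ 2) := by ring
  nlinarith [mul_nonneg h4 (by nlinarith : (0 : ℝ) ≤ 13 - 30 * r + 16 * r ^ 2)]

lemma quad_bound (κ Y ρ b c : ℝ) 
    (h : Y ^ 2 ≤ κ * (b * ρ * Y + c * ρ ^ 2)) :
    Y ^ 2 ≤ (κ ^ 2 * b ^ 2 + 2 * κ * c) * ρ ^ 2 := by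
  nlinarith [sq_nonneg (Y - κ * b * ρ)]

/-- Discrete Cheng–Yau gradient estimate at the origin. -/
lemma grad_origin {d : ℕ} (hd : 0 < d) : ∃ C : ℝ, 0 < C ∧ ∀ (u : Zd d → ℝ) (ρ : ℝ), 1 ≤ ρ →
    (∀ x, 0 < u x) → (∀ x, nsq x < ρ ^ 2 → Harm u x) → FF u 0 * ρ ^ 2 ≤ C := by
  set κ : ℝ := 136 * (d : ℝ) ^ 4 with hκ
  have hd1 : (1 : ℝ) ≤ d := by exact_mod_cast hd
  have hκ1 : 1 ≤ κ := by
    have : (1 : ℝ) ≤ (d : ℝ) ^ 4 := one_le_pow₀ hd1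
    linarith
  set C : ℝ := 144 * d ^ 2 + (κ ^ 2 * (2 * (4 * d)) ^ 2 + 2 * κ * (292 * d)) with hC
  refine ⟨C, by positivity, ?_⟩
  intro u ρ hρ hu hharm
  set D : Set (Zd d) := {x | nsq x < ρ ^ 2} with hD
  have h0 : (0 : Zd d) ∈ D := by
    have : nsq (0 : Zd d) = 0 := by simp [nsq]
    rw [hD, Set.mem_ofPred_eq, this]; positivity
  obtain ⟨x, hxD, hmax⟩ := Set.exists_max_image D (fun x => (ρ ^ 2 - nsq x) ^ 2 * FF u x)
    (nsq_finite ρ) ⟨0, h0⟩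
  have hkey : (ρ ^ 2 - nsq x) ^ 2 * FF u x ≤ C * ρ ^ 2 := by
    set t := ρ ^ 2 - nsq x with ht
    have htpos : 0 < t := by
      have : nsq x < ρ ^ 2 := hxD
      linarith
    have hF4 := FF_le hu (hharm x hxD)
    have hF0 := FF_nonneg u x
    by_cases hcase : t ≤ 6 * ρ
    · have : t ^ 2 ≤ (6 * ρ) ^ 2 := pow_le_pow_left₀ htpos.le hcase 2
      have h2 : t ^ 2 * FF u x ≤ (6 * ρ) ^ 2 * (4 * d ^ 2) := by
        apply mul_le_mul this hF4 hF0 (by positivity)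
      refine h2.trans ?_
      rw [hC]
      have : 0 ≤ (κ ^ 2 * (2 * (4 * d)) ^ 2 + 2 * κ * (292 * d)) * ρ ^ 2 := by positivity
      nlinarith
    · push Not at hcase
      set δ : Dir d → ℝ := fun w => 1 + 2 * sg x w with hδ
      have hsg : ∀ w, |sg x w| ≤ ρ := by
        intro w
        apply abs_le_of_sq_le_sq _ (by linarith)
        rw [sg_sq]
        exact ((sq_le_nsq x w.1).trans_lt hxD).le
      have hδabs : ∀ w, |δ w| ≤ 3 * ρ := by
        intro w
        have := abs_le.mp (hsg w)
        simp only [hδ]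
        rw [abs_le]; constructor <;> linarith
      have ht' : ∀ w, ρ ^ 2 - nsq (x + dir w) = t - δ w := by
        intro w; rw [nsq_add]; simp only [hδ, ht]; ring
      have hwD : ∀ w, x + dir w ∈ D := by
        intro w
        have h1 := ht' w
        have h2 := (abs_le.mp (hδabs w)).2
        rw [hD, Set.mem_ofPred_eq]
        linarith
      have hb := bochner hd hu (hharm x hxD) (fun w => hharm _ (hwD w))
      rw [← hκ] at hb
      have hFw : ∀ w, FF u (x + dir w) - FF u x
          ≤ FF u x * (2 * δ w / t + 16 * (δ w) ^ 2 / t ^ 2) := by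
        intro w
        have h1 := hmax _ (hwD w)
        rw [ht' w] at h1
        have h2 := (abs_le.mp (hδabs w)).2
        have h3 : 0 < t - δ w := by linarith
        have h4 : FF u (x + dir w) ≤ FF u x * (t ^ 2 / (t - δ w) ^ 2) := by
          rw [← mul_div_assoc, le_div_iff₀ (by positivity)]
          linarith
        have h5 := inv_sq_bound t (δ w) htpos (by linarith [hδabs w])
        have h6 := mul_le_mul_of_nonneg_left h5 hF0
        linarith
      have hsum : ∑ w, rat u w x * (FF u (x + dir w) - FF u x)
          ≤ FF u x * (2 / t * ∑ w, rat u w x * δ w + 16 / t ^ 2 * ∑ w, rat u w x * (δ w) ^ 2) := by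
        rw [mul_add, Finset.mul_sum, Finset.mul_sum, Finset.mul_sum, Finset.mul_sum,
          ← Finset.sum_add_distrib]
        refine Finset.sum_le_sum fun w _ => ?_
        have := mul_le_mul_of_nonneg_left (hFw w) (rat_pos hu w x).le
        refine this.trans (le_of_eq ?_)
        ring
      have hs2 : ∑ w, rat u w x * (δ w) ^ 2 ≤ 2 * d * (9 * ρ ^ 2) := by
        rw [← sum_rat hu (hharm x hxD), Finset.sum_mul]
        refine Finset.sum_le_sum fun w _ => mul_le_mul_of_nonneg_left ?_ (rat_pos hu w x).le
        have := pow_le_pow_left₀ (abs_nonneg _) (hδabs w) 2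
        rw [sq_abs] at this
        linarith
      have hsd : ∑ w, δ w = 2 * d := by
        rw [sum_dir]
        have : (2 * d : ℝ) = ∑ i : Fin d, (2 : ℝ) := by simp; ring
        rw [this]
        refine Finset.sum_congr rfl fun i _ => ?_
        simp only [hδ, sg]
        simp
        ring
      have hsd2 : ∑ w, (δ w) ^ 2 ≤ 16 * d * ρ ^ 2 := by
        have e1 : ∑ w, (δ w) ^ 2 = 2 * d + 8 * nsq x := by
          rw [sum_dir, nsq, Finset.mul_sum]
          simp only [hδ, sg]
          have : (2 * d : ℝ) = ∑ i : Fin d, (2 : ℝ) := by simp; ring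
          rw [this, ← Finset.sum_add_distrib]
          refine Finset.sum_congr rfl fun i _ => ?_
          simp
          ring
        have e2 : nsq x < ρ ^ 2 := hxD
        have e3 : 1 ≤ ρ ^ 2 := one_le_pow₀ hρ
        nlinarith
      set s := Real.sqrt (FF u x) with hs
      have hs0 : 0 ≤ s := Real.sqrt_nonneg _
      have hss : s ^ 2 = FF u x := Real.sq_sqrt hF0
      have hs1 : ∑ w, rat u w x * δ w ≤ 2 * d + s * (4 * d * ρ) := by
        have e1 : ∑ w, rat u w x * δ w = 2 * d + ∑ w, (rat u w x - 1) * δ w := by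
          rw [← hsd, ← Finset.sum_add_distrib]
          exact Finset.sum_congr rfl fun w _ => by ring
        rw [e1]
        have e2 := Finset.sum_mul_sq_le_sq_mul_sq Finset.univ (fun w => rat u w x - 1) δ
        have e3 : (∑ w, (rat u w x - 1) * δ w) ^ 2 ≤ (s * (4 * d * ρ)) ^ 2 := by
          refine e2.trans ?_
          have : ∑ w, (rat u w x - 1) ^ 2 = s ^ 2 := by rw [hss]; rfl
          rw [this, mul_pow]
          refine mul_le_mul_of_nonneg_left (hsd2.trans ?_) (sq_nonneg _)
          have : 0 ≤ ρ ^ 2 := sq_nonneg _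
          nlinarith [mul_nonneg (by nlinarith : (0 : ℝ) ≤ d * (d - 1)) this]
        have e4 := abs_le_of_sq_le_sq e3 (by positivity)
        linarith [le_abs_self (∑ w, (rat u w x - 1) * δ w)]
      -- combine
      have hcomb : (FF u x) ^ 2 ≤ κ * (FF u x * (2 / t * (2 * d + s * (4 * d * ρ))
          + 16 / t ^ 2 * (2 * d * (9 * ρ ^ 2)))) := by
        refine hb.trans (mul_le_mul_of_nonneg_left (hsum.trans ?_) (by linarith))
        refine mul_le_mul_of_nonneg_left ?_ hF0
        exact add_le_add (mul_le_mul_of_nonneg_left hs1 (by positivity))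
          (mul_le_mul_of_nonneg_left hs2 (by positivity))
      rcases hF0.eq_or_lt with hz | hpos
      · rw [← hz]; simp; positivity
      have hc2 : FF u x ≤ κ * (2 / t * (2 * d + s * (4 * d * ρ))
          + 16 / t ^ 2 * (2 * d * (9 * ρ ^ 2))) := by
        apply le_of_mul_le_mul_left _ hpos
        calc FF u x * FF u x = (FF u x) ^ 2 := by ring
          _ ≤ _ := hcomb
          _ = _ := by ring
      have hc3 : (t * s) ^ 2 ≤ κ * (2 * (4 * d) * ρ * (t * s) + 292 * d * ρ ^ 2) := by
        have e1 := mul_le_mul_of_nonneg_left hc2 (sq_nonneg t)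
        have e2 : t ^ 2 * (κ * (2 / t * (2 * d + s * (4 * d * ρ))
          + 16 / t ^ 2 * (2 * d * (9 * ρ ^ 2))))
          = κ * (4 * d * t + 2 * (4 * d) * ρ * (t * s) + 288 * d * ρ ^ 2) := by
          field_simp
          ring
        rw [e2] at e1
        have e3 : t ≤ ρ ^ 2 := by linarith [nsq_nonneg x]
        rw [mul_pow, hss]
        refine e1.trans (mul_le_mul_of_nonneg_left ?_ (by linarith))
        have := mul_le_mul_of_nonneg_left e3 (by positivity : (0 : ℝ) ≤ 4 * d)
        linarith
      have hfin := quad_bound κ (t * s) ρ (2 * (4 * d)) (292 * d) hc3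
      rw [mul_pow, hss] at hfin
      refine hfin.trans ?_
      rw [hC]
      have : 0 ≤ 144 * (d : ℝ) ^ 2 * ρ ^ 2 := by positivity
      nlinarith
  have hm0 := hmax 0 h0
  have hn0 : nsq (0 : Zd d) = 0 := by simp [nsq]
  rw [hn0, sub_zero] at hm0
  have h1 := hm0.trans hkey
  have h2 : 0 < ρ ^ 2 := by positivity
  apply le_of_mul_le_mul_left _ h2
  nlinarith

end DProof
namespace DProof

lemma mem_ball_zero {d : ℕ} (r : ℕ) (y : Zd d) : y ∈ ball (0 : Zd d) r ↔ ∀ i, (y i).natAbs ≤ r := by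
  simp [ball, supDist]

lemma grad_point {d : ℕ} (hd : 0 < d) : ∃ C : ℝ, 0 < C ∧ ∀ (h : Zd d → ℝ) (ρ : ℝ) (x : Zd d),
    1 ≤ ρ → (∀ y, 0 ≤ h y) → (∀ y, nsq (y - x) < ρ ^ 2 → Harm h y) →
    ∀ v, |h (x + dir v) - h x| ≤ C / ρ * h x := by
  obtain ⟨C, hC, hgrad⟩ := grad_origin hd
  refine ⟨Real.sqrt C, Real.sqrt_pos.mpr hC, ?_⟩
  intro h ρ x hρ hh hharm v
  have hρ0 : 0 < ρ := by linarith
  have key : ∀ ε > 0, |h (x + dir v) - h x| ≤ Real.sqrt C / ρ * (h x + ε) := by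
    intro ε hε
    set u : Zd d → ℝ := fun y => h (x + y) + ε with hu
    have hupos : ∀ y, 0 < u y := fun y => by simp only [hu]; linarith [hh (x + y)]
    have h1 := hgrad u ρ hρ hupos (by
      intro y hy
      have := hharm (x + y) (by simpa using hy)
      unfold Harm at *
      simp only [hu]
      rw [Finset.sum_add_distrib]
      simp only [← add_assoc]
      rw [this]
      simp
      ring)
    have h2 : (rat u v 0 - 1) ^ 2 ≤ FF u 0 :=
      Finset.single_le_sum (f := fun v => (rat u v 0 - 1) ^ 2) (fun _ _ => sq_nonneg _)
        (Finset.mem_univ v)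
    have h3 : (rat u v 0 - 1) ^ 2 ≤ (Real.sqrt C / ρ) ^ 2 := by
      rw [div_pow, Real.sq_sqrt hC.le, le_div_iff₀ (by positivity)]
      nlinarith [sq_nonneg ρ]
    have h4 := abs_le_of_sq_le_sq h3 (by positivity)
    have h5 : h (x + dir v) - h x = (rat u v 0 - 1) * (h x + ε) := by
      have : h x + ε ≠ 0 := by linarith [hh x]
      simp only [rat, hu, zero_add, add_zero]
      field_simp
      ring
    have h6 : 0 ≤ h x + ε := by linarith [hh x]
    rw [h5, abs_mul, abs_of_nonneg h6]
    exact mul_le_mul_of_nonneg_right h4 h6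
  have hc : 0 < Real.sqrt C / ρ := div_pos (Real.sqrt_pos.mpr hC) hρ0
  apply _root_.le_of_forall_pos_le_add
  intro ε hε
  have := key (ε / (Real.sqrt C / ρ)) (div_pos hε hc)
  rw [mul_add, mul_div_cancel₀ _ hc.ne'] at this
  exact this

def l1 {d : ℕ} (x : Zd d) : ℕ := ∑ i, (x i).natAbs

lemma l1_step {d : ℕ} (x : Zd d) (n : ℕ) (h : l1 x = n + 1) :
    ∃ (x' : Zd d) (v : Dir d), x = x' + dir v ∧ l1 x' = n := by
  have : ∃ i, x i ≠ 0 := by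
    by_contra hcon
    push Not at hcon
    simp [l1, hcon] at h
  obtain ⟨i, hi⟩ := this
  have gen : ∀ v : Dir d, v.1 = i → (x i - dir v i).natAbs + 1 = (x i).natAbs →
      ∃ (x' : Zd d) (v : Dir d), x = x' + dir v ∧ l1 x' = n := by
    intro v hv hv2
    refine ⟨x - dir v, v, by abel, ?_⟩
    unfold l1 at *
    rw [← Finset.add_sum_erase _ _ (Finset.mem_univ i)] at h ⊢
    have : ∑ j ∈ Finset.univ.erase i, ((x - dir v) j).natAbs
        = ∑ j ∈ Finset.univ.erase i, (x j).natAbs := by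
      refine Finset.sum_congr rfl fun j hj => ?_
      have hj' : j ≠ v.1 := by rw [hv]; exact (Finset.mem_erase.mp hj).1
      simp [dir, hj']
    rw [this]
    have : ((x - dir v) i).natAbs + 1 = (x i).natAbs := hv2
    omega
  rcases lt_or_gt_of_ne hi with hneg | hpos
  · refine gen (i, false) rfl ?_
    simp [dir]; omega
  · refine gen (i, true) rfl ?_
    simp [dir]; omega

lemma coord_le_l1 {d : ℕ} (x : Zd d) (i : Fin d) : |(x i : ℝ)| ≤ l1 x := by
  have : (x i).natAbs ≤ l1 x :=
    Finset.single_le_sum (f := fun i => (x i).natAbs) (fun _ _ => Nat.zero_le _) (Finset.mem_univ i)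
  have h2 : ((x i).natAbs : ℝ) ≤ l1 x := by exact_mod_cast this
  rwa [Nat.cast_natAbs, Int.cast_abs] at h2

lemma grad_path {d : ℕ} (hd : 0 < d) : ∃ C : ℝ, 0 < C ∧ ∀ (h : Zd d → ℝ) (ρ : ℝ) (N : ℕ),
    1 ≤ ρ → C ≤ ρ → (∀ y, 0 ≤ h y) → (∀ y : Zd d, (∀ i, |(y i : ℝ)| ≤ N + ρ) → Harm h y) →
    ∀ n ≤ N, ∀ x, l1 x = n → (1 - C / ρ) ^ n * h 0 ≤ h x ∧ h x ≤ (1 + C / ρ) ^ n * h 0 := by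
  obtain ⟨C, hC, hg⟩ := grad_point hd
  refine ⟨C, hC, ?_⟩
  intro h ρ N hρ hCρ hh hharm n
  have hρ0 : 0 < ρ := by linarith
  have hq1 : C / ρ ≤ 1 := by rw [div_le_one hρ0]; exact hCρ
  have hq0 : 0 ≤ C / ρ := by positivity
  induction n with
  | zero =>
    intro _ x hx
    have : x = 0 := by
      funext i
      have := (Finset.sum_eq_zero_iff.mp hx) i (Finset.mem_univ i)
      simpa using this
    simp [this]
  | succ n ih =>
    intro hn x hx
    obtain ⟨x', v, rfl, hx'⟩ := l1_step x n hx
    obtain ⟨h1, h2⟩ := ih (by omega) x' hx'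
    have h3 := hg h ρ x' hρ hh (by
      intro y hy
      apply hharm
      intro i
      have e1 : |(y i - x' i : ℝ)| ≤ ρ := by
        apply abs_le_of_sq_le_sq _ hρ0.le
        have := sq_le_nsq (y - x') i
        simp only [Pi.sub_apply, Int.cast_sub] at this
        linarith
      have e2 := coord_le_l1 x' i
      have e3 : (l1 x' : ℝ) ≤ N := by
        rw [hx']; exact_mod_cast (by omega : n ≤ N)
      have e4 : (y i : ℝ) = (y i - x' i : ℝ) + x' i := by ring
      rw [e4]
      refine (abs_add_le _ _).trans ?_
      have e5 : |(y i - x' i : ℝ)| ≤ ρ := e1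
      linarith) v
    obtain ⟨h4, h5⟩ := abs_le.mp h3
    constructor
    · calc (1 - C / ρ) ^ (n + 1) * h 0 = (1 - C / ρ) * ((1 - C / ρ) ^ n * h 0) := by ring
        _ ≤ (1 - C / ρ) * h x' := mul_le_mul_of_nonneg_left h1 (by linarith)
        _ ≤ _ := by linarith
    · calc h (x' + dir v) ≤ (1 + C / ρ) * h x' := by linarith
        _ ≤ (1 + C / ρ) * ((1 + C / ρ) ^ n * h 0) := mul_le_mul_of_nonneg_left h2 (by linarith)
        _ = _ := by ring

lemma exp_small (δ : ℝ) (h0 : 0 ≤ δ) (h1 : δ ≤ 1 / 2) : Real.exp δ ≤ 1 + 2 * δ := by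
  have h2 := Real.add_one_le_exp (-δ)
  have h3 : Real.exp δ * Real.exp (-δ) = 1 := by rw [← Real.exp_add]; simp
  have h4 := Real.exp_pos δ
  have h5 : Real.exp δ * (1 - δ) ≤ 1 := by nlinarith
  nlinarith [mul_nonneg h0 (by linarith : 0 ≤ 1 - 2 * δ)]

lemma harnack {d : ℕ} (hd : 0 < d) (c : ℕ) : ∃ C : ℝ, 0 < C ∧ ∀ (K L : ℕ), C ≤ K → 1 ≤ L →
    ∀ h : Zd d → ℝ, (∀ y, 0 ≤ h y) → (∀ y ∈ ball (0 : Zd d) (K * L), Harm h y) →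
    ∀ x ∈ ball (0 : Zd d) (c * L), |h x - h 0| ≤ C / K * h 0 := by
  obtain ⟨C, hC, hp⟩ := grad_path hd
  refine ⟨4 * C * d * c + 2 * d * c + 4 + 2 * C, by positivity, ?_⟩
  intro K L hK hL h hh hharm x hx
  have hL1 : (1 : ℝ) ≤ L := by exact_mod_cast hL
  have hdc : (0 : ℝ) ≤ d * c := by positivity
  have hCdc : (0 : ℝ) ≤ C * d * c := by positivity
  have hK4 : (4 : ℝ) ≤ K := by nlinarith
  have hK0 : (0 : ℝ) < K := by linarith
  have hKL : (K : ℝ) ≤ K * L := by nlinarith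
  have hx1 : l1 x ≤ d * (c * L) := by
    rw [mem_ball_zero] at hx
    calc l1 x ≤ ∑ i : Fin d, c * L := Finset.sum_le_sum fun i _ => hx i
      _ = _ := by simp
  have hρpos : (0 : ℝ) < K * L / 2 := by nlinarith
  obtain ⟨h1, h2⟩ := hp h (K * L / 2) (d * (c * L)) (by nlinarith) (by nlinarith) hh (by
    intro y hy
    apply hharm
    rw [mem_ball_zero]
    intro i
    have e1 := hy i
    have e2 : ((d * (c * L) : ℕ) : ℝ) ≤ K * L / 2 := by
      push_cast
      nlinarith
    have e3 : ((y i).natAbs : ℝ) ≤ (K * L : ℕ) := by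
      rw [Nat.cast_natAbs, Int.cast_abs]
      push_cast
      linarith
    exact_mod_cast e3) (l1 x) hx1 x rfl
  set r := C / (K * L / 2) with hr
  have hr0 : 0 ≤ r := by positivity
  set n := l1 x
  set δ : ℝ := n * r with hδ
  have hδ0 : 0 ≤ δ := by positivity
  have hδ1 : δ ≤ 2 * C * d * c / K := by
    have e1 : (n : ℝ) ≤ d * (c * L) := by exact_mod_cast hx1
    calc δ ≤ d * (c * L) * r := mul_le_mul_of_nonneg_right e1 hr0
      _ = 2 * C * d * c / K := by rw [hr]; field_simp
  have hδ2 : δ ≤ 1 / 2 := by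
    refine hδ1.trans ?_
    rw [div_le_iff₀ hK0]
    nlinarith
  have hr1 : r ≤ 1 := by
    rw [hr, div_le_one hρpos]; nlinarith
  have h00 := hh 0
  have up : (1 + r) ^ n ≤ 1 + 2 * δ := by
    refine le_trans ?_ (exp_small δ hδ0 hδ2)
    rw [hδ, Real.exp_nat_mul]
    exact pow_le_pow_left₀ (by linarith) (by linarith [Real.add_one_le_exp r]) n
  have lo : 1 - δ ≤ (1 - r) ^ n := by
    have := one_add_mul_le_pow (a := -r) (by linarith) n
    rw [hδ]
    calc 1 - n * r = 1 + n * (-r) := by ring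
      _ ≤ (1 + -r) ^ n := this
      _ = _ := by ring
  have hfin : 2 * δ ≤ (4 * C * d * c + 2 * d * c + 4 + 2 * C) / K := by
    rw [le_div_iff₀ hK0]
    rw [le_div_iff₀ hK0] at hδ1
    nlinarith
  refine le_trans ?_ (mul_le_mul_of_nonneg_right hfin h00)
  rw [abs_le]
  constructor
  · nlinarith [mul_le_mul_of_nonneg_right lo h00, mul_nonneg hδ0 h00]
  · nlinarith [mul_le_mul_of_nonneg_right up h00, mul_nonneg hδ0 h00]

end DProof
namespace DProof

/-! ### A positive superharmonic function decaying like `1/|x|` -/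

lemma inv_sqrt_poly (u : ℝ) (h : |u| ≤ 1 / 2) :
    1 / Real.sqrt (1 + u) ≤ 1 - u / 2 + 3 / 8 * u ^ 2 - 5 / 16 * u ^ 3 + u ^ 4 := by
  obtain ⟨h1, h2⟩ := abs_le.mp h
  set P := 1 - u / 2 + 3 / 8 * u ^ 2 - 5 / 16 * u ^ 3 + u ^ 4 with hP
  have hu2 : u ^ 2 ≤ 1 / 4 := by nlinarith
  have hu20 : 0 ≤ u ^ 2 := sq_nonneg u
  have hPpos : 0 < P := by
    have : 0 ≤ u ^ 2 * (3 / 8 - 5 / 16 * u) := mul_nonneg hu20 (by linarith)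
    have : 0 ≤ u ^ 4 := by positivity
    rw [hP]; nlinarith
  have hpos : 0 < 1 + u := by linarith
  rw [div_le_iff₀ (Real.sqrt_pos.mpr hpos)]
  have hkey : 1 ≤ P ^ 2 * (1 + u) := by
    have e : P ^ 2 * (1 + u) - 1 = u ^ 4 * (93 / 64 + 39 / 32 * u - 99 / 256 * u ^ 2
        + 57 / 256 * u ^ 3 + 3 / 8 * u ^ 4 + u ^ 5) := by
      rw [hP]; ring
    have hu3 : -(1 / 8) ≤ u ^ 3 := by nlinarith
    have hu5 : -(1 / 32) ≤ u ^ 5 := by nlinarith [sq_nonneg (u ^ 2)]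
    have hu4 : 0 ≤ u ^ 4 := by positivity
    have : 0 ≤ u ^ 4 * (93 / 64 + 39 / 32 * u - 99 / 256 * u ^ 2
        + 57 / 256 * u ^ 3 + 3 / 8 * u ^ 4 + u ^ 5) := mul_nonneg hu4 (by linarith)
    linarith
  have : 1 ≤ (P * Real.sqrt (1 + u)) ^ 2 := by
    rw [mul_pow, Real.sq_sqrt hpos.le]; exact hkey
  have h0 : 0 ≤ P * Real.sqrt (1 + u) := by positivity
  nlinarith

noncomputable def phi {d : ℕ} (x : Zd d) : ℝ := 1 / Real.sqrt (nsq x + 16)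

lemma phi_pos {d : ℕ} (x : Zd d) : 0 < phi x := by
  have := nsq_nonneg x
  unfold phi; positivity

lemma phi_super {d : ℕ} (hd : 3 ≤ d) (x : Zd d) : ∑ v, phi (x + dir v) ≤ 2 * d * phi x := by
  have hd3 : (3 : ℝ) ≤ d := by exact_mod_cast hd
  set n := nsq x with hn
  have hn0 : 0 ≤ n := nsq_nonneg x
  set q := n + 17 with hq
  have hqpos : 0 < q := by linarith
  set U : Fin d → ℝ := fun i => 2 * (x i : ℝ) / q with hU
  have hUabs : ∀ i, |U i| ≤ 1 / 2 := by
    intro i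
    have h1 : (x i : ℝ) ^ 2 ≤ n := sq_le_nsq x i
    rw [hU]
    simp only
    rw [abs_div, abs_of_pos hqpos, div_le_iff₀ hqpos, abs_mul, abs_two]
    rw [← sq_abs] at h1
    nlinarith [sq_nonneg (|(x i : ℝ)| - 2)]
  have hsqrt : ∀ y : ℝ, |y| ≤ 1 / 2 → 1 / Real.sqrt (q * (1 + y)) = 1 / Real.sqrt q * (1 / Real.sqrt (1 + y)) := by
    intro y hy
    rw [Real.sqrt_mul hqpos.le]
    rw [one_div_mul_one_div]
  have hterm : ∀ i, phi (x + dir (i, true)) + phi (x + dir (i, false))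
      ≤ 1 / Real.sqrt q * (2 + 3 / 4 * (U i) ^ 2 + 2 * (U i ^ 2) ^ 2) := by
    intro i
    have e1 : phi (x + dir (i, true)) = 1 / Real.sqrt q * (1 / Real.sqrt (1 + U i)) := by
      rw [← hsqrt _ (hUabs i)]
      unfold phi
      rw [nsq_add]
      congr 2
      simp only [sg, hU, hq]
      field_simp
      simp
      ring
    have e2 : phi (x + dir (i, false)) = 1 / Real.sqrt q * (1 / Real.sqrt (1 + -U i)) := by
      rw [← hsqrt _ (by rw [abs_neg]; exact hUabs i)]
      unfold phi
      rw [nsq_add]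
      congr 2
      simp only [sg, hU, hq]
      field_simp
      simp
      ring
    rw [e1, e2, ← mul_add]
    refine mul_le_mul_of_nonneg_left ?_ (by positivity)
    have e3 := inv_sqrt_poly (U i) (hUabs i)
    have e4 := inv_sqrt_poly (-U i) (by rw [abs_neg]; exact hUabs i)
    nlinarith
  have hU2 : ∑ i, (U i) ^ 2 = 4 * n / q ^ 2 := by
    simp only [hU, hn, nsq]
    rw [Finset.mul_sum, Finset.sum_div]
    exact Finset.sum_congr rfl fun i _ => by rw [div_pow]; ring
  have hU4 : ∑ i, ((U i) ^ 2) ^ 2 ≤ (4 * n / q ^ 2) ^ 2 := by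
    rw [← hU2]
    exact Finset.sum_sq_le_sq_sum_of_nonneg fun i _ => sq_nonneg _
  have hsum : ∑ v, phi (x + dir v) ≤ 1 / Real.sqrt q * (2 * d + 3 / 4 * (4 * n / q ^ 2)
      + 2 * (4 * n / q ^ 2) ^ 2) := by
    rw [sum_dir]
    refine (Finset.sum_le_sum fun i _ => hterm i).trans ?_
    rw [← Finset.mul_sum]
    refine mul_le_mul_of_nonneg_left ?_ (by positivity)
    rw [Finset.sum_add_distrib, Finset.sum_add_distrib, ← Finset.mul_sum, ← Finset.mul_sum, hU2]
    simp only [Finset.sum_const, Finset.card_univ, Fintype.card_fin, nsmul_eq_mul]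
    linarith
  have hpoly : 2 * d + 3 / 4 * (4 * n / q ^ 2) + 2 * (4 * n / q ^ 2) ^ 2 ≤ 2 * d * (1 + 1 / (2 * q)) := by
    have e0 : n / q ≤ 1 := by rw [div_le_one hqpos]; linarith
    have e0' : 0 ≤ n / q := by positivity
    have e1 : 3 / 4 * (4 * n / q ^ 2) + 2 * (4 * n / q ^ 2) ^ 2 = (1 / q ^ 2) * (3 * n + 32 * (n / q) ^ 2) := by
      field_simp
      ring
    have e2 : 3 * n + 32 * (n / q) ^ 2 ≤ d * q := by nlinarith
    have e3 : (1 / q ^ 2) * (d * q) = 2 * d * (1 / (2 * q)) := by field_simp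
    have e4 := mul_le_mul_of_nonneg_left e2 (by positivity : 0 ≤ 1 / q ^ 2)
    linarith
  have hs : 1 / Real.sqrt q * (1 + 1 / (2 * q)) ≤ phi x := by
    unfold phi
    rw [← hn]
    set s := n + 16 with hs
    have hspos : 0 < s := by linarith
    have e1 : Real.sqrt s * (1 + 1 / (2 * q)) ≤ Real.sqrt q := by
      apply Real.le_sqrt_of_sq_le
      rw [mul_pow, Real.sq_sqrt hspos.le]
      have : s = q - 1 := by rw [hs, hq]; ring
      rw [this]
      have hq1 : 1 ≤ q := by linarith
      have e5 : (q - 1) * (1 + 1 / (2 * q)) ^ 2 = q - (3 * q + 1) / (4 * q ^ 2) := by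
        field_simp
        ring
      rw [e5]
      have : 0 ≤ (3 * q + 1) / (4 * q ^ 2) := by positivity
      linarith
    have hq' := Real.sqrt_pos.mpr hqpos
    have hs' := Real.sqrt_pos.mpr hspos
    rw [div_mul_eq_mul_div, one_mul, div_le_div_iff₀ hq' hs']
    linarith
  calc ∑ v, phi (x + dir v) ≤ _ := hsum
    _ ≤ 1 / Real.sqrt q * (2 * d * (1 + 1 / (2 * q))) :=
        mul_le_mul_of_nonneg_left hpoly (by positivity)
    _ = 2 * d * (1 / Real.sqrt q * (1 + 1 / (2 * q))) := by ring
    _ ≤ _ := mul_le_mul_of_nonneg_left hs (by positivity)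

lemma phi_lower {d : ℕ} (L : ℕ) (hL : 1 ≤ L) (a : Zd d) (ha : a ∈ ball (0 : Zd d) L) :
    1 ≤ phi a * ((d + 4) * L) := by
  have hL1 : (1 : ℝ) ≤ L := by exact_mod_cast hL
  rw [mem_ball_zero] at ha
  have h1 : nsq a ≤ d * (L : ℝ) ^ 2 := by
    unfold nsq
    calc ∑ i, (a i : ℝ) ^ 2 ≤ ∑ i : Fin d, (L : ℝ) ^ 2 := by
          refine Finset.sum_le_sum fun i _ => ?_
          have : ((a i).natAbs : ℝ) ≤ L := by exact_mod_cast ha i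
          rw [Nat.cast_natAbs, Int.cast_abs] at this
          rw [← sq_abs]
          exact pow_le_pow_left₀ (abs_nonneg _) this 2
      _ = _ := by simp
  have h0 := nsq_nonneg a
  unfold phi
  rw [div_mul_eq_mul_div, one_mul, le_div_iff₀ (by positivity), one_mul]
  rw [Real.sqrt_le_left (by positivity)]
  have hdd : (0 : ℝ) ≤ d := by positivity
  have hL2 : 1 ≤ (L : ℝ) ^ 2 := one_le_pow₀ hL1
  nlinarith [mul_nonneg hdd (sq_nonneg (L : ℝ)), mul_nonneg (sq_nonneg (d : ℝ)) (sq_nonneg (L : ℝ))]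

lemma phi_upper {d : ℕ} (M : ℕ) (hM : 1 ≤ M) (x : Zd d) (hx : x ∉ ball (0 : Zd d) M) :
    phi x ≤ 1 / M := by
  rw [mem_ball_zero] at hx
  push Not at hx
  obtain ⟨i, hi⟩ := hx
  have hM1 : (1 : ℝ) ≤ M := by exact_mod_cast hM
  have h1 : (M : ℝ) ≤ |(x i : ℝ)| := by
    have : (M : ℝ) ≤ ((x i).natAbs : ℝ) := by exact_mod_cast hi.le
    rwa [Nat.cast_natAbs, Int.cast_abs] at this
  have h2 : (M : ℝ) ^ 2 ≤ nsq x := by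
    refine le_trans ?_ (sq_le_nsq x i)
    rw [← sq_abs (x i : ℝ)]
    exact pow_le_pow_left₀ (by linarith) h1 2
  unfold phi
  apply one_div_le_one_div_of_le (by linarith)
  apply Real.le_sqrt_of_sq_le
  linarith

end DProof
namespace DProof

/-! ### The discrete chain: first-passage weights -/

noncomputable def avgE {d : ℕ} (g : Zd d → ℝ≥0∞) (x : Zd d) : ℝ≥0∞ :=
  ∑' c, stepP d (c - x) * g c

lemma l1_dir {d : ℕ} (v : Dir d) : ∑ i, (dir v i).natAbs = 1 := by
  rw [Finset.sum_eq_single v.1]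
  · simp only [dir, Pi.single_eq_same]
    split_ifs <;> rfl
  · intro j _ hj
    simp [dir, hj]
  · simp

lemma eq_dir {d : ℕ} (w : Zd d) (h : ∑ i, (w i).natAbs = 1) : ∃ v, w = dir v := by
  obtain ⟨x', v, h1, h2⟩ := l1_step w 0 h
  refine ⟨v, ?_⟩
  have : x' = 0 := by
    funext i
    have := (Finset.sum_eq_zero_iff.mp h2) i (Finset.mem_univ i)
    simpa using this
  rw [h1, this, zero_add]

lemma dir_inj {d : ℕ} : Function.Injective (dir : Dir d → Zd d) := by
  rintro ⟨i, b⟩ ⟨j, b'⟩ h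
  have h1 := congrFun h i
  by_cases hij : i = j
  · subst hij
    simp only [dir, Pi.single_eq_same] at h1
    cases b <;> cases b' <;> simp_all
  · simp only [dir, Pi.single_eq_same] at h1
    rw [Pi.single_eq_of_ne hij] at h1
    cases b <;> simp at h1

lemma stepP_dir {d : ℕ} (v : Dir d) : stepP d (dir v) = ((2 * d : ℕ) : ℝ≥0∞)⁻¹ := by
  unfold stepP
  rw [if_pos (l1_dir v)]

lemma avgE_eq {d : ℕ} (g : Zd d → ℝ≥0∞) (x : Zd d) :
    avgE g x = ((2 * d : ℕ) : ℝ≥0∞)⁻¹ * ∑ v, g (x + dir v) := by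
  unfold avgE
  have hinj : Function.Injective (fun v : Dir d => x + dir v) := fun v w h =>
    dir_inj (add_left_cancel h)
  rw [tsum_eq_sum (s := Finset.univ.image (fun v : Dir d => x + dir v))]
  · rw [Finset.sum_image (fun v _ w _ h => hinj h), Finset.mul_sum]
    refine Finset.sum_congr rfl fun v _ => ?_
    rw [add_sub_cancel_left, stepP_dir]
  · intro c hc
    unfold stepP
    split_ifs with h
    · exfalso
      obtain ⟨v, hv⟩ := eq_dir _ h
      apply hc
      rw [Finset.mem_image]
      exact ⟨v, Finset.mem_univ _, by rw [← hv]; abel⟩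
    · simp

lemma stepP_symm {d : ℕ} (a b : Zd d) : stepP d (a - b) = stepP d (b - a) := by
  unfold stepP
  have : ∑ i, ((a - b) i).natAbs = ∑ i, ((b - a) i).natAbs :=
    Finset.sum_congr rfl fun i _ => by simp only [Pi.sub_apply]; omega
  rw [this]

lemma avgE_mono {d : ℕ} {g g' : Zd d → ℝ≥0∞} (h : ∀ x, g x ≤ g' x) (x : Zd d) :
    avgE g x ≤ avgE g' x :=
  ENNReal.tsum_le_tsum fun c => by gcongr; exact h c

lemma avgE_one {d : ℕ} (hd : 0 < d) (x : Zd d) : avgE (fun _ : Zd d => (1 : ℝ≥0∞)) x = 1 := by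
  rw [avgE_eq]
  have h : (∑ _v : Dir d, (1 : ℝ≥0∞)) = ((2 * d : ℕ) : ℝ≥0∞) := by
    rw [Finset.sum_const, Finset.card_univ, card_dir]; simp
  rw [h]
  exact ENNReal.inv_mul_cancel (by exact_mod_cast (by omega : 2 * d ≠ 0)) (ENNReal.natCast_ne_top _)

lemma avgE_tsum {d : ℕ} (g : ℕ → Zd d → ℝ≥0∞) (x : Zd d) :
    avgE (fun y => ∑' n, g n y) x = ∑' n, avgE (g n) x := by
  unfold avgE
  rw [ENNReal.tsum_comm]
  exact tsum_congr fun c => by rw [ENNReal.tsum_mul_left]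

lemma avgE_sum {d : ℕ} (g : ℕ → Zd d → ℝ≥0∞) (s : Finset ℕ) (x : Zd d) :
    avgE (fun y => ∑ n ∈ s, g n y) x = ∑ n ∈ s, avgE (g n) x := by
  simp only [avgE_eq]
  rw [Finset.sum_comm, Finset.mul_sum]

noncomputable def NN {d : ℕ} (D T : Set (Zd d)) : ℕ → Zd d → ℝ≥0∞
  | 0 => T.indicator (fun _ => 1)
  | n + 1 => D.indicator (avgE (NN D T n))

noncomputable def RR {d : ℕ} (D T : Set (Zd d)) (x : Zd d) : ℝ≥0∞ := ∑' n, NN D T n x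

lemma indicator_tsum' {d : ℕ} (D : Set (Zd d)) (g : ℕ → Zd d → ℝ≥0∞) (x : Zd d) :
    ∑' n, D.indicator (g n) x = D.indicator (fun y => ∑' n, g n y) x := by
  by_cases h : x ∈ D <;> simp [h]

lemma RR_eq {d : ℕ} (D T : Set (Zd d)) (x : Zd d) :
    RR D T x = T.indicator (fun _ => 1) x + D.indicator (avgE (RR D T)) x := by
  have h1 : RR D T x = NN D T 0 x + ∑' n, NN D T (n + 1) x := by
    unfold RR; exact tsum_eq_zero_add' ENNReal.summable
  rw [h1]
  congr 1
  have : avgE (RR D T) = fun y => ∑' n, avgE (NN D T n) y := by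
    funext y; exact avgE_tsum _ y
  rw [this, ← indicator_tsum']
  rfl

lemma RR_le {d : ℕ} (D T : Set (Zd d)) (hDT : Disjoint D T) (g : Zd d → ℝ≥0∞)
    (hT : ∀ x ∈ T, 1 ≤ g x) (hg : ∀ x ∈ D, avgE g x ≤ g x) (x : Zd d) : RR D T x ≤ g x := by
  have key : ∀ n x, ∑ k ∈ Finset.range n, NN D T k x ≤ g x := by
    intro n
    induction n with
    | zero => intro x; simp
    | succ n ih =>
      intro x
      rw [Finset.sum_range_succ']
      have e0 : ∑ k ∈ Finset.range n, NN D T (k + 1) x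
          = D.indicator (avgE (fun y => ∑ k ∈ Finset.range n, NN D T k y)) x := by
        by_cases h : x ∈ D
        · rw [Set.indicator_of_mem h, avgE_sum]
          exact Finset.sum_congr rfl fun k _ => Set.indicator_of_mem h _
        · rw [Set.indicator_of_notMem h]
          exact Finset.sum_eq_zero fun k _ => Set.indicator_of_notMem h _
      rw [e0]
      by_cases h : x ∈ D
      · have hT' : x ∉ T := Set.disjoint_left.mp hDT h
        rw [Set.indicator_of_mem h]
        have : NN D T 0 x = 0 := Set.indicator_of_notMem hT' _
        rw [this, add_zero]
        exact (avgE_mono ih x).trans (hg x h)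
      · rw [Set.indicator_of_notMem h, zero_add]
        by_cases h' : x ∈ T
        · have : NN D T 0 x = 1 := Set.indicator_of_mem h' _
          rw [this]; exact hT x h'
        · have : NN D T 0 x = 0 := Set.indicator_of_notMem h' _
          rw [this]; exact zero_le
  exact ENNReal.tsum_le_of_sum_range_le fun n => key n x

lemma RR_le_one {d : ℕ} (hd : 0 < d) (D T : Set (Zd d)) (hDT : Disjoint D T) (x : Zd d) :
    RR D T x ≤ 1 :=
  RR_le D T hDT (fun _ => 1) (fun _ _ => le_rfl) (fun x _ => (avgE_one hd x).le) x

noncomputable def rr {d : ℕ} (D T : Set (Zd d)) (x : Zd d) : ℝ := (RR D T x).toReal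

lemma rr_nonneg {d : ℕ} (D T : Set (Zd d)) (x : Zd d) : 0 ≤ rr D T x := ENNReal.toReal_nonneg

lemma rr_le_one {d : ℕ} (hd : 0 < d) (D T : Set (Zd d)) (hDT : Disjoint D T) (x : Zd d) :
    rr D T x ≤ 1 := by
  have := ENNReal.toReal_mono (by simp) (RR_le_one hd D T hDT x)
  simpa [rr] using this

lemma avgE_toReal {d : ℕ} (hd : 0 < d) (D T : Set (Zd d)) (hDT : Disjoint D T) (x : Zd d) :
    2 * d * (avgE (RR D T) x).toReal = ∑ v, rr D T (x + dir v) := by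
  rw [avgE_eq, ENNReal.toReal_mul, ENNReal.toReal_inv, ENNReal.toReal_natCast, ENNReal.toReal_sum]
  · have : (d : ℝ) ≠ 0 := by exact_mod_cast hd.ne'
    push_cast
    field_simp
    rfl
  · intro v _
    exact ne_top_of_le_ne_top (by simp) (RR_le_one hd D T hDT _)

lemma rr_harm {d : ℕ} (hd : 0 < d) (D T : Set (Zd d)) (hDT : Disjoint D T) (x : Zd d)
    (hx : x ∈ D) : Harm (rr D T) x := by
  unfold Harm
  rw [← avgE_toReal hd D T hDT]
  congr 1
  unfold rr
  conv_rhs => rw [RR_eq]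
  rw [Set.indicator_of_mem hx, Set.indicator_of_notMem (Set.disjoint_left.mp hDT hx), zero_add]

lemma rr_one {d : ℕ} (D T : Set (Zd d)) (hDT : Disjoint D T) (x : Zd d)
    (hx : x ∈ T) : rr D T x = 1 := by
  unfold rr
  rw [RR_eq, Set.indicator_of_mem hx, Set.indicator_of_notMem (Set.disjoint_right.mp hDT hx)]
  simp

lemma rr_zero {d : ℕ} (D T : Set (Zd d)) (x : Zd d) (hx : x ∉ T) (hx' : x ∉ D) : rr D T x = 0 := by
  unfold rr
  rw [RR_eq, Set.indicator_of_notMem hx, Set.indicator_of_notMem hx']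
  simp

/-- hitting probability bound -/
lemma hit_bound {d : ℕ} (hd : 3 ≤ d) (L : ℕ) (hL : 1 ≤ L) (A : Set (Zd d))
    (hA : A ⊆ ball (0 : Zd d) L) (M : ℕ) (hM : 1 ≤ M) (x : Zd d) (hx : x ∉ ball (0 : Zd d) M) :
    rr Aᶜ A x ≤ (d + 4) * L / M := by
  have h1 : RR Aᶜ A x ≤ ENNReal.ofReal (phi x * ((d + 4) * L)) := by
    refine RR_le Aᶜ A disjoint_compl_left (fun x => ENNReal.ofReal (phi x * ((d + 4) * L))) ?_ ?_ x
    · intro a ha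
      rw [ENNReal.one_le_ofReal]
      exact phi_lower L hL a (hA ha)
    · intro y _
      rw [avgE_eq, ← ENNReal.ofReal_sum_of_nonneg (fun v _ => by have := phi_pos (y + dir v); positivity)]
      have h2 : ((2 * d : ℕ) : ℝ≥0∞)⁻¹ = ENNReal.ofReal ((2 * d : ℝ)⁻¹) := by
        rw [ENNReal.ofReal_inv_of_pos (by positivity)]
        congr 1
        rw [← ENNReal.ofReal_natCast]
        push_cast; rfl
      rw [h2, ← ENNReal.ofReal_mul (by positivity)]
      apply ENNReal.ofReal_le_ofReal
      rw [← Finset.sum_mul]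
      have h3 := phi_super hd y
      have hd0 : (0 : ℝ) < d := by exact_mod_cast (by omega : 0 < d)
      rw [inv_mul_le_iff₀ (by positivity)]
      have := mul_le_mul_of_nonneg_right h3 (by positivity : (0 : ℝ) ≤ (d + 4) * L)
      linarith
  have h2 := ENNReal.toReal_mono (by simp) h1
  rw [ENNReal.toReal_ofReal (by have := phi_pos x; positivity)] at h2
  refine h2.trans ?_
  have h3 := mul_le_mul_of_nonneg_right (phi_upper M hM x hx) (by positivity : (0 : ℝ) ≤ (d + 4) * L)
  refine h3.trans (le_of_eq ?_)
  ring

/-! ### Path reversal -/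

noncomputable def GG {d : ℕ} (D : Set (Zd d)) (n : ℕ) (a b : Zd d) : ℝ≥0∞ := avgE (NN D {b} n) a

lemma GG_zero {d : ℕ} (D : Set (Zd d)) (a b : Zd d) : GG D 0 a b = stepP d (b - a) := by
  unfold GG avgE NN
  rw [tsum_eq_single b]
  · simp
  · intro c hc
    simp [hc]

lemma GG_succ {d : ℕ} (D : Set (Zd d)) (n : ℕ) (a b : Zd d) :
    GG D (n + 1) a b = ∑' c, stepP d (c - a) * (D.indicator (fun _ => 1) c * GG D n c b) := by
  unfold GG
  conv_lhs => unfold avgE NN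
  refine tsum_congr fun c => ?_
  by_cases h : c ∈ D <;> simp [h]

lemma GG_succ' {d : ℕ} (D : Set (Zd d)) (n : ℕ) : ∀ (a b : Zd d),
    GG D (n + 1) a b = ∑' c, GG D n a c * (D.indicator (fun _ => 1) c * stepP d (b - c)) := by
  induction n with
  | zero =>
    intro a b
    rw [GG_succ]
    refine tsum_congr fun c => ?_
    rw [GG_zero, GG_zero]
  | succ n ih =>
    intro a b
    rw [GG_succ]
    have e1 : ∀ c, stepP d (c - a) * (D.indicator (fun _ => 1) c * GG D (n + 1) c b)
        = ∑' e, stepP d (c - a) * (D.indicator (fun _ => 1) c *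
          (GG D n c e * (D.indicator (fun _ => 1) e * stepP d (b - e)))) := by
      intro c
      rw [ih c b, ← ENNReal.tsum_mul_left, ← ENNReal.tsum_mul_left]
    rw [tsum_congr e1, ENNReal.tsum_comm]
    refine tsum_congr fun e => ?_
    rw [GG_succ, ← ENNReal.tsum_mul_right]
    refine tsum_congr fun c => ?_
    ring

lemma GG_symm {d : ℕ} (D : Set (Zd d)) (n : ℕ) : ∀ (a b : Zd d), GG D n a b = GG D n b a := by
  induction n with
  | zero => intro a b; rw [GG_zero, GG_zero, stepP_symm]
  | succ n ih =>
    intro a b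
    rw [GG_succ, GG_succ']
    refine tsum_congr fun c => ?_
    rw [ih c b, stepP_symm c a]
    ring

lemma avg_RR_symm {d : ℕ} (D : Set (Zd d)) (a b : Zd d) :
    avgE (RR D {b}) a = avgE (RR D {a}) b := by
  have e : ∀ b, RR D {b} = fun y => ∑' n, NN D {b} n y := fun b => rfl
  rw [e, e, avgE_tsum, avgE_tsum]
  exact tsum_congr fun n => GG_symm D n a b

end DProof
namespace DProof

lemma ball_mono {d : ℕ} {r s : ℕ} (h : r ≤ s) : ball (0 : Zd d) r ⊆ ball (0 : Zd d) s := by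
  intro y hy
  rw [mem_ball_zero] at *
  exact fun i => (hy i).trans h

lemma ball_step {d : ℕ} {r : ℕ} (x : Zd d) (v : Dir d) (h : x ∈ ball (0 : Zd d) r) :
    x + dir v ∈ ball (0 : Zd d) (r + 1) := by
  rw [mem_ball_zero] at *
  intro i
  have h1 := h i
  have h2 : (dir v i).natAbs ≤ 1 := by
    rw [← l1_dir v]
    exact Finset.single_le_sum (f := fun i => (dir v i).natAbs) (fun _ _ => Nat.zero_le _)
      (Finset.mem_univ i)
  simp only [Pi.add_apply]
  omega

/-- local maximum principle on a ball minus a set -/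
lemma max_local {d : ℕ} (hd : 0 < d) (r s : ℕ) (hrs : r + 1 ≤ s) (A : Set (Zd d))
    (hfin : (ball (0 : Zd d) r).Finite) (g : Zd d → ℝ)
    (hg : ∀ x ∈ ball (0 : Zd d) r \ A, Harm g x)
    (hA : ∀ x ∈ A, g x ≤ 0) (hs : ∀ x ∈ ball (0 : Zd d) s, x ∉ ball (0 : Zd d) r → g x ≤ 0) :
    ∀ x ∈ ball (0 : Zd d) s, g x ≤ 0 := by
  have key := max_principle hd (ball (0 : Zd d) r \ A) (hfin.subset Set.sdiff_subset)
    (fun x => if x ∈ ball (0 : Zd d) s then g x else 0) ?_ ?_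
  · intro x hx
    have := key x
    simpa [hx] using this
  · intro x hx
    have h1 := hg x hx
    unfold Harm at *
    have hxs : x ∈ ball (0 : Zd d) s := ball_mono (by omega) hx.1
    simp only [hxs, if_true]
    rw [← h1]
    refine Finset.sum_congr rfl fun v _ => ?_
    rw [if_pos (ball_mono hrs (ball_step x v hx.1))]
  · intro x hx
    split_ifs with h
    · by_cases hxA : x ∈ A
      · exact hA x hxA
      · exact hs x h (fun h' => hx ⟨h', hxA⟩)
    · exact le_rfl

lemma main_est {d : ℕ} (hd : 3 ≤ d) : ∃ c₁ c₂ : ℝ, 2 ≤ c₁ ∧ 0 < c₂ ∧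
    ∀ K L : ℕ, c₁ ≤ K → 1 ≤ L → ∀ A : Set (Zd d), A ⊆ ball (0 : Zd d) L →
      ∀ U : Set (Zd d), U.Finite → ball (0 : Zd d) (K * L) ⊆ U → ∀ y ∈ A, ∀ z, z ∉ U →
      |(avgE (RR (U \ A) {z}) y).toReal - (1 - (avgE (RR Aᶜ A) y).toReal) * rr U {z} 0|
        ≤ c₂ / K * ((1 - (avgE (RR Aᶜ A) y).toReal) * rr U {z} 0) ∧
      (rr U {z} y = 0 → rr U {z} 0 = 0) := by
  have hd0 : 0 < d := by omega
  obtain ⟨C, hC, H⟩ := harnack hd0 (2 * (d + 4) + 1)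
  refine ⟨2 * C + (2 * (d + 4) + 1), 2 * (2 * C + (d + 4)), ?_, by positivity, ?_⟩
  · have : (0 : ℝ) ≤ d := by positivity
    linarith
  intro K L hK hL A hA U hU hKU y hy z hz
  have hd1 : (0 : ℝ) < d := by exact_mod_cast hd0
  have hKpos : (0 : ℝ) < K := by linarith
  have hKn : 2 * (d + 4) + 1 ≤ K := by
    have : ((2 * (d + 4) + 1 : ℕ) : ℝ) ≤ K := by push_cast; linarith
    exact_mod_cast this
  have hcK : (2 * (d + 4) + 1) * L ≤ K * L := Nat.mul_le_mul_right _ hKn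
  have hAL : A ⊆ ball (0 : Zd d) ((2 * (d + 4) + 1) * L) :=
    hA.trans (ball_mono (by nlinarith))
  have hAU : A ⊆ U := hAL.trans ((ball_mono hcK).trans hKU)
  have hzA : ∀ x ∈ U, x ≠ z := fun x hx h => hz (h ▸ hx)
  have d1 : Disjoint U {z} := by rw [Set.disjoint_singleton_right]; exact hz
  have d2 : Disjoint (U \ A) {z} := d1.mono_left Set.sdiff_subset
  have d3 : Disjoint Aᶜ A := disjoint_compl_left
  set h := rr U {z} with hh
  set f := rr (U \ A) {z} with hf
  set p := rr Aᶜ A with hp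
  set ε := C / K with hε
  set ε' := (d + 4 : ℝ) / K with hε'
  have hε0 : 0 ≤ ε := by positivity
  have hε0' : 0 ≤ ε' := by positivity
  have hε1 : ε < 1 := by rw [hε, div_lt_one hKpos]; linarith
  have h0 : 0 ≤ h 0 := rr_nonneg _ _ _
  have hp0 : ∀ x, 0 ≤ p x := rr_nonneg _ _
  have hp1 : ∀ x, p x ≤ 1 := rr_le_one hd0 _ _ d3
  have harn := H K L (by linarith) hL h (rr_nonneg _ _) (fun x hx => rr_harm hd0 _ _ d1 x (hKU hx))
  have harn' : ∀ x ∈ ball (0 : Zd d) ((2 * (d + 4) + 1) * L), (1 - ε) * h 0 ≤ h x ∧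
      h x ≤ (1 + ε) * h 0 := by
    intro x hx
    have := abs_le.mp (harn x hx)
    constructor <;> linarith [this.1, this.2]
  have hpU : ∀ x, x ∉ U → p x ≤ ε' := by
    intro x hx
    have h1 := hit_bound hd L hL A hA (K * L) (by nlinarith) x (fun h => hx (hKU h))
    refine h1.trans (le_of_eq ?_)
    have : (L : ℝ) ≠ 0 := by positivity
    rw [hε']; push_cast; field_simp
  have hpA : ∀ x ∈ A, p x = 1 := fun x hx => rr_one _ _ d3 x hx
  have hfA : ∀ x ∈ A, f x = 0 := fun x hx => rr_zero _ _ x (hzA x (hAU hx)) (fun h => h.2 hx)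
  have hhf : ∀ x, x ∉ U → h x = f x := by
    intro x hx
    by_cases hxz : x = z
    · rw [hh, hf, rr_one _ _ d1 x hxz, rr_one _ _ d2 x hxz]
    · rw [hh, hf, rr_zero _ _ x hxz hx, rr_zero _ _ x hxz (fun h => hx h.1)]
  have harmh : ∀ x ∈ U, Harm h x := fun x hx => rr_harm hd0 _ _ d1 x hx
  have harmf : ∀ x ∈ U \ A, Harm f x := fun x hx => rr_harm hd0 _ _ d2 x hx
  have harmp : ∀ x, x ∉ A → Harm p x := fun x hx => rr_harm hd0 _ _ d3 x hx
  have hUA : (U \ A).Finite := hU.subset Set.sdiff_subset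
  have up : ∀ x, h x - f x ≤ (1 + ε) * h 0 * p x := by
    intro x
    have := max_principle hd0 (U \ A) hUA
      (fun y => 1 * (1 * h y + (-1) * f y + 0) + (-((1 + ε) * h 0)) * p y + 0)
      (fun x hx => ((harmh x hx.1).lin (harmf x hx) 1 (-1) 0).lin (harmp x hx.2) _ _ _) ?_ x
    · linarith
    · intro x hx
      by_cases hxU : x ∈ U
      · have hxA : x ∈ A := by by_contra h; exact hx ⟨hxU, h⟩
        have := (harn' x (hAL hxA)).2
        rw [hfA x hxA, hpA x hxA]
        linarith
      · rw [hhf x hxU]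
        have : 0 ≤ (1 + ε) * h 0 * p x := by have := hp0 x; positivity
        linarith
  have lo : ∀ x, (1 - ε) * h 0 * (p x - ε') ≤ h x - f x := by
    intro x
    have he : 0 ≤ (1 - ε) * h 0 := mul_nonneg (by linarith) h0
    have := max_principle hd0 (U \ A) hUA
      (fun y => (-1) * (1 * h y + (-1) * f y + 0) + ((1 - ε) * h 0) * p y + (-((1 - ε) * h 0 * ε')))
      (fun x hx => ((harmh x hx.1).lin (harmf x hx) 1 (-1) 0).lin (harmp x hx.2) _ _ _) ?_ x
    · linarith
    · intro x hx
      by_cases hxU : x ∈ U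
      · have hxA : x ∈ A := by by_contra h; exact hx ⟨hxU, h⟩
        have := (harn' x (hAL hxA)).1
        have h2 := mul_nonneg he hε0'
        rw [hfA x hxA, hpA x hxA]
        linarith
      · rw [hhf x hxU]
        have := mul_le_mul_of_nonneg_left (hpU x hxU) he
        linarith
  set δ := 2 * (2 * ε + ε') with hδ
  have step2 : ∀ x ∈ ball (0 : Zd d) ((2 * (d + 4) + 1) * L),
      |f x - h 0 * (1 - p x)| ≤ (2 * ε + ε') * h 0 := by
    intro x hx
    have a1 := harn' x hx
    have a2 := up x
    have a3 := lo x
    have b1 : 0 ≤ ε * h 0 := by positivity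
    have b2 : ε * h 0 * p x ≤ ε * h 0 := mul_le_of_le_one_right b1 (hp1 x)
    have b3 : 0 ≤ ε * h 0 * ε' := by positivity
    have b4 : 0 ≤ h 0 * ε' := by positivity
    rw [abs_le]
    constructor <;> nlinarith
  have step3 : ∀ x ∈ ball (0 : Zd d) ((2 * (d + 4) + 1) * L), x ∉ ball (0 : Zd d) (2 * (d + 4) * L) →
      |f x - h 0 * (1 - p x)| ≤ δ * (h 0 * (1 - p x)) := by
    intro x hx hx'
    have h1 := hit_bound hd L hL A hA (2 * (d + 4) * L) (by nlinarith) x hx'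
    have h2 : p x ≤ 1 / 2 := by
      refine h1.trans (le_of_eq ?_)
      have : (L : ℝ) ≠ 0 := by positivity
      push_cast; field_simp
    have h3 := step2 x hx
    have h4 : (2 * ε + ε') * h 0 * (1 / 2) ≤ (2 * ε + ε') * h 0 * (1 - p x) :=
      mul_le_mul_of_nonneg_left (by linarith) (by positivity)
    rw [hδ]
    linarith
  have hfinb : (ball (0 : Zd d) (2 * (d + 4) * L)).Finite :=
    hU.subset ((ball_mono (by nlinarith)).trans hKU)
  have step4 : ∀ s : ℝ, |s| = 1 → ∀ x ∈ ball (0 : Zd d) ((2 * (d + 4) + 1) * L),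
      s * (f x - h 0 * (1 - p x)) ≤ δ * (h 0 * (1 - p x)) := by
    intro s hs x hx
    have := max_local hd0 (2 * (d + 4) * L) ((2 * (d + 4) + 1) * L) (by nlinarith) A hfinb
      (fun x => s * f x + ((s + δ) * h 0) * p x + (-((s + δ) * h 0))) ?_ ?_ ?_ x hx
    · linarith
    · intro x hx
      have hxU : x ∈ U := hKU (ball_mono (by nlinarith) hx.1)
      exact (harmf x ⟨hxU, hx.2⟩).lin (harmp x hx.2) _ _ _
    · intro x hx
      rw [hfA x hx, hpA x hx]
      linarith
    · intro x hx hx'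
      have h1 := step3 x hx hx'
      have h2 : s * (f x - h 0 * (1 - p x)) ≤ |f x - h 0 * (1 - p x)| := by
        refine (le_abs_self _).trans ?_
        rw [abs_mul, hs, one_mul]
      linarith
  have ybd : ∀ v, y + dir v ∈ ball (0 : Zd d) ((2 * (d + 4) + 1) * L) := fun v =>
    ball_mono (by nlinarith) (ball_step y v (hA hy))
  have hQ := avgE_toReal hd0 (U \ A) {z} d2 y
  have hE := avgE_toReal hd0 Aᶜ A d3 y
  set Q := (avgE (RR (U \ A) {z}) y).toReal
  set E := (avgE (RR Aᶜ A) y).toReal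
  have hcard : ∑ _v : Dir d, (1 : ℝ) = 2 * d := by
    rw [Finset.sum_const, Finset.card_univ, card_dir]; simp
  have step5 : ∀ s : ℝ, |s| = 1 → s * (Q - h 0 * (1 - E)) ≤ δ * (h 0 * (1 - E)) := by
    intro s hs
    have h1 : ∑ v, (s * f (y + dir v) + ((s + δ) * h 0) * p (y + dir v) + (-((s + δ) * h 0)) * 1) ≤ 0 := by
      apply Finset.sum_nonpos
      intro v _
      have := step4 s hs _ (ybd v)
      linarith
    rw [Finset.sum_add_distrib, Finset.sum_add_distrib, ← Finset.mul_sum, ← Finset.mul_sum,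
      ← Finset.mul_sum, hcard, ← hQ, ← hE] at h1
    have h2 : 2 * d * (s * (Q - h 0 * (1 - E)) - δ * (h 0 * (1 - E))) ≤ 0 := by linarith
    have h3 : s * (Q - h 0 * (1 - E)) - δ * (h 0 * (1 - E)) ≤ 0 := by
      by_contra hcon
      push Not at hcon
      have : 0 < 2 * d * (s * (Q - h 0 * (1 - E)) - δ * (h 0 * (1 - E))) := by positivity
      linarith
    linarith
  constructor
  · have hδK : 2 * (2 * C + (d + 4)) / K = δ := by
      rw [hδ, hε, hε']; field_simp
    rw [hδK, abs_le]
    have e1 := step5 1 (by simp)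
    have e2 := step5 (-1) (by simp)
    constructor <;> linarith
  · intro hy0
    have := (harn' y (hAL hy)).1
    rw [hy0] at this
    have h1 : 0 < 1 - ε := by linarith
    nlinarith

end DProof
namespace DProof

variable {d : ℕ} {Ω : Type*} [MeasurableSpace Ω]

lemma exp_integral : ∫⁻ t in Set.Ioi (0 : ℝ), ENNReal.ofReal (Real.exp (-t)) = 1 := by
  rw [← ofReal_integral_eq_lintegral_ofReal (integrableOn_exp_neg_Ioi 0)
    (Filter.Eventually.of_forall fun t => (Real.exp_pos _).le), integral_exp_neg_Ioi_zero]
  simp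

lemma expMeasure_apply (s : Set ℝ) (hs : MeasurableSet s) :
    expMeasure s = ∫⁻ t in s ∩ Set.Ioi (0 : ℝ), ENNReal.ofReal (Real.exp (-t)) := by
  unfold expMeasure
  rw [withDensity_apply _ hs]
  have : (fun t : ℝ => ENNReal.ofReal (if 0 < t then Real.exp (-t) else 0))
      = (Set.Ioi (0 : ℝ)).indicator (fun t => ENNReal.ofReal (Real.exp (-t))) := by
    funext t
    by_cases h : 0 < t <;> simp [h]
  rw [this, lintegral_indicator measurableSet_Ioi, Measure.restrict_restrict measurableSet_Ioi,
    Set.inter_comm]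

lemma expMeasure_univ : expMeasure Set.univ = 1 := by
  rw [expMeasure_apply _ MeasurableSet.univ, Set.univ_inter, exp_integral]

lemma law_Y (W : SRW d Ω) (x : Zd d) (n : ℕ) (s : Fin n → Zd d) :
    W.P x {ω | ∀ i : Fin n, W.Y ((i : ℕ) + 1) ω - W.Y (i : ℕ) ω = s i} = ∏ i, stepP d (s i) := by
  have := W.law x n s (fun _ => Set.univ) (fun _ => MeasurableSet.univ)
  simpa [expMeasure_univ] using this

lemma ae_start (W : SRW d Ω) (x : Zd d) : ∀ᵐ ω ∂ W.P x, W.Y 0 ω = x := by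
  have := W.isProb x
  have hm : MeasurableSet {ω | W.Y 0 ω = x} := W.measurable_Y 0 (MeasurableSet.singleton x)
  exact (prob_compl_eq_zero_iff hm).mpr (W.Y_zero x)

lemma meas_Y (W : SRW d Ω) (n : ℕ) (B : Set (Zd d)) : MeasurableSet {ω | W.Y n ω ∈ B} :=
  W.measurable_Y n (MeasurableSet.of_discrete (s := B))

noncomputable def pw (x : Zd d) (m : ℕ) (w : ℕ → Zd d) : ℝ≥0∞ :=
  if w 0 = x then ∏ i ∈ Finset.range m, stepP d (w (i + 1) - w i) else 0

lemma law_path (W : SRW d Ω) (x : Zd d) (m : ℕ) (w : ℕ → Zd d) :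
    W.P x {ω | ∀ j ≤ m, W.Y j ω = w j} = pw x m w := by
  unfold pw
  split_ifs with h
  · rw [← Fin.prod_univ_eq_prod_range (fun i => stepP d (w (i + 1) - w i)),
      ← law_Y W x m (fun i => w (i + 1) - w i)]
    apply measure_congr
    filter_upwards [ae_start W x] with ω hω
    apply propext
    change (∀ j ≤ m, W.Y j ω = w j) ↔ (∀ i : Fin m, W.Y ((i : ℕ) + 1) ω - W.Y (i : ℕ) ω = w (i + 1) - w i)
    constructor
    · intro hj i
      rw [hj _ (by omega), hj _ (by omega)]
    · intro hi j
      induction j with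
      | zero => intro _; rw [hω, h]
      | succ j ih =>
        intro hj
        have h1 := hi ⟨j, by omega⟩
        have h2 := ih (by omega)
        dsimp only at h1
        rw [h2] at h1
        exact sub_left_injective h1
  · refine measure_mono_null (t := {ω | ¬ W.Y 0 ω = x}) ?_ (ae_start W x)
    intro ω hω h'
    exact h ((hω 0 (Nat.zero_le _)).symm.trans h')

noncomputable def VV : ℕ → (ℕ → Set (Zd d)) → Zd d → ℝ≥0∞
  | 0, B => (B 0).indicator (fun _ => 1)
  | n + 1, B => (B 0).indicator (avgE (VV n (fun k => B (k + 1))))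

lemma law_cyl (W : SRW d Ω) (x : Zd d) (n : ℕ) : ∀ (m : ℕ) (w : ℕ → Zd d) (B : ℕ → Set (Zd d)),
    W.P x {ω | (∀ j ≤ m, W.Y j ω = w j) ∧ ∀ k ≤ n, W.Y (m + k) ω ∈ B k}
      = pw x m w * VV n B (w m) := by
  induction n with
  | zero =>
    intro m w B
    by_cases h : w m ∈ B 0
    · have : {ω | (∀ j ≤ m, W.Y j ω = w j) ∧ ∀ k ≤ 0, W.Y (m + k) ω ∈ B k}
          = {ω | ∀ j ≤ m, W.Y j ω = w j} := by
        ext ω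
        constructor
        · exact fun h => h.1
        · intro hω
          refine ⟨hω, fun k hk => ?_⟩
          obtain rfl : k = 0 := by omega
          rw [add_zero, hω m le_rfl]; exact h
      rw [this, law_path]
      simp [VV, h]
    · have : {ω | (∀ j ≤ m, W.Y j ω = w j) ∧ ∀ k ≤ 0, W.Y (m + k) ω ∈ B k} = ∅ := by
        ext ω
        simp only [Set.mem_empty_iff_false, iff_false]
        rintro ⟨h1, h2⟩
        have := h2 0 le_rfl
        rw [add_zero, h1 m le_rfl] at this
        exact h this
      rw [this]
      simp [VV, h]
  | succ n ih =>
    intro m w B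
    by_cases h : w m ∈ B 0
    · have e : {ω | (∀ j ≤ m, W.Y j ω = w j) ∧ ∀ k ≤ n + 1, W.Y (m + k) ω ∈ B k}
          = ⋃ c : Zd d, {ω | (∀ j ≤ m + 1, W.Y j ω = Function.update w (m + 1) c j) ∧
              ∀ k ≤ n, W.Y (m + 1 + k) ω ∈ B (k + 1)} := by
        ext ω
        simp only [Set.mem_iUnion]
        constructor
        · rintro ⟨h1, h2⟩
          refine ⟨W.Y (m + 1) ω, ?_, ?_⟩
          · intro j hj
            by_cases hj' : j = m + 1
            · subst hj'; simp
            · rw [Function.update_of_ne hj']; exact h1 j (by omega)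
          · intro k hk
            have := h2 (k + 1) (by omega)
            rwa [show m + 1 + k = m + (k + 1) by ring]
        · rintro ⟨c, h1, h2⟩
          have h3 : ∀ j ≤ m, W.Y j ω = w j := by
            intro j hj
            have := h1 j (by omega)
            rwa [Function.update_of_ne (by omega)] at this
          refine ⟨h3, ?_⟩
          intro k hk
          cases k with
          | zero => rw [add_zero, h3 m le_rfl]; exact h
          | succ k =>
            have := h2 k (by omega)
            rwa [show m + 1 + k = m + (k + 1) by ring] at this
      rw [e, measure_iUnion]
      · have h1 : VV (n + 1) B (w m) = avgE (VV n (fun k => B (k + 1))) (w m) :=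
          Set.indicator_of_mem h _
        rw [h1]
        unfold avgE
        rw [← ENNReal.tsum_mul_left]
        refine tsum_congr fun c => ?_
        rw [ih, Function.update_self, ← mul_assoc]
        congr 1
        unfold pw
        rw [Function.update_of_ne (by omega)]
        split_ifs with h0
        · rw [Finset.prod_range_succ, Function.update_self, Function.update_of_ne (by omega)]
          congr 1
          refine Finset.prod_congr rfl fun i hi => ?_
          have hi' := Finset.mem_range.mp hi
          rw [Function.update_of_ne (by omega), Function.update_of_ne (by omega)]
        · simp
      · intro c c' hcc
        rw [Function.onFun, Set.disjoint_left]
        rintro ω ⟨h1, _⟩ ⟨h2, _⟩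
        apply hcc
        have a1 := h1 (m + 1) le_rfl
        have a2 := h2 (m + 1) le_rfl
        rw [Function.update_self] at a1 a2
        exact a1.symm.trans a2
      · intro c
        have : {ω | (∀ j ≤ m + 1, W.Y j ω = Function.update w (m + 1) c j) ∧
              ∀ k ≤ n, W.Y (m + 1 + k) ω ∈ B (k + 1)}
            = (⋂ j, ⋂ (_ : j ≤ m + 1), {ω | W.Y j ω ∈ ({Function.update w (m + 1) c j} : Set (Zd d))}) ∩
              ⋂ k, ⋂ (_ : k ≤ n), {ω | W.Y (m + 1 + k) ω ∈ B (k + 1)} := by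
          ext ω
          simp
        rw [this]
        exact (MeasurableSet.iInter fun j => MeasurableSet.iInter fun _ => meas_Y W _ _).inter
          (MeasurableSet.iInter fun j => MeasurableSet.iInter fun _ => meas_Y W _ _)
    · have : {ω | (∀ j ≤ m, W.Y j ω = w j) ∧ ∀ k ≤ n + 1, W.Y (m + k) ω ∈ B k} = ∅ := by
        ext ω
        simp only [Set.mem_empty_iff_false, iff_false]
        rintro ⟨h1, h2⟩
        have := h2 0 (by omega)
        rw [add_zero, h1 m le_rfl] at this
        exact h this
      rw [this]
      simp [VV, h]

lemma law_VV (W : SRW d Ω) (x : Zd d) (n : ℕ) (B : ℕ → Set (Zd d)) :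
    W.P x {ω | ∀ k ≤ n, W.Y k ω ∈ B k} = VV n B x := by
  have h := law_cyl W x n 0 (fun _ => x) B
  have h1 : pw x 0 (fun _ => x) = 1 := by simp [pw]
  rw [h1, one_mul] at h
  rw [← h]
  apply measure_congr
  filter_upwards [ae_start W x] with ω hω
  apply propext
  change (∀ k ≤ n, W.Y k ω ∈ B k) ↔ ((∀ j ≤ 0, W.Y j ω = x) ∧ ∀ k ≤ n, W.Y (0 + k) ω ∈ B k)
  simp [hω]

lemma VV_NN (D T : Set (Zd d)) (n : ℕ) : ∀ B : ℕ → Set (Zd d), (∀ k < n, B k = D) → B n = T →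
    VV n B = NN D T n := by
  induction n with
  | zero => intro B _ h; simp [VV, NN, h]
  | succ n ih =>
    intro B h1 h2
    simp only [VV, NN]
    rw [ih (fun k => B (k + 1)) (fun k hk => h1 (k + 1) (by omega)) h2, h1 0 (by omega)]

lemma P_NN (W : SRW d Ω) (D T : Set (Zd d)) (n : ℕ) (x : Zd d) :
    W.P x {ω | W.Y n ω ∈ T ∧ ∀ k < n, W.Y k ω ∈ D} = NN D T n x := by
  rw [← VV_NN D T n (fun k => if k < n then D else T) (fun k hk => if_pos hk) (by simp), ← law_VV W]
  congr 1
  ext ω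
  constructor
  · rintro ⟨h1, h2⟩ k hk
    by_cases h : k < n
    · simp only [h, if_true]; exact h2 k h
    · obtain rfl : k = n := by omega
      simpa using h1
  · intro h
    refine ⟨by simpa using h n le_rfl, fun k hk => ?_⟩
    have := h k hk.le
    simpa [hk] using this

lemma P_avgNN (W : SRW d Ω) (D T : Set (Zd d)) (n : ℕ) (x : Zd d) :
    W.P x {ω | W.Y (n + 1) ω ∈ T ∧ ∀ k < n, W.Y (k + 1) ω ∈ D} = avgE (NN D T n) x := by
  have h0 : VV (n + 1) (fun k => if k = 0 then Set.univ else if k < n + 1 then D else T) x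
      = avgE (NN D T n) x := by
    simp only [VV, if_true]
    rw [Set.indicator_univ, VV_NN D T n]
    · intro k hk
      simp [hk]
    · simp
  rw [← h0, ← law_VV W]
  congr 1
  ext ω
  constructor
  · rintro ⟨h1, h2⟩ k hk
    cases k with
    | zero => simp
    | succ k =>
      by_cases h : k < n
      · simpa [h] using h2 k h
      · obtain rfl : k = n := by omega
        simpa using h1
  · intro h
    refine ⟨by simpa using h (n + 1) le_rfl, fun k hk => ?_⟩
    have := h (k + 1) (by omega)
    simpa [hk] using this

lemma P_RR (W : SRW d Ω) (D T : Set (Zd d)) (hDT : Disjoint D T) (x : Zd d) :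
    W.P x {ω | ∃ n, W.Y n ω ∈ T ∧ ∀ k < n, W.Y k ω ∈ D} = RR D T x := by
  have e : {ω | ∃ n, W.Y n ω ∈ T ∧ ∀ k < n, W.Y k ω ∈ D}
      = ⋃ n, {ω | W.Y n ω ∈ T ∧ ∀ k < n, W.Y k ω ∈ D} := by ext ω; simp
  rw [e, measure_iUnion]
  · unfold RR
    exact tsum_congr fun n => P_NN W D T n x
  · intro n n' hn
    rw [Function.onFun, Set.disjoint_left]
    rintro ω ⟨h1, h2⟩ ⟨h3, h4⟩
    rcases lt_or_gt_of_ne hn with h | h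
    · exact Set.disjoint_left.mp hDT (h4 n h) h1
    · exact Set.disjoint_left.mp hDT (h2 n' h) h3
  · intro n
    have : {ω | W.Y n ω ∈ T ∧ ∀ k < n, W.Y k ω ∈ D}
        = {ω | W.Y n ω ∈ T} ∩ ⋂ k, ⋂ (_ : k < n), {ω | W.Y k ω ∈ D} := by ext ω; simp
    rw [this]
    exact (meas_Y W _ _).inter (MeasurableSet.iInter fun j => MeasurableSet.iInter fun _ => meas_Y W _ _)

lemma meas_first (W : SRW d Ω) (D T : Set (Zd d)) (n : ℕ) :
    MeasurableSet {ω | W.Y (n + 1) ω ∈ T ∧ ∀ k < n, W.Y (k + 1) ω ∈ D} := by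
  have : {ω | W.Y (n + 1) ω ∈ T ∧ ∀ k < n, W.Y (k + 1) ω ∈ D}
      = {ω | W.Y (n + 1) ω ∈ T} ∩ ⋂ k, ⋂ (_ : k < n), {ω | W.Y (k + 1) ω ∈ D} := by ext ω; simp
  rw [this]
  exact (meas_Y W _ _).inter (MeasurableSet.iInter fun j => MeasurableSet.iInter fun _ => meas_Y W _ _)

lemma P_avgRR (W : SRW d Ω) (D T : Set (Zd d)) (hDT : Disjoint D T) (x : Zd d) :
    W.P x {ω | ∃ n, W.Y (n + 1) ω ∈ T ∧ ∀ k < n, W.Y (k + 1) ω ∈ D} = avgE (RR D T) x := by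
  have e : {ω | ∃ n, W.Y (n + 1) ω ∈ T ∧ ∀ k < n, W.Y (k + 1) ω ∈ D}
      = ⋃ n, {ω | W.Y (n + 1) ω ∈ T ∧ ∀ k < n, W.Y (k + 1) ω ∈ D} := by ext ω; simp
  have e' : RR D T = fun y => ∑' n, NN D T n y := rfl
  rw [e, measure_iUnion, e', avgE_tsum]
  · exact tsum_congr fun n => P_avgNN W D T n x
  · intro n n' hn
    rw [Function.onFun, Set.disjoint_left]
    rintro ω ⟨h1, h2⟩ ⟨h3, h4⟩
    rcases lt_or_gt_of_ne hn with h | h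
    · exact Set.disjoint_left.mp hDT (h4 n h) h1
    · exact Set.disjoint_left.mp hDT (h2 n' h) h3
  · exact meas_first W D T

/-- killing outside `U` is the same as killing on the boundary of `U` -/
lemma NN_bdry (A U : Set (Zd d)) (y : Zd d) (hy : y ∈ U) (n : ℕ) (x : Zd d) :
    NN (A ∪ bdry U)ᶜ {y} n x = NN (U \ A) {y} n x := by
  have zero : ∀ n x, x ∉ U → NN (A ∪ bdry U)ᶜ {y} n x = 0 := by
    intro n
    induction n with
    | zero =>
      intro x hx
      exact Set.indicator_of_notMem (fun h => hx (by rw [Set.mem_singleton_iff.mp h]; exact hy)) _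
    | succ n ih =>
      intro x hx
      simp only [NN]
      by_cases h : x ∈ (A ∪ bdry U)ᶜ
      · rw [Set.indicator_of_mem h, avgE_eq]
        have : ∀ v, NN (A ∪ bdry U)ᶜ {y} n (x + dir v) = 0 := by
          intro v
          apply ih
          intro hv
          apply h
          right
          refine ⟨hx, x + dir v, hv, ?_⟩
          unfold adjacent
          simp only [Pi.add_apply, add_sub_cancel_left]
          exact l1_dir v
        rw [Finset.sum_congr rfl (fun v _ => this v), Finset.sum_const_zero, mul_zero]
      · exact Set.indicator_of_notMem h _
  induction n generalizing x with
  | zero => rfl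
  | succ n ih =>
    have hfun : NN (A ∪ bdry U)ᶜ {y} n = NN (U \ A) {y} n := funext ih
    by_cases hx : x ∈ U
    · simp only [NN]
      rw [hfun]
      by_cases hxA : x ∈ A
      · have h1 : x ∉ (A ∪ bdry U)ᶜ := fun h => h (Or.inl hxA)
        have h2 : x ∉ U \ A := fun h => h.2 hxA
        rw [Set.indicator_of_notMem h1, Set.indicator_of_notMem h2]
      · have h1 : x ∈ (A ∪ bdry U)ᶜ := by
          rintro (h | h)
          · exact hxA h
          · exact h.1 hx
        have h2 : x ∈ U \ A := ⟨hx, hxA⟩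
        rw [Set.indicator_of_mem h1, Set.indicator_of_mem h2]
    · rw [zero _ _ hx]
      simp only [NN]
      rw [Set.indicator_of_notMem (fun h => hx h.1)]

end DProof
namespace DProof

variable {d : ℕ} {Ω : Type*} [MeasurableSpace Ω]

/-! ### Holding times -/

lemma law_zeta (W : SRW d Ω) (x : Zd d) (n : ℕ) (I : Fin n → Set ℝ) (hI : ∀ i, MeasurableSet (I i)) :
    W.P x {ω | ∀ i : Fin n, W.ζ i ω ∈ I i} = ∏ i, expMeasure (I i) := by
  have gen : ∀ I : Fin n → Set ℝ, (∀ i, MeasurableSet (I i)) →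
      W.P x {ω | ∀ i : Fin n, W.ζ i ω ∈ I i}
        = (∑' s : Fin n → Zd d, ∏ i, stepP d (s i)) * ∏ i, expMeasure (I i) := by
    intro I hI
    have e : {ω | ∀ i : Fin n, W.ζ i ω ∈ I i} = ⋃ s : Fin n → Zd d,
        {ω | (∀ i : Fin n, W.Y ((i : ℕ) + 1) ω - W.Y (i : ℕ) ω = s i) ∧
             (∀ i : Fin n, W.ζ (i : ℕ) ω ∈ I i)} := by
      ext ω
      simp only [Set.mem_iUnion]
      constructor
      · intro h
        exact ⟨fun i => W.Y ((i : ℕ) + 1) ω - W.Y (i : ℕ) ω, fun i => rfl, h⟩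
      · rintro ⟨s, _, h⟩
        exact h
    rw [e, measure_iUnion, ← ENNReal.tsum_mul_right]
    · exact tsum_congr fun s => W.law x n s I hI
    · intro s s' hs
      rw [Function.onFun, Set.disjoint_left]
      rintro ω ⟨h1, _⟩ ⟨h2, _⟩
      exact hs (funext fun i => (h1 i).symm.trans (h2 i))
    · intro s
      have : {ω | (∀ i : Fin n, W.Y ((i : ℕ) + 1) ω - W.Y (i : ℕ) ω = s i) ∧
             (∀ i : Fin n, W.ζ (i : ℕ) ω ∈ I i)}
          = (⋂ i : Fin n, (fun ω => W.Y ((i : ℕ) + 1) ω - W.Y (i : ℕ) ω) ⁻¹' {s i}) ∩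
            ⋂ i : Fin n, W.ζ (i : ℕ) ⁻¹' I i := by
        ext ω; simp
      rw [this]
      exact (MeasurableSet.iInter fun i => ((W.measurable_Y _).sub (W.measurable_Y _))
        (MeasurableSet.singleton _)).inter
        (MeasurableSet.iInter fun i => W.measurable_ζ _ (hI i))
  have h1 := gen (fun _ => Set.univ) (fun _ => MeasurableSet.univ)
  have := W.isProb x
  simp only [Set.mem_univ, implies_true, Set.ofPred_true, measure_univ, expMeasure_univ,
    Finset.prod_const_one, mul_one] at h1
  rw [gen I hI, ← h1, one_mul]

instance : IsProbabilityMeasure expMeasure := ⟨expMeasure_univ⟩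

lemma expMeasure_neg : expMeasure (Set.Iic 0) = 0 := by
  rw [expMeasure_apply _ measurableSet_Iic]
  have : Set.Iic (0 : ℝ) ∩ Set.Ioi 0 = ∅ := by
    ext t; simp
  rw [this]
  simp

lemma expMeasure_lt : expMeasure (Set.Iic 1) < 1 := by
  have h : expMeasure (Set.Ioi 1) ≠ 0 := by
    rw [expMeasure_apply _ measurableSet_Ioi]
    have : Set.Ioi (1 : ℝ) ∩ Set.Ioi 0 = Set.Ioi 1 := by
      ext t
      simp only [Set.mem_inter_iff, Set.mem_Ioi]
      constructor
      · exact fun h => h.1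
      · exact fun h => ⟨h, by linarith⟩
    rw [this, ← ofReal_integral_eq_lintegral_ofReal (integrableOn_exp_neg_Ioi 1)
      (Filter.Eventually.of_forall fun t => (Real.exp_pos _).le), integral_exp_neg_Ioi]
    simp [Real.exp_pos]
  rw [← Set.compl_Ioi, prob_compl_eq_one_sub measurableSet_Ioi]
  exact ENNReal.sub_lt_self (by simp) (by simp) h

lemma ae_pos (W : SRW d Ω) (x : Zd d) : ∀ᵐ ω ∂ W.P x, ∀ n, 0 < W.ζ n ω := by
  rw [ae_all_iff]
  intro n
  have h := law_zeta W x (n + 1) (fun i => if (i : ℕ) = n then Set.Iic 0 else Set.univ)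
    (fun i => by split_ifs; exacts [measurableSet_Iic, MeasurableSet.univ])
  rw [Finset.prod_eq_zero (Finset.mem_univ (Fin.last n)) (by simp [expMeasure_neg])] at h
  refine measure_mono_null ?_ h
  intro ω hω i
  by_cases hi : (i : ℕ) = n
  · have : W.ζ n ω ≤ 0 := not_lt.mp hω
    simp only [hi, if_true]
    exact this
  · simp [hi]

lemma ae_large (W : SRW d Ω) (x : Zd d) : ∀ᵐ ω ∂ W.P x, ∀ m, ∃ i, m ≤ i ∧ 1 < W.ζ i ω := by
  rw [ae_all_iff]
  intro m
  have hle : ∀ n : ℕ, W.P x {ω | ¬ ∃ i, m ≤ i ∧ 1 < W.ζ i ω} ≤ expMeasure (Set.Iic 1) ^ n := by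
    intro n
    have h := law_zeta W x (m + n) (fun i => if m ≤ (i : ℕ) then Set.Iic 1 else Set.univ)
      (fun i => by split_ifs; exacts [measurableSet_Iic, MeasurableSet.univ])
    have h2 : ∏ i : Fin (m + n), expMeasure (if m ≤ (i : ℕ) then Set.Iic 1 else Set.univ)
        = expMeasure (Set.Iic 1) ^ n := by
      rw [Fin.prod_univ_add]
      have a1 : ∀ i : Fin m, expMeasure (if m ≤ ((Fin.castAdd n i : Fin (m + n)) : ℕ) then Set.Iic 1
          else Set.univ) = 1 := by
        intro i
        rw [if_neg (by simp), expMeasure_univ]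
      have a2 : ∀ i : Fin n, expMeasure (if m ≤ ((Fin.natAdd m i : Fin (m + n)) : ℕ) then Set.Iic 1
          else Set.univ) = expMeasure (Set.Iic 1) := by
        intro i
        rw [if_pos (by simp)]
      rw [Finset.prod_congr rfl (fun i _ => a1 i), Finset.prod_congr rfl (fun i _ => a2 i)]
      simp
    rw [← h2, ← h]
    apply measure_mono
    intro ω hω i
    by_cases hi : m ≤ (i : ℕ)
    · simp only [hi, if_true]
      by_contra hc
      exact hω ⟨i, hi, not_le.mp hc⟩
    · simp [hi]
  have ht := ENNReal.tendsto_pow_atTop_nhds_zero_of_lt_one expMeasure_lt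
  have := ge_of_tendsto' ht hle
  exact le_antisymm this zero_le

def Good (W : SRW d Ω) (ω : Ω) : Prop := (∀ n, 0 < W.ζ n ω) ∧ ∀ R : ℝ, ∃ n, R < W.S n ω

lemma S_succ (W : SRW d Ω) (n : ℕ) (ω : Ω) : W.S (n + 1) ω = W.S n ω + W.ζ n ω := by
  unfold SRW.S; rw [Finset.sum_range_succ]

lemma S_zero (W : SRW d Ω) (ω : Ω) : W.S 0 ω = 0 := by simp [SRW.S]

lemma S_one (W : SRW d Ω) (ω : Ω) : W.S 1 ω = W.ζ 0 ω := by simp [SRW.S]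

lemma S_mono (W : SRW d Ω) (ω : Ω) (h : ∀ n, 0 < W.ζ n ω) : StrictMono (fun n => W.S n ω) :=
  strictMono_nat_of_lt_succ fun n => by rw [S_succ]; linarith [h n]

lemma ae_good (W : SRW d Ω) (x : Zd d) : ∀ᵐ ω ∂ W.P x, Good W ω := by
  filter_upwards [ae_pos W x, ae_large W x] with ω h1 h2
  refine ⟨h1, ?_⟩
  have hm := S_mono W ω h1
  have key : ∀ N : ℕ, ∃ n, (N : ℝ) ≤ W.S n ω := by
    intro N
    induction N with
    | zero => exact ⟨0, by simp [S_zero]⟩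
    | succ N ih =>
      obtain ⟨n, hn⟩ := ih
      obtain ⟨i, hi, hz⟩ := h2 n
      refine ⟨i + 1, ?_⟩
      have := hm.monotone hi
      rw [S_succ]
      push_cast
      linarith
  intro R
  obtain ⟨N, hN⟩ := exists_nat_gt R
  obtain ⟨n, hn⟩ := key N
  exact ⟨n, hN.trans_le hn⟩

section det

variable {W : SRW d Ω} {ω : Ω}

lemma S_nonneg (h : Good W ω) (n : ℕ) : 0 ≤ W.S n ω := by
  rw [← S_zero W ω]
  exact (S_mono W ω h.1).monotone (Nat.zero_le n)

lemma jump_eq (h : Good W ω) (t : ℝ) (k : ℕ) (h1 : W.S k ω ≤ t) (h2 : t < W.S (k + 1) ω) :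
    W.jumpIdx t ω = k := by
  unfold SRW.jumpIdx
  have hm := S_mono W ω h.1
  have : {j : ℕ | W.S j ω ≤ t} = Set.Iic k := by
    ext j
    constructor
    · intro hj
      have hj' : W.S j ω ≤ t := hj
      have : W.S j ω < W.S (k + 1) ω := hj'.trans_lt h2
      have := hm.lt_iff_lt.mp this
      exact Nat.lt_succ_iff.mp this
    · intro hj
      exact (hm.monotone hj).trans h1
  rw [this, csSup_Iic]

lemma X_S (h : Good W ω) (k : ℕ) : W.X (W.S k ω) ω = W.Y k ω := by
  unfold SRW.X
  rw [jump_eq h _ k le_rfl (S_mono W ω h.1 (Nat.lt_succ_self k))]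

lemma X_exists (h : Good W ω) (t : ℝ) (ht : 0 ≤ t) :
    ∃ k, W.S k ω ≤ t ∧ t < W.S (k + 1) ω ∧ W.X t ω = W.Y k ω := by
  have hex := h.2 t
  have hspec := Nat.find_spec hex
  obtain ⟨k, hk⟩ : ∃ k, Nat.find hex = k + 1 := by
    apply Nat.exists_eq_succ_of_ne_zero
    intro h0
    rw [h0, S_zero] at hspec
    linarith
  rw [hk] at hspec
  have h1 : W.S k ω ≤ t := not_lt.mp (Nat.find_min hex (by omega))
  refine ⟨k, h1, hspec, ?_⟩
  unfold SRW.X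
  rw [jump_eq h t k h1 hspec]

lemma hit_le (h : Good W ω) (A : Set (Zd d)) (m k : ℕ) (hmk : m ≤ k) (hk : W.Y k ω ∈ A) :
    W.hitFrom A (ENNReal.ofReal (W.S m ω)) ω ≤ ENNReal.ofReal (W.S k ω) := by
  apply sInf_le
  refine ⟨(W.S k ω).toNNReal, rfl, ?_, ?_⟩
  · exact ENNReal.ofReal_le_ofReal ((S_mono W ω h.1).monotone hmk)
  · rw [Real.coe_toNNReal _ (S_nonneg h k), X_S h]
    exact hk

lemma exists_of_mem (h : Good W ω) (A : Set (Zd d)) (m : ℕ) (s : ℝ≥0)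
    (h1 : ENNReal.ofReal (W.S m ω) ≤ (s : ℝ≥0∞)) (h2 : W.X (s : ℝ) ω ∈ A) :
    ∃ k, m ≤ k ∧ W.Y k ω ∈ A ∧ W.S k ω ≤ s := by
  obtain ⟨k, a1, a2, a3⟩ := X_exists h s s.2
  refine ⟨k, ?_, a3 ▸ h2, a1⟩
  have h3 : W.S m ω ≤ s := by
    rw [← ENNReal.ofReal_coe_nnreal] at h1
    exact (ENNReal.ofReal_le_ofReal_iff s.2).mp h1
  exact Nat.lt_succ_iff.mp ((S_mono W ω h.1).lt_iff_lt.mp (h3.trans_lt a2))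

lemma le_hit (h : Good W ω) (A : Set (Zd d)) (m N : ℕ) (hN : ∀ k, m ≤ k → k < N → W.Y k ω ∉ A) :
    ENNReal.ofReal (W.S N ω) ≤ W.hitFrom A (ENNReal.ofReal (W.S m ω)) ω := by
  apply le_sInf
  rintro u ⟨s, rfl, h1, h2⟩
  obtain ⟨k, b1, b2, b3⟩ := exists_of_mem h A m s h1 h2
  have hNk : N ≤ k := by
    by_contra hc
    exact hN k b1 (not_le.mp hc) b2
  have := ((S_mono W ω h.1).monotone hNk).trans b3
  rw [← ENNReal.ofReal_coe_nnreal]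
  exact ENNReal.ofReal_le_ofReal this

lemma hit_eq (h : Good W ω) (A : Set (Zd d)) (m N : ℕ) (hmN : m ≤ N) (hY : W.Y N ω ∈ A)
    (hN : ∀ k, m ≤ k → k < N → W.Y k ω ∉ A) :
    W.hitFrom A (ENNReal.ofReal (W.S m ω)) ω = ENNReal.ofReal (W.S N ω) :=
  le_antisymm (hit_le h A m N hmN hY) (le_hit h A m N hN)

lemma hit_top (h : Good W ω) (A : Set (Zd d)) (m : ℕ) :
    W.hitFrom A (ENNReal.ofReal (W.S m ω)) ω = ⊤ ↔ ∀ k, m ≤ k → W.Y k ω ∉ A := by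
  constructor
  · intro ht k hk hY
    have := hit_le h A m k hk hY
    rw [ht] at this
    simp at this
  · intro hA
    apply sInf_eq_top.mpr
    rintro u ⟨s, rfl, h1, h2⟩
    obtain ⟨k, b1, b2, _⟩ := exists_of_mem h A m s h1 h2
    exact absurd b2 (hA k b1)

lemma hit_def' (A : Set (Zd d)) : W.hit A ω = W.hitFrom A (ENNReal.ofReal (W.S 0 ω)) ω := by
  rw [S_zero, ENNReal.ofReal_zero]; rfl

lemma hitTilde_def' (A : Set (Zd d)) :
    W.hitTilde A ω = W.hitFrom A (ENNReal.ofReal (W.S 1 ω)) ω := by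
  rw [S_one]; rfl

/-- first visit -/
lemma first_visit (Y : ℕ → Zd d) (A : Set (Zd d)) (h : ∃ k, Y k ∈ A) :
    ∃ N, Y N ∈ A ∧ ∀ k < N, Y k ∉ A :=
  ⟨Nat.find h, Nat.find_spec h, fun _ hk => Nat.find_min h hk⟩

lemma Xat_eq (h : Good W ω) (τ : Ω → ℝ≥0∞) (N : ℕ) (hτ : τ ω = ENNReal.ofReal (W.S N ω)) :
    W.Xat τ ω = W.Y N ω := by
  unfold SRW.Xat
  rw [hτ, ENNReal.toReal_ofReal (S_nonneg h N), X_S h]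

lemma Xat_top (h : Good W ω) (τ : Ω → ℝ≥0∞) (hτ : τ ω = ⊤) : W.Xat τ ω = W.Y 0 ω := by
  unfold SRW.Xat
  rw [hτ, ENNReal.toReal_top, ← S_zero W ω, X_S h]

lemma event1 (h : Good W ω) (U : Set (Zd d)) (z : Zd d) (hz : z ∉ U) (h0 : W.Y 0 ω ∈ U) :
    W.Xat (W.exit U) ω = z ↔ ∃ n, W.Y n ω ∈ ({z} : Set (Zd d)) ∧ ∀ k < n, W.Y k ω ∈ U := by
  by_cases hex : ∃ k, W.Y k ω ∈ Uᶜ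
  · obtain ⟨N, hN1, hN2⟩ := first_visit (fun k => W.Y k ω) _ hex
    have he : W.exit U ω = ENNReal.ofReal (W.S N ω) := by
      unfold SRW.exit
      rw [hit_def']
      exact hit_eq h _ 0 N (Nat.zero_le _) hN1 (fun k _ hk => hN2 k hk)
    rw [Xat_eq h _ N he]
    constructor
    · intro hY
      exact ⟨N, hY, fun k hk => not_not.mp (hN2 k hk)⟩
    · rintro ⟨n, h1, h2⟩
      have h1' : W.Y n ω = z := h1
      have : n = N := by
        rcases lt_trichotomy n N with hl | hl | hl
        · exact absurd (h1' ▸ hz) (hN2 n hl)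
        · exact hl
        · exact absurd (h2 N hl) hN1
      rw [← this]; exact h1'
  · push Not at hex
    have he : W.exit U ω = ⊤ := by
      unfold SRW.exit
      rw [hit_def', hit_top h]
      exact fun k _ => hex k
    rw [Xat_top h _ he]
    constructor
    · intro h'
      exact absurd (h' ▸ h0) hz
    · rintro ⟨n, h1, _⟩
      have h1' : W.Y n ω = z := h1
      exact absurd (show W.Y n ω ∈ Uᶜ from h1' ▸ hz) (hex n)

lemma event2 (h : Good W ω) (B C : Set (Zd d)) (a : Zd d) (haB : a ∈ B) (haC : a ∉ C)
    (h0 : W.Y 0 ω ∉ B) :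
    (W.hit B ω < W.hitTilde C ω ∧ W.Xat (W.hit B) ω = a) ↔
      ∃ n, W.Y (n + 1) ω ∈ ({a} : Set (Zd d)) ∧ ∀ k < n, W.Y (k + 1) ω ∈ (B ∪ C)ᶜ := by
  have hm := S_mono W ω h.1
  constructor
  · rintro ⟨h1, h2⟩
    have hex : ∃ k, W.Y k ω ∈ B := by
      by_contra hc
      push Not at hc
      have : W.hit B ω = ⊤ := by rw [hit_def', hit_top h]; exact fun k _ => hc k
      rw [this] at h1
      exact not_top_lt h1
    obtain ⟨N, hN1, hN2⟩ := first_visit (fun k => W.Y k ω) _ hex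
    have he : W.hit B ω = ENNReal.ofReal (W.S N ω) := by
      rw [hit_def']
      exact hit_eq h _ 0 N (Nat.zero_le _) hN1 (fun k _ hk => hN2 k hk)
    rw [Xat_eq h _ N he] at h2
    obtain ⟨n, rfl⟩ : ∃ n, N = n + 1 := by
      apply Nat.exists_eq_succ_of_ne_zero
      rintro rfl
      exact h0 hN1
    refine ⟨n, h2, ?_⟩
    rintro k hk (hB | hC)
    · exact hN2 (k + 1) (by omega) hB
    · have h3 := hit_le h C 1 (k + 1) (by omega) hC
      rw [← hitTilde_def'] at h3
      rw [he] at h1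
      have h4 : W.S (k + 1) ω ≤ W.S (n + 1) ω := hm.monotone (by omega)
      exact absurd (h1.trans_le h3) (not_lt.mpr (ENNReal.ofReal_le_ofReal h4))
  · rintro ⟨n, h1, h2⟩
    have h1' : W.Y (n + 1) ω = a := h1
    have he : W.hit B ω = ENNReal.ofReal (W.S (n + 1) ω) := by
      rw [hit_def']
      refine hit_eq h _ 0 (n + 1) (Nat.zero_le _) (h1' ▸ haB) ?_
      intro k _ hk
      cases k with
      | zero => exact h0
      | succ k => exact fun hB => h2 k (by omega) (Or.inl hB)
    refine ⟨?_, ?_⟩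
    · rw [he, hitTilde_def']
      have h3 := le_hit h C 1 (n + 1 + 1) ?_
      · refine lt_of_lt_of_le ?_ h3
        have h4 : W.S (n + 1) ω < W.S (n + 1 + 1) ω := hm (Nat.lt_succ_self _)
        exact (ENNReal.ofReal_lt_ofReal_iff ((S_nonneg h _).trans_lt h4)).mpr h4
      · intro k hk1 hk2
        obtain ⟨k, rfl⟩ : ∃ j, k = j + 1 := ⟨k - 1, by omega⟩
        by_cases hkn : k = n
        · subst hkn; rw [h1']; exact haC
        · exact fun hC => h2 k (by omega) (Or.inr hC)
    · rw [Xat_eq h _ (n + 1) he]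
      exact h1'

lemma event3 (h : Good W ω) (A : Set (Zd d)) :
    W.hitTilde A ω = ⊤ ↔ ¬ ∃ n, W.Y (n + 1) ω ∈ A ∧ ∀ k < n, W.Y (k + 1) ω ∈ Aᶜ := by
  rw [hitTilde_def', hit_top h]
  constructor
  · rintro h1 ⟨n, h2, _⟩
    exact h1 (n + 1) (by omega) h2
  · intro h1 k hk hY
    obtain ⟨k, rfl⟩ : ∃ j, k = j + 1 := ⟨k - 1, by omega⟩
    apply h1
    obtain ⟨N, hN1, hN2⟩ := first_visit (fun k => W.Y (k + 1) ω) A ⟨k, hY⟩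
    exact ⟨N, hN1, hN2⟩

end det

lemma prob1 (W : SRW d Ω) (U : Set (Zd d)) (x z : Zd d) (hx : x ∈ U) (hz : z ∉ U) :
    (W.P x {ω | W.Xat (W.exit U) ω = z}).toReal = rr U {z} x := by
  unfold rr
  rw [← P_RR W U {z} (by rw [Set.disjoint_singleton_right]; exact hz) x]
  congr 1
  apply measure_congr
  filter_upwards [ae_good W x, ae_start W x] with ω h1 h2
  exact propext (event1 h1 U z hz (by rw [h2]; exact hx))

lemma prob2 (W : SRW d Ω) (B C : Set (Zd d)) (x a : Zd d) (hx : x ∉ B) (haB : a ∈ B) (haC : a ∉ C) :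
    W.P x {ω | W.hit B ω < W.hitTilde C ω ∧ W.Xat (W.hit B) ω = a}
      = avgE (RR (B ∪ C)ᶜ {a}) x := by
  rw [← P_avgRR W (B ∪ C)ᶜ {a} (by rw [Set.disjoint_singleton_right]; exact fun h => h (Or.inl haB)) x]
  apply measure_congr
  filter_upwards [ae_good W x, ae_start W x] with ω h1 h2
  exact propext (event2 h1 B C a haB haC (by rw [h2]; exact hx))

lemma prob3 (W : SRW d Ω) (A : Set (Zd d)) (y : Zd d) (hy : y ∈ A) :
    W.eqm A y = 1 - (avgE (RR Aᶜ A) y).toReal := by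
  unfold SRW.eqm
  rw [if_pos hy]
  have hP := W.isProb y
  have hm : MeasurableSet {ω | ∃ n, W.Y (n + 1) ω ∈ A ∧ ∀ k < n, W.Y (k + 1) ω ∈ Aᶜ} := by
    have : {ω | ∃ n, W.Y (n + 1) ω ∈ A ∧ ∀ k < n, W.Y (k + 1) ω ∈ Aᶜ}
      = ⋃ n, {ω | W.Y (n + 1) ω ∈ A ∧ ∀ k < n, W.Y (k + 1) ω ∈ Aᶜ} := by ext ω; simp
    rw [this]
    exact MeasurableSet.iUnion (meas_first W _ _)
  have e : W.P y {ω | W.hitTilde A ω = ⊤}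
      = W.P y {ω | ∃ n, W.Y (n + 1) ω ∈ A ∧ ∀ k < n, W.Y (k + 1) ω ∈ Aᶜ}ᶜ := by
    apply measure_congr
    filter_upwards [ae_good W y] with ω h1
    exact propext (event3 h1 A)
  rw [e, prob_compl_eq_one_sub hm, P_avgRR W Aᶜ A disjoint_compl_left,
    ENNReal.toReal_sub_of_le _ (by simp)]
  · simp
  · rw [← P_avgRR W Aᶜ A disjoint_compl_left]
    exact prob_le_one

end DProof
/-- Lemma 1.3: for `K ≥ c₁`, `A ⊆ B(0,L)`, finite `U ⊇ B(0,KL)`, `y ∈ A`,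
`z ∈ ∂U`, one has `P_z[H_A < H̃_{∂U}, X_{H_A} = y] = P_y[T_U < H̃_A, X_{T_U} = z]
= e_A(y)·P_0[X_{T_U} = z]·(1+ψ)` with `|ψ| ≤ c₂/K`, and `ψ = 0` when
`e_A(y)·P_y[X_{T_U} = z] = 0`. -/
theorem statement3 {d : ℕ} (hd : 3 ≤ d) {Ω : Type*} [MeasurableSpace Ω] (W : SRW d Ω) :
    ∃ c₁ c₂ : ℝ, 2 ≤ c₁ ∧ 0 < c₂ ∧
      ∀ (K L : ℕ), c₁ ≤ (K : ℝ) → 1 ≤ L →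
        ∀ A : Set (Zd d), A ⊆ ball (0 : Zd d) L →
          ∀ U : Set (Zd d), U.Finite → ball (0 : Zd d) (K * L) ⊆ U →
            ∀ y ∈ A, ∀ z ∈ bdry U,
              ∃ ψ : ℝ, |ψ| ≤ c₂ / K ∧
                (W.P z {ω | W.hit A ω < W.hitTilde (bdry U) ω ∧ W.Xat (W.hit A) ω = y}).toReal
                  = W.eqm A y * (W.P 0 {ω | W.Xat (W.exit U) ω = z}).toReal * (1 + ψ) ∧
                (W.P y {ω | W.exit U ω < W.hitTilde A ω ∧ W.Xat (W.exit U) ω = z}).toReal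
                  = W.eqm A y * (W.P 0 {ω | W.Xat (W.exit U) ω = z}).toReal * (1 + ψ) ∧
                (W.eqm A y * (W.P y {ω | W.Xat (W.exit U) ω = z}).toReal = 0 → ψ = 0) := by
  obtain ⟨c₁, c₂, h1, h2, H⟩ := DProof.main_est hd
  refine ⟨c₁, c₂, h1, h2, ?_⟩
  intro K L hK hL A hA U hU hKU y hy z hz
  have hKpos : (0 : ℝ) < K := by linarith
  have hzU : z ∉ U := hz.1
  have hKL : L ≤ K * L := by
    have : 1 ≤ K := by exact_mod_cast hKpos
    nlinarith
  have hAU : A ⊆ U := hA.trans ((DProof.ball_mono hKL).trans hKU)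
  have h0U : (0 : Zd d) ∈ U := hKU (by rw [DProof.mem_ball_zero]; intro i; simp)
  have hyU : y ∈ U := hAU hy
  have hzA : z ∉ A := fun h => hzU (hAU h)
  obtain ⟨hest, hzero⟩ := H K L hK hL A hA U hU hKU y hy z hzU
  have p0 := DProof.prob1 W U 0 z h0U hzU
  have py := DProof.prob1 W U y z hyU hzU
  have pe := DProof.prob3 W A y hy
  have q1 : W.P y {ω | W.exit U ω < W.hitTilde A ω ∧ W.Xat (W.exit U) ω = z}
      = DProof.avgE (DProof.RR (U \ A) {z}) y := by
    have e : U \ A = (Uᶜ ∪ A)ᶜ := by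
      ext x; simp
    rw [e]
    exact DProof.prob2 W Uᶜ A y z (fun h => h hyU) hzU hzA
  have q2 : W.P z {ω | W.hit A ω < W.hitTilde (bdry U) ω ∧ W.Xat (W.hit A) ω = y}
      = DProof.avgE (DProof.RR (U \ A) {z}) y := by
    rw [DProof.prob2 W A (bdry U) z y hzA hy (fun h => h.1 hyU), DProof.avg_RR_symm (U \ A) y z]
    congr 1
    funext x
    exact tsum_congr fun n => DProof.NN_bdry A U y hyU n x
  rw [q1, q2, p0, py, pe]
  set Q := (DProof.avgE (DProof.RR (U \ A) {z}) y).toReal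
  set e := 1 - (DProof.avgE (DProof.RR Aᶜ A) y).toReal
  set h0 := DProof.rr U {z} 0
  have hc : 0 < c₂ / K := by positivity
  by_cases he : e * h0 = 0
  · refine ⟨0, by simpa using hc.le, ?_, ?_, fun _ => rfl⟩ <;>
    · rw [he, mul_zero] at hest
      have := abs_nonpos_iff.mp hest
      rw [he]
      linarith
  · have hpos : 0 < e * h0 := by
      have h3 : 0 ≤ c₂ / K * (e * h0) := (abs_nonneg _).trans hest
      have h4 : 0 ≤ e * h0 := nonneg_of_mul_nonneg_right h3 hc
      exact lt_of_le_of_ne h4 (Ne.symm he)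
    have hQ : Q = e * h0 * (1 + (Q / (e * h0) - 1)) := by
      rw [add_sub_cancel, mul_div_cancel₀ _ he]
    refine ⟨Q / (e * h0) - 1, ?_, hQ, hQ, ?_⟩
    · have h5 : Q / (e * h0) - 1 = (Q - e * h0) / (e * h0) := by rw [sub_div, div_self he]
      rw [h5, abs_div, abs_of_pos hpos, div_le_iff₀ hpos]
      exact hest
    · intro h6
      exfalso
      rcases mul_eq_zero.mp h6 with h7 | h7
      · exact he (by rw [h7, zero_mul])
      · exact he (by rw [show h0 = 0 from hzero h7, mul_zero])
end
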